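/- Let m ≥ 1 and let q be a prime power with 3 dividing q+1; let F be the field with q elements. Then there exists a bijection between Irr_{3'}(GL_{2m+1}(F)) and the Cartesian product Irr(Fˣ) × Irr_{3'}(GL_{2m}(F)), where Fˣ is the multiplicative group of F. -/

import Mathlib

open scoped Classical
open Matrix

noncomputable section

/-- The set of irreducible complex characters of a group `G`. -/
def Irr (G : Type) [Group G] : Set (G → ℂ) :=
  {χ | ∃ V : FDRep ℂ G, CategoryTheory.Simple V ∧ FDRep.character V = χ}

/-- The set of irreducible complex characters of `G` whose degree is coprime to `p`. -/
def IrrCoprime (p : ℕ) (G : Type) [Group G] : Set (G → ℂ) :=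
  {χ | ∃ V : FDRep ℂ G, CategoryTheory.Simple V ∧ FDRep.character V = χ ∧
    Nat.Coprime (Module.finrank ℂ V) p}

namespace OEB

/-- Ring of formal complete symmetric functions. -/
abbrev Lam := MvPolynomial ℕ ℤ

def hL (k : ℤ) : Lam := if k < 0 then 0 else if k = 0 then 1 else MvPolynomial.X k.toNat

lemma hL_neg {k : ℤ} (h : k < 0) : hL k = 0 := by simp [hL, h]
lemma hL_zero : hL 0 = 1 := by simp [hL]
lemma hL_pos {k : ℕ} (h : k ≠ 0) : hL k = MvPolynomial.X k := by
  have : ¬ ((k : ℤ) < 0) := by omega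
  simp [hL, h]

/-- Algebra maps out of `Lam` prescribed on `hL`. -/
def lift {A : Type*} [CommRing A] (f : ℕ → A) : Lam →+* A :=
  (MvPolynomial.aeval f : Lam →ₐ[ℤ] A).toRingHom

def extZ {A : Type*} [Zero A] (f : ℕ → A) (k : ℤ) : A := if k < 0 then 0 else f k.toNat

lemma extZ_nat {A : Type*} [Zero A] (f : ℕ → A) (k : ℕ) : extZ f k = f k := by simp [extZ]
lemma extZ_neg {A : Type*} [Zero A] (f : ℕ → A) {k : ℤ} (h : k < 0) : extZ f k = 0 := by
  simp [extZ, h]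

lemma lift_hL {A : Type*} [CommRing A] (f : ℕ → A) (hf : f 0 = 1) (k : ℤ) :
    lift f (hL k) = extZ f k := by
  unfold hL extZ
  split_ifs with h1 h2
  · simp
  · subst h2; simp [hf]
  · simp [lift]

def tau : Lam →+* Polynomial Lam :=
  lift (fun s => ∑ i ∈ Finset.range (s + 1), Polynomial.monomial i (hL ((s : ℤ) - i)))

lemma tau_hL_coeff (k : ℤ) (i : ℕ) : (tau (hL k)).coeff i = hL (k - i) := by
  unfold tau
  rw [lift_hL]
  · by_cases hk : k < 0
    · rw [extZ_neg _ hk, hL_neg (by omega)]; simp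
    · obtain ⟨n, rfl⟩ := Int.eq_ofNat_of_zero_le (not_lt.mp hk)
      rw [extZ_nat]
      simp only [Polynomial.finsetSum_coeff, Polynomial.coeff_monomial]
      rw [Finset.sum_ite_eq' (Finset.range (n+1)) i]
      split_ifs with h
      · rfl
      · rw [hL_neg]; simp at h; omega
  · simp [hL_zero]

/-- recursively: complete homogeneous symmetric polynomials in `l` variables -/
def ev : (l : ℕ) → Lam →+* MvPolynomial (Fin l) ℤ
  | 0 => lift (fun s => if s = 0 then 1 else 0)
  | (l + 1) => ((MvPolynomial.finSuccEquiv ℤ l).symm.toRingEquiv.toRingHom).comp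
      ((Polynomial.mapRingHom (ev l)).comp tau)

lemma ev_succ_coeff (l : ℕ) (a : Lam) (g : Fin (l + 1) →₀ ℕ) :
    (ev (l + 1) a).coeff g = (ev l ((tau a).coeff (g 0))).coeff (g.tail) := by
  have h := MvPolynomial.finSuccEquiv_coeff_coeff (g.tail) (ev (l+1) a) (g 0)
  rw [Finsupp.cons_tail] at h
  rw [← h]
  simp [ev]

/-- generating series -/
def Hs (l : ℕ) : PowerSeries (MvPolynomial (Fin l) ℤ) := PowerSeries.mk fun s => ev l (hL s)

lemma Hs_zero : Hs 0 = 1 := by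
  ext s
  simp only [Hs, PowerSeries.coeff_mk, ev, PowerSeries.coeff_one]
  rw [lift_hL _ (by simp), extZ_nat]

lemma finSucc_ev (l : ℕ) (a : Lam) :
    MvPolynomial.finSuccEquiv ℤ l (ev (l + 1) a) = (tau a).map (ev l) := by
  simp [ev]

lemma finSucc_rename (l : ℕ) (p : MvPolynomial (Fin l) ℤ) :
    MvPolynomial.finSuccEquiv ℤ l (MvPolynomial.rename Fin.succ p) = Polynomial.C p := by
  induction p using MvPolynomial.induction_on with
  | C a => simp [MvPolynomial.finSuccEquiv_apply]
  | add p q hp hq => simp [hp, hq]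
  | mul_X p i hp => simp [hp, MvPolynomial.finSuccEquiv_X_succ]

lemma ev_succ_hL (l : ℕ) (k : ℤ) : ev (l + 1) (hL (k + 1)) =
    MvPolynomial.X 0 * ev (l+1) (hL k) + MvPolynomial.rename Fin.succ (ev l (hL (k + 1))) := by
  apply (MvPolynomial.finSuccEquiv ℤ l).injective
  rw [map_add, map_mul, MvPolynomial.finSuccEquiv_X_zero, finSucc_ev, finSucc_ev, finSucc_rename]
  ext1 i
  rcases i with _ | i
  · simp [tau_hL_coeff, Polynomial.coeff_C]
  · simp [tau_hL_coeff, Polynomial.coeff_C]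

lemma Hs_mul (l : ℕ) :
    Hs l * ∏ i : Fin l, (1 - PowerSeries.C (MvPolynomial.X i) * PowerSeries.X) = 1 := by
  induction l with
  | zero => simp [Hs_zero]
  | succ l ih =>
    rw [Fin.prod_univ_succ, ← mul_assoc]
    have h1 : Hs (l+1) * (1 - PowerSeries.C (MvPolynomial.X 0) * PowerSeries.X)
        = PowerSeries.map (MvPolynomial.rename Fin.succ : _ →ₐ[ℤ] MvPolynomial (Fin (l+1)) ℤ).toRingHom (Hs l) := by
      ext1 s
      rw [mul_sub, mul_one, ← mul_assoc, map_sub]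
      rcases s with _ | s
      · simp [Hs, hL_zero]
      · rw [PowerSeries.coeff_succ_mul_X, mul_comm, PowerSeries.coeff_C_mul]
        simp only [Hs, PowerSeries.coeff_mk, PowerSeries.coeff_map]
        push_cast
        rw [ev_succ_hL]
        simp
    rw [h1]
    have := congrArg (PowerSeries.map (MvPolynomial.rename Fin.succ : _ →ₐ[ℤ] MvPolynomial (Fin (l+1)) ℤ).toRingHom) ih
    simpa using this

end OEB

namespace OEB

/-- Schur functions indexed by beta-sequences -/
def sL {l : ℕ} (b : Fin l → ℤ) : Lam := Matrix.det (Matrix.of fun i j : Fin l => hL (b i - (j : ℕ)))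

lemma coeff_geom {R : Type*} [CommRing R] (x : R) (P : PowerSeries R)
    (h : P * (1 - PowerSeries.C x * PowerSeries.X) = 1) (c : ℕ) : PowerSeries.coeff c P = x ^ c := by
  have h0 : P = 1 + PowerSeries.C x * (P * PowerSeries.X) := by
    linear_combination h
  induction c with
  | zero => rw [h0]; simp
  | succ c ih =>
    rw [h0, map_add, PowerSeries.coeff_C_mul, PowerSeries.coeff_succ_mul_X, ih, PowerSeries.coeff_one]
    simp [pow_succ']

lemma jt_aux (l : ℕ) (k : Fin l) : ∃ g : Fin l → MvPolynomial (Fin l) ℤ, ∀ c : ℕ,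
    ∑ j : Fin l, ev l (hL ((c : ℤ) - (j : ℕ))) * g j = MvPolynomial.X k ^ c := by
  set Q : Polynomial (MvPolynomial (Fin l) ℤ) :=
    ∏ i ∈ Finset.univ.erase k, (1 - Polynomial.C (MvPolynomial.X i) * Polynomial.X) with hQ
  have hdeg : Q.natDegree < l := by
    have h1 : Q.natDegree ≤ ∑ i ∈ Finset.univ.erase k, 1 := by
      refine (Polynomial.natDegree_prod_le _ _).trans (Finset.sum_le_sum fun i _ => ?_)
      compute_degree
    have h2 : (Finset.univ.erase k).card = l - 1 := by simp
    have := k.pos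
    simp only [Finset.sum_const, smul_eq_mul, mul_one] at h1
    omega
  have hQ2 : (Q : PowerSeries (MvPolynomial (Fin l) ℤ)) =
      ∏ i ∈ Finset.univ.erase k, (1 - PowerSeries.C (MvPolynomial.X i) * PowerSeries.X) := by
    rw [hQ, ← Polynomial.coeToPowerSeries.ringHom_apply, map_prod]
    simp
  have h1 : (Hs l * (Q : PowerSeries _)) * (1 - PowerSeries.C (MvPolynomial.X k) * PowerSeries.X) = 1 := by
    rw [hQ2, mul_assoc, Finset.prod_erase_mul _ _ (Finset.mem_univ k)]
    exact Hs_mul l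
  refine ⟨fun j => Q.coeff j, fun c => ?_⟩
  rw [← coeff_geom _ _ h1 c, mul_comm (Hs l), PowerSeries.coeff_mul]
  rw [Finset.Nat.sum_antidiagonal_eq_sum_range_succ_mk]
  simp only [Polynomial.coeff_coe, Hs, PowerSeries.coeff_mk]
  have e1 : ∑ j ∈ Finset.range (l + c + 1), ev l (hL ((c : ℤ) - (j : ℕ))) * Q.coeff j =
      ∑ j ∈ Finset.range l, ev l (hL ((c : ℤ) - (j : ℕ))) * Q.coeff j := by
    symm
    apply Finset.sum_subset
    · intro x; simp; omega
    · intro x _ hx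
      rw [Polynomial.coeff_eq_zero_of_natDegree_lt, mul_zero]
      simp at hx; omega
  have e2 : ∑ j ∈ Finset.range (l + c + 1), ev l (hL ((c : ℤ) - (j : ℕ))) * Q.coeff j =
      ∑ j ∈ Finset.range (c + 1), ev l (hL ((c : ℤ) - (j : ℕ))) * Q.coeff j := by
    symm
    apply Finset.sum_subset
    · intro x; simp; omega
    · intro x _ hx
      rw [hL_neg, map_zero, zero_mul]
      simp at hx; omega
  rw [e2, Finset.sum_range (n := l)] at e1
  rw [← e1]
  refine Finset.sum_congr rfl fun x hx => ?_
  rw [mul_comm, Nat.cast_sub (by simp at hx; omega)]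

lemma jacobi_trudi {l : ℕ} (b : Fin l → ℕ) :
    ev l (sL fun i => (b i : ℤ)) *
      Matrix.det (Matrix.of fun i k : Fin l => (MvPolynomial.X k : MvPolynomial (Fin l) ℤ) ^ (i : ℕ))
    = Matrix.det (Matrix.of fun i k : Fin l => (MvPolynomial.X k : MvPolynomial (Fin l) ℤ) ^ (b i)) := by
  choose g hg using jt_aux l
  have key : ∀ b : Fin l → ℕ, ev l (sL fun i => (b i : ℤ)) * Matrix.det (Matrix.of fun j k => g k j) =
      Matrix.det (Matrix.of fun i k : Fin l => (MvPolynomial.X k : MvPolynomial (Fin l) ℤ) ^ (b i)) := by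
    intro b
    rw [sL, RingHom.map_det, ← Matrix.det_mul]
    congr 1
    ext1 i k
    simp [Matrix.mul_apply, hg]
  have h1 : sL (fun i : Fin l => ((i : ℕ) : ℤ)) = 1 := by
    rw [sL, Matrix.det_of_isLowerTriangular]
    · simp [hL_zero]
    · intro i j hij
      have : i < j := hij
      simp only [Matrix.of_apply]
      rw [hL_neg]
      have : (i : ℕ) < j := this
      omega
  have h2 := key (fun i => i)
  rw [h1, map_one, one_mul] at h2
  rw [← h2, key]

lemma coeff_det {R : Type*} [CommRing R] {l : ℕ} (f : Fin l → Fin l → ℕ → R) (r : ℕ) :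
    PowerSeries.coeff r (Matrix.det (Matrix.of fun i j => PowerSeries.mk (f i j))) =
    ∑ κ ∈ Finset.finsuppAntidiag (Finset.univ : Finset (Fin l)) r,
      Matrix.det (Matrix.of fun i j => f i j (κ i)) := by
  rw [Matrix.det_apply']
  simp only [map_sum]
  simp_rw [Matrix.det_apply']
  rw [Finset.sum_comm]
  refine Finset.sum_congr rfl fun σ _ => ?_
  have : ((Equiv.Perm.sign σ : ℤ) : PowerSeries R) = PowerSeries.C ((Equiv.Perm.sign σ : ℤ) : R) := by simp
  rw [this, PowerSeries.coeff_C_mul, ← Finset.mul_sum]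
  congr 1
  have e : ∏ i, (Matrix.of fun i j => PowerSeries.mk (f i j)) (σ i) i =
    ∏ i, PowerSeries.mk (f i (σ⁻¹ i)) := by
    refine Fintype.prod_equiv σ _ _ (fun i => ?_)
    simp
  rw [e, PowerSeries.coeff_prod]
  refine Finset.sum_congr rfl fun κ _ => ?_
  simp only [PowerSeries.coeff_mk, Matrix.of_apply]
  refine (Fintype.prod_equiv σ _ _ (fun i => ?_)).symm
  simp

lemma pieri {l : ℕ} (b : Fin (l+1) → ℤ) (hb : b 0 = 0) (r : ℕ) :
    hL r * sL b = ∑ κ ∈ Finset.finsuppAntidiag (Finset.univ : Finset (Fin (l+1))) r,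
      sL (fun i => b i + (κ i : ℕ)) := by
  set G : Matrix (Fin (l+1)) (Fin (l+1)) (PowerSeries Lam) :=
    Matrix.of fun i j => PowerSeries.mk fun k => hL (b i - (j : ℕ) + k) with hG
  set G' : Matrix (Fin (l+1)) (Fin (l+1)) (PowerSeries Lam) :=
    Matrix.of fun i j => if j = 0 then PowerSeries.mk fun k => hL (b i + k) else PowerSeries.C (hL (b i - (j : ℕ))) with hG'
  have h1 : G.det = G'.det := by
    apply Matrix.det_eq_of_forall_col_eq_smul_add_pred (fun _ => PowerSeries.X)
    · intro i
      simp [hG, hG']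
    · intro i j
      ext1 k
      have hj : (j.succ : Fin (l+1)) ≠ 0 := Fin.succ_ne_zero j
      rcases k with _ | k
      · simp [hG, hG', hj]
      · simp only [hG, hG', Matrix.of_apply, if_neg hj, map_add, PowerSeries.coeff_succ_X_mul, PowerSeries.coeff_C, PowerSeries.coeff_mk]
        simp
        congr 1
        ring_nf
  have h2 : G'.det = (PowerSeries.mk fun k => hL (k : ℤ)) * PowerSeries.C (sL b) := by
    have e1 : sL b = Matrix.det (Matrix.submatrix (Matrix.of fun i j : Fin (l+1) => hL (b i - (j : ℕ))) Fin.succ Fin.succ) := by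
      rw [sL, Matrix.det_succ_row_zero, Fin.sum_univ_succ, Finset.sum_eq_zero]
      · simp [hb, hL_zero]
      · intro i _
        simp only [Matrix.of_apply]
        rw [hb, hL_neg (by simp; omega)]; simp
    rw [e1, RingHom.map_det, Matrix.det_succ_row_zero, Fin.sum_univ_succ, Finset.sum_eq_zero]
    · simp [hG', hb]
      left
      congr 1
    · intro i _
      simp only [hG', Matrix.of_apply]
      rw [hb, if_neg (Fin.succ_ne_zero i), hL_neg (by simp; omega)]; simp
  have h3 := congrArg (PowerSeries.coeff r) (h1.trans h2)
  rw [hG, coeff_det, PowerSeries.coeff_mul_C, PowerSeries.coeff_mk] at h3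
  rw [← h3]
  refine Finset.sum_congr rfl fun κ _ => ?_
  rw [sL]
  congr 1
  ext i j : 3
  simp only [Matrix.of_apply]
  congr 1
  ring_nf

end OEB

namespace OEB

/-- `∏_{i=1}^n (q^i-1)` -/
def phi (q : ℕ) (n : ℕ) : ℚ := ∏ i ∈ Finset.range n, ((q : ℚ) ^ (i + 1) - 1)

/-- pairing on free abelian group -/
def ip {B : Type} : (B →₀ ℤ) →ₗ[ℤ] (B →₀ ℤ) →ₗ[ℤ] ℤ :=
  Finsupp.linearCombination ℤ (fun b => (Finsupp.lapply b : (B →₀ ℤ) →ₗ[ℤ] ℤ))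

lemma ip_single {B : Type} (b : B) (x : ℤ) (w : B →₀ ℤ) : ip (Finsupp.single b x) w = x * w b := by
  simp [ip]

lemma ip_apply {B : Type} (v w : B →₀ ℤ) : ip v w = v.sum fun b x => x * w b := by
  simp [ip, Finsupp.linearCombination_apply, Finsupp.sum]

lemma ip_single_right {B : Type} (b : B) (x : ℤ) (w : B →₀ ℤ) : ip w (Finsupp.single b x) = w b * x := by
  induction w using Finsupp.induction_linear with
  | zero => simp
  | add v w hv hw => simp [hv, hw, add_mul]
  | single a y =>
    rw [ip_single]
    by_cases h : a = b
    · subst h; simp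
    · simp [h, Ne.symm h]

lemma ip_comm {B : Type} (v w : B →₀ ℤ) : ip v w = ip w v := by
  induction v using Finsupp.induction_linear with
  | zero => simp
  | add v v' hv hv' => simp [hv, hv']
  | single a y => rw [ip_single, ip_single_right, mul_comm]

lemma ip_self_eq_zero {B : Type} (v : B →₀ ℤ) (h : ip v v = 0) : v = 0 := by
  rw [ip_apply, Finsupp.sum, Finset.sum_eq_zero_iff_of_nonneg (fun b _ => mul_self_nonneg _)] at h
  ext b
  by_contra hb
  exact hb (mul_self_eq_zero.mp (h b (Finsupp.mem_support_iff.mpr hb)))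

lemma ip_self_one {B : Type} (v : B →₀ ℤ) (h : ip v v = 1) :
    ∃ b, v = Finsupp.single b 1 ∨ v = - Finsupp.single b 1 := by
  have hne : v ≠ 0 := by rintro rfl; simp at h
  obtain ⟨b, hb⟩ := Finsupp.ne_iff.mp hne
  simp only [Finsupp.coe_zero, Pi.zero_apply] at hb
  have hd : v = Finsupp.single b (v b) + v.erase b := (Finsupp.single_add_erase b v).symm
  have hz : ip (v.erase b) (v.erase b) + v b * v b = 1 := by
    rw [← h]
    conv_rhs => rw [hd]
    simp only [map_add, LinearMap.add_apply, ip_single, ip_single_right]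
    simp; ring
  have hp : 0 ≤ ip (v.erase b) (v.erase b) := by
    rw [ip_apply]; exact Finset.sum_nonneg fun b _ => mul_self_nonneg _
  have h1 : 1 ≤ v b * v b := by
    have := mul_self_pos.mpr hb
    omega
  have h2 : v b * v b = 1 := by omega
  have h3 := ip_self_eq_zero (v.erase b) (by omega)
  rw [h3, add_zero] at hd
  refine ⟨b, ?_⟩
  rcases mul_self_eq_one_iff.mp h2 with h4 | h4
  · left; rw [hd, h4]
  · right; rw [hd, h4]; simp

/-- Zelevinsky-type structure. -/
structure PSH (L B : Type) (q : ℕ) where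
  deg : B → ℕ
  d : B → ℕ
  h : L → ℤ → Module.End ℤ (B →₀ ℤ)
  e : L → ℕ → Module.End ℤ (B →₀ ℤ)
  h_neg : ∀ l k, k < 0 → h l k = 0
  h_zero : ∀ l, h l 0 = 1
  e_zero : ∀ l, e l 0 = 1
  adj : ∀ l (r : ℕ) b b', (h l r (Finsupp.single b 1)) b' = (e l r (Finsupp.single b' 1)) b
  mackey : ∀ l l' (s : ℕ) t v, e l t (h l' s v) =
    ∑ i ∈ Finset.range (t + 1), if l = l' ∨ i = 0 then h l' (s - i) (e l (t - i) v) else 0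
  deg_h : ∀ l (r : ℕ) b b', (h l r (Finsupp.single b 1)) b' ≠ 0 → deg b' = deg b + r
  pos : ∀ l (r : ℕ) b b', 0 ≤ (h l r (Finsupp.single b 1)) b'
  dpos : ∀ b, 0 < d b
  dim : ∀ l (r : ℕ) b, (h l r (Finsupp.single b 1)).sum (fun b x => (x : ℚ) * (d b / phi q (deg b)))
    = (d b / phi q (deg b)) / phi q r

namespace PSH

variable {L B : Type} {q : ℕ} (Z : PSH L B q)

lemma adj' (l : L) (r : ℕ) (v w : B →₀ ℤ) : ip (Z.h l r v) w = ip v (Z.e l r w) := by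
  induction v using Finsupp.induction_linear with
  | zero => simp
  | add v v' hv hv' => simp [hv, hv']
  | single a y =>
    induction w using Finsupp.induction_linear with
    | zero => simp
    | add v v' hv hv' => simp [hv, hv']
    | single b x =>
      have e1 : Finsupp.single a y = y • Finsupp.single a (1:ℤ) := by simp
      have e2 : Finsupp.single b x = x • Finsupp.single b (1:ℤ) := by simp
      rw [e1, e2]
      simp only [map_smul, LinearMap.smul_apply, ip_single, ip_single_right, Z.adj]
      simp

/-- supported in degrees `< n` -/
def Low (n : ℕ) (v : B →₀ ℤ) : Prop := ∀ b, v b ≠ 0 → Z.deg b < n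

lemma deg_e (l : L) (r : ℕ) (v : B →₀ ℤ) (b : B) (hb : (Z.e l r v) b ≠ 0) :
    ∃ b', v b' ≠ 0 ∧ Z.deg b' = Z.deg b + r := by
  have h1 : (Z.e l r v) b = ip (Finsupp.single b 1) (Z.e l r v) := by simp [ip_single]
  rw [h1, ← Z.adj', ip_apply, Finsupp.sum] at hb
  obtain ⟨b', _, hb'⟩ := Finset.exists_ne_zero_of_sum_ne_zero hb
  exact ⟨b', right_ne_zero_of_mul hb', Z.deg_h l r b b' (left_ne_zero_of_mul hb')⟩

lemma low_e {n : ℕ} {v : B →₀ ℤ} (hv : Z.Low (n+1) v) (l : L) (r : ℕ) (hr : r ≠ 0) : Z.Low n (Z.e l r v) := by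
  intro b hb
  obtain ⟨b', h1, h2⟩ := Z.deg_e l r v b hb
  have := hv b' h1
  omega

lemma low_zero {v : B →₀ ℤ} (hv : Z.Low 0 v) : v = 0 := by
  ext b; by_contra hb; exact absurd (hv b hb) (by omega)

lemma exists_low (v : B →₀ ℤ) : ∃ n, Z.Low n v := by
  refine ⟨v.support.sup Z.deg + 1, fun b hb => ?_⟩
  have := Finset.le_sup (f := Z.deg) (Finsupp.mem_support_iff.mpr hb)
  omega

def E (l : L) : PowerSeries (Module.End ℤ (B →₀ ℤ)) := PowerSeries.mk (Z.e l)
def Ht (l l' : L) (s : ℤ) : PowerSeries (Module.End ℤ (B →₀ ℤ)) :=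
  PowerSeries.mk fun i => if l = l' ∨ i = 0 then Z.h l' (s - i) else 0

lemma E_mul (l l' : L) (s : ℤ) : Z.E l * PowerSeries.C (Z.h l' s) = Z.Ht l l' s * Z.E l := by
  ext1 t
  rw [PowerSeries.coeff_mul_C, PowerSeries.coeff_mul, Finset.Nat.sum_antidiagonal_eq_sum_range_succ_mk]
  simp only [E, Ht, PowerSeries.coeff_mk]
  by_cases hs : s < 0
  · rw [Z.h_neg _ _ hs, mul_zero, Finset.sum_eq_zero]
    intro i _
    rw [Z.h_neg _ _ (by omega)]; simp
  · obtain ⟨n, rfl⟩ := Int.eq_ofNat_of_zero_le (not_lt.mp hs)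
    refine LinearMap.ext fun v => ?_
    rw [Module.End.mul_apply, Z.mackey, LinearMap.sum_apply]
    refine Finset.sum_congr rfl fun i _ => ?_
    split_ifs <;> simp

lemma h_comm_aux (N : ℕ) : ∀ (l l' : L) (r s : ℤ), r + s < N → Z.h l r * Z.h l' s = Z.h l' s * Z.h l r := by
  induction N with
  | zero =>
    intro l l' r s hrs
    rcases lt_or_ge r 0 with h | h
    · simp [Z.h_neg _ _ h]
    · simp [Z.h_neg l' s (by push_cast at hrs; omega)]
  | succ N ih =>
    intro l l' r s hrs
    rcases lt_trichotomy r 0 with h | h | hr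
    · simp [Z.h_neg _ _ h]
    · subst h; simp [Z.h_zero]
    rcases lt_trichotomy s 0 with h | h | hs
    · simp [Z.h_neg _ _ h]
    · subst h; simp [Z.h_zero]
    set X := Z.h l r * Z.h l' s - Z.h l' s * Z.h l r with hX
    have key : ∀ l'', Z.E l'' * PowerSeries.C X = PowerSeries.C X * Z.E l'' := by
      intro l''
      have e1 : Z.Ht l'' l r * Z.Ht l'' l' s - Z.Ht l'' l' s * Z.Ht l'' l r = PowerSeries.C X := by
        ext1 k
        rw [map_sub, PowerSeries.coeff_mul, PowerSeries.coeff_mul]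
        rcases Nat.eq_zero_or_pos k with hk | hk
        · subst hk; simp [Ht, hX]
        · rw [PowerSeries.coeff_C, if_neg (by omega), sub_eq_zero, ← Finset.sum_equiv (Equiv.prodComm ℕ ℕ) (s := Finset.HasAntidiagonal.antidiagonal k) (t := Finset.HasAntidiagonal.antidiagonal k) (g := fun p => (PowerSeries.coeff p.1 (Z.Ht l'' l' s)) * PowerSeries.coeff p.2 (Z.Ht l'' l r)) (f := fun p => (PowerSeries.coeff p.2 (Z.Ht l'' l' s)) * PowerSeries.coeff p.1 (Z.Ht l'' l r))]
          · refine Finset.sum_congr rfl fun p hp => ?_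
            rw [Finset.HasAntidiagonal.mem_antidiagonal] at hp
            simp only [Ht, PowerSeries.coeff_mk]
            split_ifs <;> try simp only [mul_zero, zero_mul]
            apply ih
            push_cast at hrs
            omega
          · intro p; simp [add_comm]
          · intro p _; simp
      conv_rhs => rw [← e1, sub_mul]
      rw [hX, map_sub, mul_sub, map_mul, map_mul, ← mul_assoc, ← mul_assoc, E_mul, E_mul,
        mul_assoc, E_mul, mul_assoc, E_mul]
      simp only [mul_assoc]
    have key2 : ∀ l'' t v, Z.e l'' t (X v) = X (Z.e l'' t v) := by
      intro l'' t v
      have := congrArg (PowerSeries.coeff t) (key l'')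
      rw [PowerSeries.coeff_mul_C, PowerSeries.coeff_C_mul] at this
      simp only [E, PowerSeries.coeff_mk] at this
      exact congrArg (fun f => f v) this
    have fin : ∀ n v, Z.Low n v → X v = 0 := by
      intro n
      induction n with
      | zero => intro v hv; rw [Z.low_zero hv]; simp
      | succ n ih2 =>
        intro v hv
        apply ip_self_eq_zero
        have hz : ∀ (l'' : L) (t : ℤ) w, 0 < t → ip (Z.h l'' t w) (X v) = 0 := by
          intro l'' t w ht
          obtain ⟨m, rfl⟩ := Int.eq_ofNat_of_zero_le ht.le
          rw [Z.adj', key2, ih2, map_zero]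
          exact Z.low_e hv _ _ (by omega)
        conv_lhs => enter [1]; rw [hX]
        simp only [LinearMap.sub_apply, Module.End.mul_apply, map_sub]
        rw [hz _ _ _ hr, hz _ _ _ hs]; simp
    rw [← sub_eq_zero]
    refine LinearMap.ext fun v => ?_
    obtain ⟨n, hn⟩ := Z.exists_low v
    exact fin n v hn

lemma h_comm (l l' : L) (r s : ℤ) : Z.h l r * Z.h l' s = Z.h l' s * Z.h l r :=
  Z.h_comm_aux ((r+s).toNat + 1) l l' r s (by push_cast; omega)

lemma e_comm (l l' : L) (r s : ℕ) (v : B →₀ ℤ) : Z.e l r (Z.e l' s v) = Z.e l' s (Z.e l r v) := by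
  rw [← sub_eq_zero]
  apply ip_self_eq_zero
  have : ∀ w, ip w (Z.e l r (Z.e l' s v) - Z.e l' s (Z.e l r v)) = 0 := by
    intro w
    rw [map_sub, ← Z.adj', ← Z.adj', ← Z.adj', ← Z.adj', ← Module.End.mul_apply, ← Module.End.mul_apply,
      Z.h_comm, sub_self]
  exact this _

/-- The action of `Lam` by the operators `h l`. -/
def act (l : L) : Lam →+* Module.End ℤ (B →₀ ℤ) :=
  letI : CommRing (Algebra.adjoin ℤ (Set.range fun n : ℕ => Z.h l n)) :=
    Algebra.adjoinCommRingOfComm ℤ (by rintro _ ⟨a, rfl⟩ _ ⟨b, rfl⟩; exact Z.h_comm l l a b)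
  ((Algebra.adjoin ℤ (Set.range fun n : ℕ => Z.h l n)).subtype).comp
    (lift (fun n => (⟨Z.h l n, Algebra.subset_adjoin ⟨n, rfl⟩⟩ : Algebra.adjoin ℤ (Set.range fun n : ℕ => Z.h l n))))

lemma act_X (l : L) (n : ℕ) : Z.act l (MvPolynomial.X n) = Z.h l n := by
  simp [act, lift]
  rfl

lemma act_hL (l : L) (k : ℤ) : Z.act l (hL k) = Z.h l k := by
  unfold hL
  split_ifs with h1 h2
  · rw [Z.h_neg _ _ h1]; simp
  · rw [h2, Z.h_zero]; simp
  · rw [act_X, Int.toNat_of_nonneg (by omega)]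

lemma act_comm_of (l : L) (x : Module.End ℤ (B →₀ ℤ)) (hx : ∀ n : ℕ, Z.h l n * x = x * Z.h l n) (a : Lam) :
    Z.act l a * x = x * Z.act l a := by
  induction a using MvPolynomial.induction_on with
  | C a => simpa using (Int.cast_commute a x).eq
  | add p q hp hq => simp [add_mul, mul_add, hp, hq]
  | mul_X p n hp => rw [map_mul, act_X, mul_assoc, hx, ← mul_assoc, hp, mul_assoc]

lemma act_comm (l l' : L) (a a' : Lam) : Z.act l a * Z.act l' a' = Z.act l' a' * Z.act l a := by
  apply act_comm_of
  intro n
  symm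
  apply act_comm_of
  intro m
  exact Z.h_comm _ _ _ _

lemma E_act (l : L) (a : Lam) : Z.E l * PowerSeries.C (Z.act l a) =
    PowerSeries.map (Z.act l) ((tau a : Polynomial Lam) : PowerSeries Lam) * Z.E l := by
  induction a using MvPolynomial.induction_on with
  | C a =>
    have h1 : ((tau (MvPolynomial.C a) : Polynomial Lam) : PowerSeries Lam) = (a : PowerSeries Lam) := by
      rw [← Polynomial.coeToPowerSeries.ringHom_apply]; simp
    rw [h1]
    simpa using (Int.cast_commute a (Z.E l)).eq.symm
  | add p q hp hq => simp [add_mul, mul_add, hp, hq]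
  | mul_X p n hp =>
    rw [map_mul, map_mul, ← mul_assoc, hp, mul_assoc, act_X, E_mul, map_mul, Polynomial.coe_mul, map_mul, mul_assoc]
    congr 2
    ext1 i
    simp only [Ht, PowerSeries.coeff_mk, PowerSeries.coeff_map, Polynomial.coeff_coe]
    simp only [true_or, if_true]
    by_cases hn : n = 0
    · subst hn
      have : tau (MvPolynomial.X 0) = tau (hL 0) := by simp [tau, lift, hL_zero]
      rw [this, tau_hL_coeff, act_hL]; simp
    · rw [← hL_pos hn, tau_hL_coeff, act_hL]

def Free (l : L) (v : B →₀ ℤ) : Prop := ∀ r, r ≠ 0 → Z.e l r v = 0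

lemma e_act_free (l : L) (a : Lam) (v : B →₀ ℤ) (hv : Z.Free l v) (r : ℕ) :
    Z.e l r (Z.act l a v) = Z.act l ((tau a).coeff r) v := by
  have := congrArg (PowerSeries.coeff r) (Z.E_act l a)
  rw [PowerSeries.coeff_mul_C, PowerSeries.coeff_mul] at this
  simp only [E, PowerSeries.coeff_mk, PowerSeries.coeff_map, Polynomial.coeff_coe] at this
  have h2 := congrArg (fun f => f v) this
  simp only [Module.End.mul_apply, LinearMap.sum_apply] at h2
  rw [h2, Finset.sum_eq_single (r, 0)]
  · simp [Z.e_zero]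
  · rintro ⟨i, j⟩ hij hne
    rw [Finset.HasAntidiagonal.mem_antidiagonal] at hij
    rw [hv j, map_zero]
    rintro rfl
    apply hne; simp at hij; simp [hij]
  · intro h; simp at h

lemma e_comm_act (l l' : L) (hl : l ≠ l') (a : Lam) (v : B →₀ ℤ) (r : ℕ) :
    Z.e l r (Z.act l' a v) = Z.act l' a (Z.e l r v) := by
  have := Z.act_comm_of l' (Z.e l r) ?_ a
  · exact (congrArg (fun f => f v) this).symm
  · intro n
    refine LinearMap.ext fun v => ?_
    rw [Module.End.mul_apply, Module.End.mul_apply, Z.mackey, Finset.sum_eq_single 0]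
    · simp
    · intro i _ hi; rw [if_neg]; simp [hl, hi]
    · simp

lemma ip_ev (l : L) (v v' : B →₀ ℤ) (hv : Z.Free l v) (hv' : Z.Free l v') (k : ℕ) :
    ∀ (γ : Fin k →₀ ℕ) (a : Lam), ip (Z.act l (∏ j, hL (γ j)) v') (Z.act l a v) = (ev k a).coeff γ * ip v' v := by
  induction k with
  | zero =>
    intro γ a
    have hγ : γ = 0 := Subsingleton.elim _ _
    subst hγ
    simp only [Finset.univ_eq_empty, Finset.prod_empty, map_one, Module.End.one_apply]
    induction a using MvPolynomial.induction_on with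
    | C a =>
      have h1 : Z.act l (MvPolynomial.C a) = a • 1 := by simp
      have h2 : ev 0 (MvPolynomial.C a) = MvPolynomial.C a := by simp
      rw [h1, h2, MvPolynomial.coeff_C]
      simp
    | add p q hp hq => simp [add_mul, hp, hq]
    | mul_X p n hp =>
      rw [mul_comm, map_mul, act_X, Module.End.mul_apply, ip_comm, Z.adj', ip_comm, map_mul]
      by_cases hn : n = 0
      · subst hn; rw [Z.e_zero, Module.End.one_apply, hp]; simp [ev, lift]
      · rw [hv' n hn]
        simp [ev, lift, hn]
  | succ k ih =>
    intro γ a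
    rw [Fin.prod_univ_succ, map_mul, Module.End.mul_apply, act_hL, Z.adj', e_act_free _ _ _ _ hv]
    have := ih γ.tail ((tau a).coeff (γ 0))
    rw [ev_succ_coeff, ← this]
    simp [Finsupp.tail_apply]

end PSH
end OEB

namespace OEB

lemma det_fact {k : ℕ} (x c : Fin k → ℚ) (u w : ℕ → ℚ) (M : Matrix (Fin k) (Fin k) ℚ)
    (hM : ∀ i j, M i j = c i * w j * ∏ t ∈ Finset.range j, (x i - u t)) :
    M.det = (∏ i, c i) * (∏ j : Fin k, w j) * ∏ i : Fin k, ∏ j ∈ Finset.Ioi i, (x j - x i) := by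
  have h1 := Matrix.det_eval_matrixOfPolynomials_eq_det_vandermonde x
    (fun j : Fin k => ∏ t ∈ Finset.range j, (Polynomial.X - Polynomial.C (u t)))
    (fun i => by rw [Polynomial.natDegree_prod_of_monic _ _ (fun i _ => Polynomial.monic_X_sub_C _)]; simp)
    (fun i => Polynomial.monic_prod_of_monic _ _ (fun i _ => Polynomial.monic_X_sub_C _))
  rw [Matrix.det_vandermonde] at h1
  rw [h1]
  have h2 : M = Matrix.of fun i j => c i * (Matrix.of fun i (j : Fin k) => w j * (Matrix.of fun i j : Fin k => Polynomial.eval (x i)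
    (∏ t ∈ Finset.range j, (Polynomial.X - Polynomial.C (u t)))) i j) i j := by
    ext i j
    simp [hM, Polynomial.eval_prod, mul_assoc]
  rw [h2, Matrix.det_mul_column, Matrix.det_mul_row, mul_assoc]

lemma sL_id {l : ℕ} : sL (fun i : Fin l => ((i : ℕ) : ℤ)) = 1 := by
  rw [sL, Matrix.det_of_isLowerTriangular]
  · simp [hL_zero]
  · intro i j hij
    have : i < j := hij
    simp only [Matrix.of_apply]
    rw [hL_neg]
    have : (i : ℕ) < j := this
    omega

lemma sL_expand {k : ℕ} (c : Fin k → ℤ) : sL c = ∑ σ : Equiv.Perm (Fin k),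
    ((Equiv.Perm.sign σ : ℤ) : Lam) * ∏ i, hL (c i - (σ i : ℕ)) := by
  rw [sL, ← Matrix.det_transpose, Matrix.det_apply']
  rfl

lemma sum_sign_coeff {k : ℕ} (b c : Fin k → ℕ) (hb : StrictMono b) (hc : StrictMono c) :
    (Matrix.det (Matrix.of fun i j : Fin k => (MvPolynomial.X j : MvPolynomial (Fin k) ℤ) ^ (b i))).coeff
      (Finsupp.equivFunOnFinite.symm c) = if b = c then 1 else 0 := by
  rw [Matrix.det_apply', MvPolynomial.coeff_sum]
  have h1 : ∀ σ : Equiv.Perm (Fin k), MvPolynomial.coeff (Finsupp.equivFunOnFinite.symm c)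
      (((Equiv.Perm.sign σ : ℤ) : MvPolynomial (Fin k) ℤ) *
      ∏ i, (Matrix.of fun i j : Fin k => (MvPolynomial.X j : MvPolynomial (Fin k) ℤ) ^ (b i)) (σ i) i)
      = if σ = 1 ∧ b = c then 1 else 0 := by
    intro σ
    have e1 : ∏ i, (Matrix.of fun i j : Fin k => (MvPolynomial.X j : MvPolynomial (Fin k) ℤ) ^ (b i)) (σ i) i
      = MvPolynomial.monomial (Finsupp.equivFunOnFinite.symm (fun i => b (σ i))) 1 := by
      rw [MvPolynomial.monomial_eq]
      simp [Finsupp.prod_fintype]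
    have e2 : ((Equiv.Perm.sign σ : ℤ) : MvPolynomial (Fin k) ℤ) = MvPolynomial.C (Equiv.Perm.sign σ : ℤ) := by simp
    rw [e1, e2, MvPolynomial.coeff_C_mul, MvPolynomial.coeff_monomial]
    by_cases h : (fun i => b (σ i)) = c
    · have hbc : b = c := by
        rw [← hb.range_inj hc, ← h]
        exact (EquivLike.range_comp b σ).symm
      have hσ : σ = 1 := by
        ext i
        have := congrFun h i
        rw [← hbc] at this
        simp [hb.injective this]
      simp [hσ, hbc]
    · have : ¬ (σ = 1 ∧ b = c) := by
        rintro ⟨rfl, rfl⟩; exact h rfl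
      rw [if_neg this, if_neg, mul_zero]
      intro h'
      exact h (Finsupp.equivFunOnFinite.symm.injective h')
  simp_rw [h1]
  by_cases hbc : b = c
  · simp [hbc]
  · simp [hbc]

namespace PSH

variable {L B : Type} {q : ℕ} (Z : PSH L B q)

lemma ip_sL (l : L) (v v' : B →₀ ℤ) (hv : Z.Free l v) (hv' : Z.Free l v') {k : ℕ} (b c : Fin k → ℕ)
    (hb : StrictMono b) (hc : StrictMono c) :
    ip (Z.act l (sL fun i => (c i : ℤ)) v') (Z.act l (sL fun i => (b i : ℤ)) v) =
      (if b = c then 1 else 0) * ip v' v := by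
  set a := sL fun i => (b i : ℤ) with ha
  rw [← sum_sign_coeff b c hb hc, ← jacobi_trudi, sL_expand, ← ha, Matrix.det_apply',
    Finset.mul_sum, MvPolynomial.coeff_sum, map_sum, LinearMap.sum_apply, map_sum, LinearMap.sum_apply, Finset.sum_mul]
  refine Finset.sum_congr rfl fun σ _ => ?_
  have e1 : ∏ i, (Matrix.of fun i j : Fin k => (MvPolynomial.X j : MvPolynomial (Fin k) ℤ) ^ (i : ℕ)) (σ i) i
      = MvPolynomial.monomial (Finsupp.equivFunOnFinite.symm (fun i => (σ i : ℕ))) 1 := by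
    rw [MvPolynomial.monomial_eq]
    simp [Finsupp.prod_fintype]
  have e2 : ((Equiv.Perm.sign σ : ℤ) : MvPolynomial (Fin k) ℤ) = MvPolynomial.C (Equiv.Perm.sign σ : ℤ) := by simp
  have e3 : ∀ w, Z.act l (((Equiv.Perm.sign σ : ℤ) : Lam) * ∏ i, hL ((c i : ℤ) - (σ i : ℕ))) w =
      (Equiv.Perm.sign σ : ℤ) • Z.act l (∏ i, hL ((c i : ℤ) - (σ i : ℕ))) w := by
    intro w
    rw [map_mul, map_intCast, Module.End.mul_apply]
    simp
  rw [e1, e2, e3, mul_left_comm, MvPolynomial.coeff_C_mul, map_smul, LinearMap.smul_apply, smul_eq_mul, mul_assoc]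
  congr 1
  rw [MvPolynomial.coeff_mul_monomial', mul_one]
  split_ifs with h
  · rw [← Z.ip_ev l v v' hv hv']
    congr 4
    refine Finset.prod_congr rfl fun i _ => ?_
    have := h i
    simp at this
    congr 1
    simp [Nat.cast_sub this]
  · have : ∃ i, c i < σ i := by
      by_contra h'
      push Not at h'
      exact h (fun i => by simpa using h' i)
    obtain ⟨i, hi⟩ := this
    rw [Finset.prod_eq_zero (Finset.mem_univ i), map_zero]
    · simp
    · apply hL_neg; omega

end PSH

def theta (q : ℕ) : Lam →+* ℚ := lift (fun n => (phi q n)⁻¹)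

lemma phi_pos {q : ℕ} (hq : 2 ≤ q) (n : ℕ) : 0 < phi q n := by
  refine Finset.prod_pos fun i _ => ?_
  rw [sub_pos]
  exact one_lt_pow₀ (by exact_mod_cast hq) (by omega)

lemma theta_hL {q : ℕ} (hq : 2 ≤ q) (b j : ℕ) : theta q (hL ((b : ℤ) - j)) =
    (phi q b)⁻¹ * (∏ t ∈ Finset.range j, ((q : ℚ) ^ t)⁻¹) * ∏ t ∈ Finset.range j, ((q : ℚ) ^ b - (q : ℚ) ^ t) := by
  have hq0 : (q : ℚ) ≠ 0 := by positivity
  rw [theta, lift_hL _ (by simp [phi])]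
  induction j with
  | zero => simp [extZ_nat]
  | succ j ih =>
    rw [Finset.prod_range_succ, Finset.prod_range_succ]
    have : (phi q b)⁻¹ * ((∏ x ∈ Finset.range j, ((q:ℚ) ^ x)⁻¹) * ((q:ℚ) ^ j)⁻¹) * ((∏ x ∈ Finset.range j, ((q:ℚ) ^ b - (q:ℚ) ^ x)) * ((q:ℚ) ^ b - (q:ℚ) ^ j))
      = (phi q b)⁻¹ * (∏ x ∈ Finset.range j, ((q:ℚ) ^ x)⁻¹) * (∏ x ∈ Finset.range j, ((q:ℚ) ^ b - (q:ℚ) ^ x)) * (((q:ℚ) ^ b - (q:ℚ) ^ j) / (q:ℚ)^j) := by ring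
    rw [this, ← ih]
    rcases lt_trichotomy j b with h | h | h
    · obtain ⟨n, rfl⟩ : ∃ n, b = j + n + 1 := ⟨b - j - 1, by omega⟩
      have e1 : ((j + n + 1 : ℕ) : ℤ) - j = ((n + 1 : ℕ) : ℤ) := by push_cast; ring
      have e2 : ((j + n + 1 : ℕ) : ℤ) - (j + 1 : ℕ) = (n : ℤ) := by push_cast; ring
      rw [e1, e2, extZ_nat, extZ_nat]
      have e3 : phi q (n+1) = phi q n * ((q:ℚ)^(n+1) - 1) := Finset.prod_range_succ _ _
      have h1 := (phi_pos hq n).ne'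
      have h2 := (phi_pos hq (n+1)).ne'
      have h3 : ((q:ℚ)^(n+1) - 1) ≠ 0 := by rw [e3] at h2; exact right_ne_zero_of_mul h2
      rw [e3]
      field_simp
      ring
    · subst h
      rw [extZ_neg _ (by omega)]; simp
    · rw [extZ_neg _ (by omega), extZ_neg _ (by omega)]; simp

lemma theta_sL {q : ℕ} (hq : 2 ≤ q) {k : ℕ} (b : Fin k → ℕ) : theta q (sL fun i => (b i : ℤ)) =
    (∏ i, (phi q (b i))⁻¹) * (∏ j : Fin k, ∏ t ∈ Finset.range j, ((q : ℚ) ^ t)⁻¹) *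
      ∏ i : Fin k, ∏ j ∈ Finset.Ioi i, ((q : ℚ) ^ (b j) - (q : ℚ) ^ (b i)) := by
  rw [sL, RingHom.map_det]
  apply det_fact (fun i => (q:ℚ)^(b i)) _ (fun t => (q:ℚ)^t) (fun j => ∏ t ∈ Finset.range j, ((q : ℚ) ^ t)⁻¹)
  intro i j
  exact theta_hL hq (b i) j

lemma theta_sL_pos {q : ℕ} (hq : 2 ≤ q) {k : ℕ} (b : Fin k → ℕ) (hb : StrictMono b) :
    0 < theta q (sL fun i => (b i : ℤ)) := by
  rw [theta_sL hq]
  have hq' : (1:ℚ) < q := by exact_mod_cast hq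
  have h1 : ∀ i : Fin k, 0 < (phi q (b i))⁻¹ := fun i => inv_pos.mpr (phi_pos hq _)
  have h2 : ∀ i : Fin k, ∀ j ∈ Finset.Ioi i, 0 < ((q : ℚ) ^ (b j) - (q : ℚ) ^ (b i)) := by
    intro i j hij
    rw [sub_pos]
    exact pow_lt_pow_right₀ hq' (hb (Finset.mem_Ioi.mp hij))
  refine mul_pos (mul_pos (Finset.prod_pos fun i _ => h1 i) (Finset.prod_pos fun i _ => Finset.prod_pos fun j _ => by positivity)) (Finset.prod_pos fun i _ => Finset.prod_pos fun j hj => h2 i j hj)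

/-- Schur function of a finite set of naturals (beta-set) -/
def sS (S : Finset ℕ) : Lam := sL (fun i : Fin S.card => ((S.orderEmbOfFin rfl i : ℕ) : ℤ))

lemma sS_eq {S : Finset ℕ} {k : ℕ} (h : S.card = k) :
    sS S = sL (fun i : Fin k => ((S.orderEmbOfFin h i : ℕ) : ℤ)) := by
  subst h; rfl

lemma sL_sort {k : ℕ} (b : Fin k → ℕ) : sL (fun i => (b i : ℤ)) = 0 ∨
    (Function.Injective b ∧ ∃ u : ℤ, sL (fun i => (b i : ℤ)) = (u : Lam) * sS (Finset.univ.image b)) := by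
  by_cases hb : Function.Injective b
  · right
    refine ⟨hb, ?_⟩
    have hc : (Finset.univ.image b).card = k := by
      rw [Finset.card_image_of_injective _ hb]; simp
    have hm : StrictMono (b ∘ Tuple.sort b) :=
      (Tuple.monotone_sort b).strictMono_of_injective (hb.comp (Tuple.sort b).injective)
    have h1 : b ∘ Tuple.sort b = (Finset.univ.image b).orderEmbOfFin hc := by
      apply Finset.orderEmbOfFin_unique
      · intro x; simp
      · exact hm
    refine ⟨(Equiv.Perm.sign (Tuple.sort b)⁻¹ : ℤ), ?_⟩
    rw [sS_eq hc, ← h1, sL, sL, ← Matrix.det_permute]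
    congr 1
    ext i j : 2
    simp
  · left
    rw [Function.Injective] at hb
    push Not at hb
    obtain ⟨i, j, hij, hne⟩ := hb
    apply Matrix.det_zero_of_row_eq hne
    funext t
    simp [hij]

end OEB

namespace OEB
namespace PSH

variable {L B : Type} {q : ℕ} (Z : PSH L B q)

/-- normalized dimension -/
def D : (B →₀ ℤ) →ₗ[ℤ] ℚ := Finsupp.linearCombination ℤ (fun b => ((Z.d b : ℚ) / phi q (Z.deg b)))

lemma D_single (b : B) (x : ℤ) : Z.D (Finsupp.single b x) = x * ((Z.d b : ℚ) / phi q (Z.deg b)) := by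
  simp [D]

lemma D_h (l : L) (r : ℕ) (v : B →₀ ℤ) : Z.D (Z.h l r v) = (phi q r)⁻¹ * Z.D v := by
  induction v using Finsupp.induction_linear with
  | zero => simp
  | add v v' hv hv' => simp [hv, hv', mul_add]
  | single a y =>
    have e1 : Finsupp.single a y = y • Finsupp.single a (1:ℤ) := by simp
    rw [e1, map_smul, map_smul, map_smul, D_single]
    have := Z.dim l r a
    have h2 : Z.D (Z.h l r (Finsupp.single a 1)) = (Z.h l r (Finsupp.single a 1)).sum (fun b x => (x : ℚ) * (Z.d b / phi q (Z.deg b))) := by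
      simp [D, Finsupp.linearCombination_apply]
    rw [h2, this]
    simp; ring

lemma D_act (l : L) (a : Lam) (v : B →₀ ℤ) : Z.D (Z.act l a v) = theta q a * Z.D v := by
  induction a using MvPolynomial.induction_on generalizing v with
  | C a =>
    have h1 : Z.act l (MvPolynomial.C a) = a • 1 := by simp
    have h2 : theta q (MvPolynomial.C a) = a := by simp
    rw [h1, h2]; simp
  | add p q hp hq => simp [add_mul, hp, hq]
  | mul_X p n hp =>
    rw [map_mul, act_X, Module.End.mul_apply, hp, D_h, map_mul]
    simp [theta, lift]; ring

lemma D_single_pos (hq : 2 ≤ q) (b : B) : 0 < Z.D (Finsupp.single b 1) := by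
  rw [D_single]
  have := phi_pos hq (Z.deg b)
  have := Z.dpos b
  have : (0:ℚ) < Z.d b := by exact_mod_cast this
  simp; positivity

lemma basis_of_sL (hq : 2 ≤ q) (l : L) (ρ : B) (hρ : Z.Free l (Finsupp.single ρ 1)) {k : ℕ} (b : Fin k → ℕ)
    (hb : StrictMono b) : ∃ χ, Z.act l (sL fun i => (b i : ℤ)) (Finsupp.single ρ 1) = Finsupp.single χ 1 := by
  have h1 := Z.ip_sL l _ _ hρ hρ b b hb hb
  rw [if_pos rfl, ip_single, one_mul] at h1
  obtain ⟨χ, h2 | h2⟩ := ip_self_one _ (by simpa using h1)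
  · exact ⟨χ, h2⟩
  · exfalso
    have h3 := Z.D_act l (sL fun i => (b i : ℤ)) (Finsupp.single ρ 1)
    rw [h2, map_neg] at h3
    have h4 := mul_pos (theta_sL_pos hq b hb) (Z.D_single_pos hq ρ)
    have h5 := Z.D_single_pos hq χ
    linarith

/-- `χ = s_S ρ` with `ρ` free -/
structure Rep (l : L) (S : Finset ℕ) (ρ χ : B) : Prop where
  free : Z.Free l (Finsupp.single ρ 1)
  eq : Z.act l (sS S) (Finsupp.single ρ 1) = Finsupp.single χ 1

lemma exists_rep_of (hq : 2 ≤ q) (l : L) (ρ : B) (hρ : Z.Free l (Finsupp.single ρ 1)) (S : Finset ℕ) :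
    ∃ χ, Z.Rep l S ρ χ := by
  obtain ⟨χ, h⟩ := Z.basis_of_sL hq l ρ hρ _ (S.orderEmbOfFin rfl).strictMono
  exact ⟨χ, hρ, h⟩

lemma Rep.unique {l : L} {S S' : Finset ℕ} {ρ ρ' χ : B} (h : Z.Rep l S ρ χ) (h' : Z.Rep l S' ρ' χ)
    (hc : S.card = S'.card) : S = S' ∧ ρ = ρ' := by
  have h1 := Z.ip_sL l _ _ h.free h'.free (S.orderEmbOfFin hc) (S'.orderEmbOfFin rfl)
    (OrderEmbedding.strictMono _) (OrderEmbedding.strictMono _)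
  rw [← sS_eq, ← sS_eq, h.eq, h'.eq] at h1
  simp only [ip_single, Finsupp.single_eq_same, mul_one, one_mul] at h1
  by_cases e1 : (S.orderEmbOfFin hc : Fin S'.card → ℕ) = S'.orderEmbOfFin rfl
  · constructor
    · have := congrArg Set.range e1
      simpa using this
    · by_contra hne
      rw [Finsupp.single_apply, if_neg hne] at h1
      simp at h1
  · rw [if_neg e1] at h1; simp at h1

def HomZ (n : ℤ) (v : B →₀ ℤ) : Prop := ∀ b, v b ≠ 0 → (Z.deg b : ℤ) = n

lemma HomZ.add {n : ℤ} {v w : B →₀ ℤ} (hv : Z.HomZ n v) (hw : Z.HomZ n w) : Z.HomZ n (v + w) := by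
  intro b hb
  by_cases h : v b = 0
  · apply hw; intro h'; apply hb; simp [h, h']
  · exact hv b h

lemma HomZ.smul {n : ℤ} {v : B →₀ ℤ} (hv : Z.HomZ n v) (c : ℤ) : Z.HomZ n (c • v) := by
  intro b hb
  apply hv; intro h; apply hb; simp [h]

lemma homZ_zero {n : ℤ} : Z.HomZ n 0 := by intro b hb; simp at hb

lemma HomZ.sum {ι : Type*} {n : ℤ} (s : Finset ι) (f : ι → B →₀ ℤ) (hv : ∀ i ∈ s, Z.HomZ n (f i)) : Z.HomZ n (∑ i ∈ s, f i) := by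
  induction s using Finset.induction_on with
  | empty => simpa using Z.homZ_zero
  | insert a s ha ih =>
    rw [Finset.sum_insert ha]
    exact HomZ.add _ (hv a (by simp)) (ih fun i hi => hv i (by simp [hi]))

lemma homZ_single (b : B) : Z.HomZ (Z.deg b) (Finsupp.single b 1) := by
  intro b' hb'
  rw [Finsupp.single_apply] at hb'
  split_ifs at hb' with h
  · rw [h]
  · simp at hb'

lemma HomZ.h {n : ℤ} {v : B →₀ ℤ} (hv : Z.HomZ n v) (l : L) (k : ℤ) : Z.HomZ (n + k) (Z.h l k v) := by
  by_cases hk : k < 0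
  · rw [Z.h_neg _ _ hk]; exact Z.homZ_zero
  · obtain ⟨r, rfl⟩ := Int.eq_ofNat_of_zero_le (not_lt.mp hk)
    rw [← Finsupp.sum_single v, Finsupp.sum, map_sum]
    apply HomZ.sum
    intro b hb
    have : Finsupp.single b (v b) = v b • Finsupp.single b (1:ℤ) := by simp
    rw [this, map_smul]
    apply HomZ.smul
    intro b' hb'
    rw [Z.deg_h l r b b' hb', ← hv b (Finsupp.mem_support_iff.mp hb)]
    push_cast; rfl

lemma HomZ.prod {n : ℤ} {v : B →₀ ℤ} (hv : Z.HomZ n v) (l : L) {ι : Type*} (s : Finset ι) (f : ι → ℤ) :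
    Z.HomZ (n + ∑ i ∈ s, f i) (Z.act l (∏ i ∈ s, hL (f i)) v) := by
  induction s using Finset.induction_on with
  | empty => simpa using hv
  | insert a s ha ih =>
    rw [Finset.sum_insert ha, Finset.prod_insert ha, map_mul, Module.End.mul_apply, act_hL]
    have := HomZ.h Z ih l (f a)
    convert this using 1; ring

lemma homZ_sL {n : ℤ} {v : B →₀ ℤ} (hv : Z.HomZ n v) (l : L) {k : ℕ} (b : Fin k → ℤ) :
    Z.HomZ (n + ∑ i, b i - ∑ i : Fin k, ((i : ℕ) : ℤ)) (Z.act l (sL b) v) := by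
  rw [sL_expand, map_sum, LinearMap.sum_apply]
  apply HomZ.sum
  intro σ _
  rw [map_mul, map_intCast, Module.End.mul_apply]
  have := HomZ.prod Z hv l Finset.univ (fun i => b i - ((σ i : ℕ) : ℤ))
  rw [Finset.sum_sub_distrib, Equiv.sum_comp σ (fun i : Fin k => ((i : ℕ) : ℤ)), ← add_sub_assoc] at this
  have h2 := HomZ.smul Z this (Equiv.Perm.sign σ : ℤ)
  simpa using h2

lemma sum_orderEmb {S : Finset ℕ} {k : ℕ} (h : S.card = k) {M : Type*} [AddCommMonoid M] (f : ℕ → M) :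
    ∑ i, f (S.orderEmbOfFin h i) = ∑ x ∈ S, f x := by
  conv_rhs => rw [← S.map_orderEmbOfFin_univ h]
  rw [Finset.sum_map]
  rfl

lemma Rep.deg {l : L} {S : Finset ℕ} {ρ χ : B} (h : Z.Rep l S ρ χ) :
    Z.deg χ + ∑ i ∈ Finset.range S.card, i = Z.deg ρ + ∑ x ∈ S, x := by
  have h1 := Z.homZ_sL (Z.homZ_single ρ) l (fun i : Fin S.card => ((S.orderEmbOfFin rfl i : ℕ) : ℤ))
  rw [← sS, h.eq] at h1
  have h2 := h1 χ (by simp)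
  rw [sum_orderEmb rfl (fun x => (x : ℤ)), ← Finset.sum_range (fun i => (i : ℤ))] at h2
  have : (Z.deg χ : ℤ) + ∑ i ∈ Finset.range S.card, (i : ℤ) = Z.deg ρ + ∑ x ∈ S, (x:ℤ) := by rw [h2]; ring
  zify
  exact this

lemma Rep.zero_mem {l : L} {S : Finset ℕ} {ρ χ : B} (h : Z.Rep l S ρ χ) (hc : Z.deg χ < S.card) : 0 ∈ S := by
  by_contra h0
  have h1 := h.deg
  have h2 : ∑ i : Fin S.card, ((i : ℕ) + 1) ≤ ∑ x ∈ S, x := by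
    rw [← sum_orderEmb rfl (fun x => x)]
    refine Finset.sum_le_sum fun i _ => ?_
    have h3 : ∀ n (hn : n < S.card), n + 1 ≤ S.orderEmbOfFin rfl ⟨n, hn⟩ := by
      intro n
      induction n with
      | zero =>
        intro hn
        have := S.orderEmbOfFin_mem rfl ⟨0, hn⟩
        by_contra hlt
        have h6 : S.orderEmbOfFin rfl ⟨0, hn⟩ = 0 := by omega
        rw [h6] at this
        exact h0 this
      | succ n ih =>
        intro hn
        have h4 := ih (by omega)
        have h5 : S.orderEmbOfFin rfl ⟨n, by omega⟩ < S.orderEmbOfFin rfl ⟨n+1, hn⟩ :=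
          (S.orderEmbOfFin rfl).strictMono (by simp)
        omega
    exact h3 i i.2
  rw [Finset.sum_add_distrib, ← Finset.sum_range (fun i => i)] at h2
  simp at h2
  simp at h1
  omega

lemma pieri_step (hq : 2 ≤ q) {l : L} {S : Finset ℕ} {ρ ψ χ : B} (h : Z.Rep l S ρ ψ) (hc : Z.deg ψ < S.card) (r : ℕ)
    (hne : Z.h l r (Finsupp.single ψ 1) χ ≠ 0) : ∃ κ : Fin S.card →₀ ℕ, ∑ i, κ i = r ∧
      (Function.Injective (fun i => S.orderEmbOfFin rfl i + κ i)) ∧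
      Z.Rep l (Finset.univ.image (fun i => S.orderEmbOfFin rfl i + κ i)) ρ χ := by
  have h0 := h.zero_mem Z hc
  obtain ⟨k, hk⟩ : ∃ k, S.card = k + 1 := ⟨S.card - 1, by omega⟩
  have hb0 : S.orderEmbOfFin hk 0 = 0 := by
    have h0' : (0:ℕ) ∈ Set.range (S.orderEmbOfFin hk) := by simpa using h0
    obtain ⟨i, hi⟩ := h0'
    have := (S.orderEmbOfFin hk).monotone (Fin.zero_le i)
    rw [hi] at this
    omega
  have h1 : ∃ κ : Fin (k+1) →₀ ℕ, ∑ i, κ i = r ∧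
      (Function.Injective (fun i => S.orderEmbOfFin hk i + κ i)) ∧
      Z.Rep l (Finset.univ.image (fun i => S.orderEmbOfFin hk i + κ i)) ρ χ := by
    rw [← Z.act_hL, ← h.eq, ← Module.End.mul_apply, ← map_mul, sS_eq hk, pieri _ (by exact_mod_cast hb0), map_sum,
      LinearMap.sum_apply, Finsupp.finsetSum_apply] at hne
    obtain ⟨κ, hκ, hκ2⟩ := Finset.exists_ne_zero_of_sum_ne_zero hne
    refine ⟨κ, ?_⟩
    have h2 : (fun i => ((S.orderEmbOfFin hk i : ℕ) : ℤ) + (κ i : ℕ)) = fun i => (((S.orderEmbOfFin hk i + κ i : ℕ)) : ℤ) := by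
      funext i; push_cast; rfl
    rw [h2] at hκ2
    rcases sL_sort (fun i => S.orderEmbOfFin hk i + κ i) with h3 | ⟨h3, u, h4⟩
    · rw [h3] at hκ2; simp at hκ2
    · refine ⟨?_, h3, h.free, ?_⟩
      · rw [Finset.mem_finsuppAntidiag] at hκ; exact hκ.1
      · obtain ⟨χ', h5⟩ := Z.exists_rep_of hq l ρ h.free (Finset.univ.image (fun i => S.orderEmbOfFin hk i + κ i))
        rw [h4, map_mul, map_intCast, Module.End.mul_apply, h5.eq] at hκ2
        have : χ' = χ := by
          by_contra hne'
          apply hκ2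
          rw [Module.End.intCast_apply]
          simp [Finsupp.single_apply, hne']
        rw [h5.eq, this]
  have key : ∀ n (hn : S.card = n), (∃ κ : Fin n →₀ ℕ, ∑ i, κ i = r ∧
      (Function.Injective (fun i => S.orderEmbOfFin hn i + κ i)) ∧
      Z.Rep l (Finset.univ.image (fun i => S.orderEmbOfFin hn i + κ i)) ρ χ) →
      (∃ κ : Fin S.card →₀ ℕ, ∑ i, κ i = r ∧
      (Function.Injective (fun i => S.orderEmbOfFin rfl i + κ i)) ∧
      Z.Rep l (Finset.univ.image (fun i => S.orderEmbOfFin rfl i + κ i)) ρ χ) := by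
    rintro n rfl h; exact h
  exact key _ hk h1

lemma exists_rep (hq : 2 ≤ q) (l : L) (k : ℕ) : ∀ χ, Z.deg χ < k → ∃ S ρ, S.card = k ∧ Z.Rep l S ρ χ := by
  have main : ∀ n, ∀ χ, Z.deg χ = n → Z.deg χ < k → ∃ S ρ, S.card = k ∧ Z.Rep l S ρ χ := by
    intro n
    induction n using Nat.strong_induction_on with
    | _ n ih =>
      intro χ hχ hk
      by_cases hf : Z.Free l (Finsupp.single χ 1)
      · refine ⟨Finset.range k, χ, by simp, hf, ?_⟩
        have h1 : (fun i : Fin k => (i : ℕ)) = (Finset.range k).orderEmbOfFin (by simp) :=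
          Finset.orderEmbOfFin_unique _ (fun x => by simp) (fun a b h => h)
        have h2 : sS (Finset.range k) = 1 := by
          rw [sS_eq (k := k) (by simp), ← h1, sL_id]
        rw [h2]; simp
      · unfold Free at hf
        push Not at hf
        obtain ⟨r, hr, hne⟩ := hf
        obtain ⟨ψ, hψ⟩ := Finsupp.ne_iff.mp hne
        rw [← Z.adj] at hψ
        have hd := Z.deg_h _ _ _ _ hψ
        obtain ⟨S, ρ, hS, hrep⟩ := ih (Z.deg ψ) (by omega) ψ rfl (by omega)
        obtain ⟨κ, _, h2, h3⟩ := Z.pieri_step hq hrep (by omega) r hψ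
        refine ⟨_, ρ, ?_, h3⟩
        rw [Finset.card_image_of_injective _ h2]; simpa using hS
  exact fun χ h => main _ χ rfl h

/-- box adding -/
lemma pieri_one (hq : 2 ≤ q) {l : L} {S : Finset ℕ} {ρ ψ χ : B} (h : Z.Rep l S ρ ψ) (hc : Z.deg ψ < S.card)
    (hne : Z.h l 1 (Finsupp.single ψ 1) χ ≠ 0) :
    ∃ x ∈ S, x + 1 ∉ S ∧ Z.Rep l (insert (x+1) (S.erase x)) ρ χ := by
  obtain ⟨κ, h1, h2, h3⟩ := Z.pieri_step hq h hc 1 (by exact_mod_cast hne)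
  obtain ⟨i, hi⟩ : ∃ i, κ i ≠ 0 := by
    by_contra hcon
    push Not at hcon
    simp [hcon] at h1
  have hκ : κ = Finsupp.single i 1 := by
    have h4 := Finset.add_sum_erase Finset.univ κ (Finset.mem_univ i)
    have h5 : ∑ j ∈ Finset.univ.erase i, κ j = 0 := by omega
    rw [Finset.sum_eq_zero_iff] at h5
    ext j
    by_cases hj : j = i
    · subst hj; simp; omega
    · rw [h5 j (by simp [hj])]; simp [Finsupp.single_apply, Ne.symm hj]
  subst hκ
  set x := S.orderEmbOfFin rfl i with hx
  have hxS : x ∈ S := S.orderEmbOfFin_mem rfl i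
  have hnot : x + 1 ∉ S := by
    intro hmem
    have : x + 1 ∈ Set.range (S.orderEmbOfFin rfl) := by simpa using hmem
    obtain ⟨j, hj⟩ := this
    have hij : i ≠ j := by rintro rfl; omega
    apply hij
    apply h2
    simp [Finsupp.single_apply, hij, hj, ← hx]
  refine ⟨x, hxS, hnot, ?_⟩
  convert h3 using 1
  ext y
  simp only [Finset.mem_insert, Finset.mem_erase, Finset.mem_image, Finset.mem_univ, true_and]
  constructor
  · rintro (rfl | ⟨hy1, hy2⟩)
    · exact ⟨i, by simp [← hx]⟩
    · have : y ∈ Set.range (S.orderEmbOfFin rfl) := by simpa using hy2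
      obtain ⟨j, hj⟩ := this
      refine ⟨j, ?_⟩
      have hij : i ≠ j := by rintro rfl; exact hy1 hj.symm
      simp [Finsupp.single_apply, hij, hj]
  · rintro ⟨j, rfl⟩
    by_cases hij : i = j
    · subst hij; left; simp [← hx]
    · right
      simp only [Finsupp.single_apply, hij, if_false, add_zero]
      exact ⟨fun h => hij ((S.orderEmbOfFin rfl).injective (hx ▸ h.symm)), S.orderEmbOfFin_mem rfl j⟩

lemma Rep.D_eq {l : L} {S : Finset ℕ} {ρ χ : B} (h : Z.Rep l S ρ χ) :
    (Z.d χ : ℚ) / phi q (Z.deg χ) = theta q (sS S) * (Z.d ρ / phi q (Z.deg ρ)) := by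
  have := Z.D_act l (sS S) (Finsupp.single ρ 1)
  rw [h.eq, D_single, D_single] at this
  simpa using this

/-- parts for different characters are independent -/
lemma Rep.indep (hq : 2 ≤ q) {l l' : L} (hl : l ≠ l') {S S' : Finset ℕ} {ρ ρ' χ : B} (h : Z.Rep l S ρ χ) (h' : Z.Rep l' S' ρ' ρ) :
    ∃ ψ, Z.Rep l' S' ψ χ := by
  -- first `ρ'` is free for `l`
  have hf : Z.Free l (Finsupp.single ρ' 1) := by
    intro r hr
    have h1 := h.free r hr
    rw [← h'.eq, Z.e_comm_act l l' hl] at h1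
    have hfree : Z.Free l' (Z.e l r (Finsupp.single ρ' 1)) := by
      intro t ht
      rw [Z.e_comm, h'.free t ht, map_zero]
    apply ip_self_eq_zero
    have h2 := Z.ip_sL l' _ _ hfree hfree (S'.orderEmbOfFin rfl) (S'.orderEmbOfFin rfl)
      (OrderEmbedding.strictMono _) (OrderEmbedding.strictMono _)
    rw [← sS, h1] at h2
    simpa using h2.symm
  obtain ⟨ψ, hψ⟩ := Z.exists_rep_of hq l ρ' hf S
  refine ⟨ψ, ?_, ?_⟩
  · intro r hr
    rw [← hψ.eq, Z.e_comm_act l' l hl.symm, h'.free r hr, map_zero]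
  · rw [← hψ.eq, ← h.eq, ← h'.eq, ← Module.End.mul_apply, Z.act_comm, Module.End.mul_apply]

end PSH
end OEB

namespace OEB

/-- runners of a 2-abacus -/
def half (i : ℕ) (S : Finset ℕ) : Finset ℕ := (S.filter (fun x => x % 2 = i)).image (fun x => x / 2)

lemma mem_half {i : ℕ} (hi : i < 2) {S : Finset ℕ} {x : ℕ} : x ∈ half i S ↔ 2 * x + i ∈ S := by
  simp only [half, Finset.mem_image, Finset.mem_filter]
  constructor
  · rintro ⟨y, ⟨h1, h2⟩, rfl⟩
    have : 2 * (y / 2) + i = y := by omega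
    rwa [this]
  · intro h
    exact ⟨_, ⟨h, by omega⟩, by omega⟩

lemma sum_half {M : Type*} [AddCommMonoid M] (S : Finset ℕ) (F : ℕ → M) :
    ∑ x ∈ S, F x = ∑ x ∈ half 0 S, F (2 * x) + ∑ x ∈ half 1 S, F (2 * x + 1) := by
  rw [half, half, Finset.sum_image, Finset.sum_image, ← Finset.sum_filter_add_sum_filter_not S (fun x => x % 2 = 0)]
  · congr 1
    · refine Finset.sum_congr rfl fun x hx => ?_
      simp at hx
      congr 1; omega
    · have : (S.filter fun x => ¬ x % 2 = 0) = S.filter fun x => x % 2 = 1 := by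
        ext x; simp
      rw [this]
      refine Finset.sum_congr rfl fun x hx => ?_
      simp at hx
      congr 1; omega
  · intro x hx y hy hxy
    simp at hx hy hxy
    omega
  · intro x hx y hy hxy
    simp at hx hy hxy
    omega

lemma card_half (S : Finset ℕ) : S.card = (half 0 S).card + (half 1 S).card := by
  have := sum_half S (fun _ => 1)
  simpa using this

def swapT (S : Finset ℕ) : Finset ℕ := S.image (fun x => if x % 2 = 0 then x + 1 else x - 1)

lemma half_swapT0 (S : Finset ℕ) : half 0 (swapT S) = half 1 S := by
  ext x
  rw [mem_half (by omega), mem_half (by omega), swapT, Finset.mem_image]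
  constructor
  · rintro ⟨y, hy, h⟩
    split_ifs at h with h1
    · omega
    · have : y = 2 * x + 1 := by omega
      rwa [← this]
  · intro h
    refine ⟨_, h, ?_⟩
    rw [if_neg (by omega)]; omega

lemma half_swapT1 (S : Finset ℕ) : half 1 (swapT S) = half 0 S := by
  ext x
  rw [mem_half (by omega), mem_half (by omega), swapT, Finset.mem_image]
  constructor
  · rintro ⟨y, hy, h⟩
    split_ifs at h with h1
    · have : y = 2 * x + 0 := by omega
      rwa [← this]
    · omega
  · intro h
    refine ⟨_, h, ?_⟩
    rw [if_pos (by omega)]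

lemma half_ext {S S' : Finset ℕ} (h0 : half 0 S = half 0 S') (h1 : half 1 S = half 1 S') : S = S' := by
  ext x
  rcases Nat.even_or_odd' x with ⟨y, hy | hy⟩
  · have := @mem_half 0 (by omega) S y
    have h2 := @mem_half 0 (by omega) S' y
    rw [h0] at this
    simp at this h2
    rw [hy, ← this, h2]
  · have := @mem_half 1 (by omega) S y
    have h2 := @mem_half 1 (by omega) S' y
    rw [h1] at this
    rw [hy, ← this, h2]

lemma swapT_swapT (S : Finset ℕ) : swapT (swapT S) = S := by
  apply half_ext
  · rw [half_swapT0, half_swapT1]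
  · rw [half_swapT1, half_swapT0]

lemma card_swapT (S : Finset ℕ) : (swapT S).card = S.card := by
  rw [card_half, half_swapT0, half_swapT1, card_half S, add_comm]

lemma le_orderEmb (S : Finset ℕ) {k : ℕ} (hk : S.card = k) (i : Fin k) : (i : ℕ) ≤ S.orderEmbOfFin hk i := by
  have h3 : ∀ n (hn : n < k), n ≤ S.orderEmbOfFin hk ⟨n, hn⟩ := by
    intro n
    induction n with
    | zero => intro hn; omega
    | succ n ih =>
      intro hn
      have h4 := ih (by omega)
      have h5 : S.orderEmbOfFin hk ⟨n, by omega⟩ < S.orderEmbOfFin hk ⟨n+1, hn⟩ :=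
        (S.orderEmbOfFin hk).strictMono (by simp)
      omega
  exact h3 i i.2

/-- weight of a beta-set -/
def wt (U : Finset ℕ) : ℕ := ∑ x ∈ U, x - ∑ i ∈ Finset.range U.card, i

lemma wt_add (U : Finset ℕ) : wt U + ∑ i ∈ Finset.range U.card, i = ∑ x ∈ U, x := by
  rw [wt]
  apply Nat.sub_add_cancel
  rw [← PSH.sum_orderEmb (S := U) rfl (fun x => x), Finset.sum_range]
  exact Finset.sum_le_sum fun i _ => le_orderEmb U rfl i

lemma vprod {ι : Type*} (s : Finset ι) (f : ι → ℚ) (hf : ∀ i ∈ s, f i ≠ 0) :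
    padicValRat 3 (∏ i ∈ s, f i) = ∑ i ∈ s, padicValRat 3 (f i) := by
  induction s using Finset.induction_on with
  | empty => simp
  | insert a s ha ih =>
    rw [Finset.prod_insert ha, Finset.sum_insert ha, padicValRat.mul (hf a (by simp)), ih]
    · intro i hi; exact hf i (by simp [hi])
    · exact Finset.prod_ne_zero_iff.mpr fun i hi => hf i (by simp [hi])

/-- sum over increasing pairs -/
def pairs (U : Finset ℕ) (f : ℕ → ℤ) : ℤ := ∑ x ∈ U, ∑ y ∈ U, if x < y then f (y - x) else 0

lemma pairs_orderEmb (S : Finset ℕ) {k : ℕ} (hk : S.card = k) (f : ℕ → ℕ → ℤ) :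
    ∑ i : Fin k, ∑ j ∈ Finset.Ioi i, f (S.orderEmbOfFin hk i) (S.orderEmbOfFin hk j) =
    ∑ x ∈ S, ∑ y ∈ S, if x < y then f x y else 0 := by
  rw [← PSH.sum_orderEmb hk (fun x => ∑ y ∈ S, if x < y then f x y else 0)]
  refine Finset.sum_congr rfl fun i _ => ?_
  rw [← PSH.sum_orderEmb hk (fun y => if S.orderEmbOfFin hk i < y then f (S.orderEmbOfFin hk i) y else 0)]
  rw [← Finset.sum_filter]
  refine Finset.sum_congr ?_ fun _ _ => rfl
  ext j; simp

/-- the number of standard tableaux, over `w!` -/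
def ft (U : Finset ℕ) : ℚ := (∏ i, ((Nat.factorial (U.orderEmbOfFin rfl i) : ℚ))⁻¹) *
      ∏ i : Fin U.card, ∏ j ∈ Finset.Ioi i, (((U.orderEmbOfFin rfl j : ℕ) : ℚ) - ((U.orderEmbOfFin rfl i : ℕ) : ℚ))

lemma fact_shift (b j : ℕ) : extZ (fun n => ((Nat.factorial n : ℚ))⁻¹) ((b : ℤ) - j) =
    ((Nat.factorial b : ℚ))⁻¹ * 1 * ∏ t ∈ Finset.range j, ((b : ℚ) - t) := by
  induction j with
  | zero => simp [extZ_nat]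
  | succ j ih =>
    rw [Finset.prod_range_succ, ← mul_assoc, ← ih]
    rcases lt_trichotomy j b with h | h | h
    · obtain ⟨n, rfl⟩ : ∃ n, b = j + n + 1 := ⟨b - j - 1, by omega⟩
      have e1 : ((j + n + 1 : ℕ) : ℤ) - j = ((n + 1 : ℕ) : ℤ) := by push_cast; ring
      have e2 : ((j + n + 1 : ℕ) : ℤ) - (j + 1 : ℕ) = (n : ℤ) := by push_cast; ring
      rw [e1, e2, extZ_nat, extZ_nat, Nat.factorial_succ]
      have : ((n:ℚ) + 1) ≠ 0 := by positivity
      push_cast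
      field_simp
      ring
    · subst h
      rw [extZ_neg _ (by omega)]; simp
    · rw [extZ_neg _ (by omega), extZ_neg _ (by omega)]; simp

lemma ft_integral (U : Finset ℕ) : ∃ z : ℤ, (Nat.factorial (wt U) : ℚ) * ft U = z := by
  have h1 : ft U = Matrix.det (Matrix.of fun i j : Fin U.card =>
      extZ (fun n => ((Nat.factorial n : ℚ))⁻¹) (((U.orderEmbOfFin rfl i : ℕ) : ℤ) - (j : ℕ))) := by
    rw [det_fact (fun i => ((U.orderEmbOfFin rfl i : ℕ) : ℚ)) (fun i => ((Nat.factorial (U.orderEmbOfFin rfl i) : ℚ))⁻¹) (fun t => t) (fun _ => 1)]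
    · simp [ft]
    · intro i j
      exact fact_shift _ _
  rw [h1, ← Matrix.det_transpose, Matrix.det_apply', Finset.mul_sum]
  have : ∀ σ : Equiv.Perm (Fin U.card), ∃ z : ℤ, (Nat.factorial (wt U) : ℚ) * ((Equiv.Perm.sign σ : ℤ) *
      ∏ i, (Matrix.of fun i j : Fin U.card => extZ (fun n => ((Nat.factorial n : ℚ))⁻¹) (((U.orderEmbOfFin rfl i : ℕ) : ℤ) - (j : ℕ)))ᵀ (σ i) i) = z := by
    intro σ
    simp only [Matrix.transpose_apply, Matrix.of_apply]
    by_cases h : ∀ i, (σ i : ℕ) ≤ U.orderEmbOfFin rfl i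
    · have h2 : ∑ i, (U.orderEmbOfFin rfl i - (σ i : ℕ)) = wt U := by
        have h3 : ∑ i, (U.orderEmbOfFin rfl i - (σ i : ℕ)) + ∑ i, (σ i : ℕ) = ∑ i, U.orderEmbOfFin rfl i := by
          rw [← Finset.sum_add_distrib]
          exact Finset.sum_congr rfl fun i _ => Nat.sub_add_cancel (h i)
        rw [Equiv.sum_comp σ (fun i => (i : ℕ)), ← Finset.sum_range (fun i => i), PSH.sum_orderEmb rfl (fun x => x)] at h3
        have := wt_add U
        omega
      obtain ⟨z, hz⟩ := Nat.prod_factorial_dvd_factorial_sum Finset.univ (fun i => U.orderEmbOfFin rfl i - (σ i : ℕ))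
      rw [h2] at hz
      refine ⟨(Equiv.Perm.sign σ : ℤ) * z, ?_⟩
      have h4 : ∏ i, extZ (fun n => ((Nat.factorial n : ℚ))⁻¹) (((U.orderEmbOfFin rfl i : ℕ) : ℤ) - (σ i : ℕ)) =
          (((∏ i, Nat.factorial (U.orderEmbOfFin rfl i - (σ i : ℕ)) : ℕ)) : ℚ)⁻¹ := by
        push_cast
        rw [← Finset.prod_inv_distrib]
        refine Finset.prod_congr rfl fun i _ => ?_
        rw [← Nat.cast_sub (h i), extZ_nat]
      rw [h4, hz]
      have h5 : (((∏ i, Nat.factorial (U.orderEmbOfFin rfl i - (σ i : ℕ)) : ℕ)) : ℚ) ≠ 0 := by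
        rw [Nat.cast_ne_zero]
        exact Finset.prod_ne_zero_iff.mpr fun i _ => Nat.factorial_ne_zero _
      rw [Nat.cast_mul]
      generalize (((∏ i, Nat.factorial (U.orderEmbOfFin rfl i - (σ i : ℕ)) : ℕ)) : ℚ) = P at h5 ⊢
      push_cast
      field_simp
    · push Not at h
      obtain ⟨i, hi⟩ := h
      refine ⟨0, ?_⟩
      rw [Finset.prod_eq_zero (Finset.mem_univ i)]
      · simp
      · apply extZ_neg; omega
  choose z hz using this
  refine ⟨∑ σ, z σ, ?_⟩
  rw [Finset.sum_congr rfl fun σ _ => hz σ]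
  push_cast; rfl

lemma ft_val (U : Finset ℕ) : padicValRat 3 (ft U) =
    pairs U (fun y => padicValNat 3 y) - ∑ x ∈ U, (padicValNat 3 (Nat.factorial x) : ℤ) := by
  have h2 : ∀ i : Fin U.card, ∀ j ∈ Finset.Ioi i, (((U.orderEmbOfFin rfl j : ℕ) : ℚ) - ((U.orderEmbOfFin rfl i : ℕ) : ℚ)) ≠ 0 := by
    intro i j hij
    have := (U.orderEmbOfFin rfl).strictMono (Finset.mem_Ioi.mp hij)
    rw [sub_ne_zero]
    intro h
    rw [Nat.cast_inj] at h
    omega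
  rw [ft, padicValRat.mul, vprod, vprod]
  · rw [add_comm, sub_eq_add_neg]
    congr 1
    · rw [pairs, ← pairs_orderEmb U rfl (fun x y => (padicValNat 3 (y - x) : ℤ))]
      refine Finset.sum_congr rfl fun i _ => ?_
      rw [vprod _ _ (h2 i)]
      refine Finset.sum_congr rfl fun j hij => ?_
      have := (U.orderEmbOfFin rfl).strictMono (Finset.mem_Ioi.mp hij)
      rw [← Nat.cast_sub this.le, padicValRat.of_nat]
    · rw [← PSH.sum_orderEmb rfl (fun x => (padicValNat 3 (Nat.factorial x) : ℤ)), ← Finset.sum_neg_distrib]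
      refine Finset.sum_congr rfl fun i _ => ?_
      rw [padicValRat.inv, padicValRat.of_nat]
  · intro i _; exact Finset.prod_ne_zero_iff.mpr (h2 i)
  · intro i _; positivity
  · exact Finset.prod_ne_zero_iff.mpr fun i _ => by positivity
  · exact Finset.prod_ne_zero_iff.mpr fun i _ => Finset.prod_ne_zero_iff.mpr (h2 i)

lemma ft_ne_zero (U : Finset ℕ) : ft U ≠ 0 := by
  have h2 : ∀ i : Fin U.card, ∀ j ∈ Finset.Ioi i, (((U.orderEmbOfFin rfl j : ℕ) : ℚ) - ((U.orderEmbOfFin rfl i : ℕ) : ℚ)) ≠ 0 := by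
    intro i j hij
    have := (U.orderEmbOfFin rfl).strictMono (Finset.mem_Ioi.mp hij)
    rw [sub_ne_zero]
    intro h
    rw [Nat.cast_inj] at h
    omega
  apply mul_ne_zero
  · exact Finset.prod_ne_zero_iff.mpr fun i _ => by positivity
  · exact Finset.prod_ne_zero_iff.mpr fun i _ => Finset.prod_ne_zero_iff.mpr (h2 i)

lemma pairs_ge (U : Finset ℕ) : -(padicValNat 3 (Nat.factorial (wt U)) : ℤ) ≤
    pairs U (fun y => padicValNat 3 y) - ∑ x ∈ U, (padicValNat 3 (Nat.factorial x) : ℤ) := by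
  rw [← ft_val]
  obtain ⟨z, hz⟩ := ft_integral U
  have h1 := congrArg (padicValRat 3) hz
  rw [padicValRat.mul (by positivity) (ft_ne_zero U), padicValRat.of_nat, padicValRat.of_int] at h1
  omega

end OEB

namespace OEB

section val
variable {q : ℕ}

def av (q : ℕ) : ℕ := padicValNat 3 (q ^ 2 - 1)

/-- 3-adic valuation of `q^y-1` -/
def vv (q : ℕ) (y : ℕ) : ℤ := if y % 2 = 0 then av q + padicValNat 3 (y / 2) else 0


lemma av_pos (hq : 2 ≤ q) (h3 : 3 ∣ q + 1) : 1 ≤ av q := by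
  have h1 : 1 ≤ q ^ 2 := Nat.one_le_pow _ _ (by omega)
  have h2 : 3 ∣ q ^ 2 - 1 := by
    have : q ^ 2 - 1 = (q + 1) * (q - 1) := by
      have := Nat.sq_sub_sq q 1
      simpa using this
    rw [this]; exact Dvd.dvd.mul_right h3 _
  have h4 : q ^ 2 - 1 ≠ 0 := by
    have : 2 ^ 2 ≤ q ^ 2 := Nat.pow_le_pow_left hq 2
    omega
  exact one_le_padicValNat_of_dvd h4 h2

lemma not_dvd_q (_hq : 2 ≤ q) (h3 : 3 ∣ q + 1) : ¬ 3 ∣ q := by omega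

lemma val_pow_sub (hq : 2 ≤ q) (h3 : 3 ∣ q + 1) (y : ℕ) (hy : y ≠ 0) : padicValRat 3 ((q : ℚ) ^ y - 1) = vv q y := by
  have h1 : 1 ≤ q ^ y := Nat.one_le_pow _ _ (by omega)
  have e : (q : ℚ) ^ y - 1 = ((q ^ y - 1 : ℕ) : ℚ) := by push_cast [Nat.cast_sub h1]; rfl
  rw [e, padicValRat.of_nat, vv]
  split_ifs with hp
  · obtain ⟨z, rfl⟩ : ∃ z, y = 2 * z := ⟨y / 2, by omega⟩
    have h5 : 2 ^ 2 ≤ q ^ 2 := Nat.pow_le_pow_left hq 2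
    have h4 := padicValNat.pow_sub_pow (p := 3) (by decide : Odd 3) (x := q ^ 2) (y := 1) (by omega) ?_ ?_ (n := z) (by omega)
    · rw [one_pow, ← pow_mul] at h4
      rw [h4, av]; simp
    · by_contra hc
      have := av_pos hq h3
      rw [av, padicValNat.eq_zero_of_not_dvd hc] at this
      omega
    · intro h
      exact not_dvd_q hq h3 (Nat.Prime.dvd_of_dvd_pow Nat.prime_three h)
  · rw [padicValNat.eq_zero_of_not_dvd]
    · rfl
    · intro h
      have h6 : (q : ZMod 3) = -1 := by
        have : ((q + 1 : ℕ) : ZMod 3) = 0 := (ZMod.natCast_eq_zero_iff _ _).mpr h3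
        push_cast at this
        linear_combination this
      have h7 : ((q ^ y - 1 : ℕ) : ZMod 3) = 0 := (ZMod.natCast_eq_zero_iff _ _).mpr h
      rw [Nat.cast_sub h1] at h7
      push_cast at h7
      rw [h6, Odd.neg_one_pow (Nat.odd_iff.mpr (by omega))] at h7
      revert h7; decide

lemma val_phi (hq : 2 ≤ q) (h3 : 3 ∣ q + 1) (n : ℕ) : padicValRat 3 (phi q n) = av q * (n / 2 : ℕ) + padicValNat 3 (Nat.factorial (n / 2)) := by
  induction n with
  | zero => simp [phi]
  | succ n ih =>
    have e3 : phi q (n+1) = phi q n * ((q:ℚ)^(n+1) - 1) := Finset.prod_range_succ _ _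
    have h2 := (phi_pos hq (n+1)).ne'
    rw [e3] at h2
    rw [e3, padicValRat.mul (left_ne_zero_of_mul h2) (right_ne_zero_of_mul h2), ih, val_pow_sub hq h3 _ (by omega), vv]
    split_ifs with hp
    · have e1 : (n + 1) / 2 = n / 2 + 1 := by omega
      rw [e1, Nat.factorial_succ, padicValNat.mul (by omega) (Nat.factorial_ne_zero _)]
      push_cast; ring
    · have e1 : (n + 1) / 2 = n / 2 := by omega
      rw [e1]; simp

lemma val_theta (hq : 2 ≤ q) (h3 : 3 ∣ q + 1) (S : Finset ℕ) : padicValRat 3 (theta q (sS S)) =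
    pairs S (vv q) - ∑ x ∈ S, ((av q * (x / 2 : ℕ) + padicValNat 3 (Nat.factorial (x / 2)) : ℕ) : ℤ) := by
  have hq' : (1:ℚ) < q := by exact_mod_cast hq
  have h2 : ∀ i : Fin S.card, ∀ j ∈ Finset.Ioi i, ((q : ℚ) ^ (S.orderEmbOfFin rfl j) - (q : ℚ) ^ (S.orderEmbOfFin rfl i)) ≠ 0 := by
    intro i j hij
    have := (S.orderEmbOfFin rfl).strictMono (Finset.mem_Ioi.mp hij)
    exact (sub_pos.mpr (pow_lt_pow_right₀ hq' this)).ne'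
  have hv : padicValRat 3 (q : ℚ) = 0 := by
    rw [padicValRat.of_nat, padicValNat.eq_zero_of_not_dvd (not_dvd_q hq h3)]; rfl
  have hq0 : (q : ℚ) ≠ 0 := by positivity
  have hvp : ∀ t, padicValRat 3 ((q : ℚ) ^ t) = 0 := by
    intro t; rw [padicValRat.pow, hv]; simp
  have h1 : ∀ i : Fin S.card, (phi q (S.orderEmbOfFin rfl i))⁻¹ ≠ 0 := fun i => (inv_pos.mpr (phi_pos hq _)).ne'
  have h4 : (∏ j : Fin S.card, ∏ t ∈ Finset.range j, ((q : ℚ) ^ t)⁻¹) ≠ 0 :=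
    Finset.prod_ne_zero_iff.mpr fun i _ => Finset.prod_ne_zero_iff.mpr fun j _ => by positivity
  have h5 : padicValRat 3 (∏ j : Fin S.card, ∏ t ∈ Finset.range j, ((q : ℚ) ^ t)⁻¹) = 0 := by
    rw [vprod]
    · apply Finset.sum_eq_zero
      intro i _
      rw [vprod]
      · apply Finset.sum_eq_zero
        intro t _
        rw [padicValRat.inv, hvp]; simp
      · intro t _; positivity
    · intro i _
      exact Finset.prod_ne_zero_iff.mpr fun j _ => by positivity
  have h6 : (∏ i : Fin S.card, ∏ j ∈ Finset.Ioi i, ((q : ℚ) ^ (S.orderEmbOfFin rfl j) - (q : ℚ) ^ (S.orderEmbOfFin rfl i))) ≠ 0 :=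
    Finset.prod_ne_zero_iff.mpr fun i _ => Finset.prod_ne_zero_iff.mpr (h2 i)
  have h7 : (∏ i : Fin S.card, (phi q (S.orderEmbOfFin rfl i))⁻¹) ≠ 0 := Finset.prod_ne_zero_iff.mpr fun i _ => h1 i
  rw [sS, theta_sL hq, padicValRat.mul (mul_ne_zero h7 h4) h6, padicValRat.mul h7 h4, h5, add_zero, add_comm, sub_eq_add_neg]
  congr 1
  · rw [pairs, ← pairs_orderEmb S rfl (fun x y => vv q (y - x)), vprod]
    · refine Finset.sum_congr rfl fun i _ => ?_
      rw [vprod _ _ (h2 i)]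
      refine Finset.sum_congr rfl fun j hij => ?_
      have := (S.orderEmbOfFin rfl).strictMono (Finset.mem_Ioi.mp hij)
      rw [← val_pow_sub hq h3 _ (by omega)]
      have e : (q : ℚ) ^ (S.orderEmbOfFin rfl j) - (q : ℚ) ^ (S.orderEmbOfFin rfl i) =
        (q : ℚ) ^ (S.orderEmbOfFin rfl i) * ((q : ℚ) ^ (S.orderEmbOfFin rfl j - S.orderEmbOfFin rfl i) - 1) := by
        rw [mul_sub, ← pow_add, mul_one, Nat.add_sub_of_le this.le]
      have hne := h2 i j hij
      rw [e] at hne ⊢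
      rw [padicValRat.mul (left_ne_zero_of_mul hne) (right_ne_zero_of_mul hne), hvp, zero_add]
    · intro i _; exact Finset.prod_ne_zero_iff.mpr (h2 i)
  · rw [vprod _ _ (fun i _ => h1 i), ← PSH.sum_orderEmb rfl (fun x => ((av q * (x / 2 : ℕ) + padicValNat 3 (Nat.factorial (x / 2)) : ℕ) : ℤ)), ← Finset.sum_neg_distrib]
    refine Finset.sum_congr rfl fun i _ => ?_
    rw [padicValRat.inv, val_phi hq h3]
    push_cast; rfl


def gU (q : ℕ) (U : Finset ℕ) : ℤ := pairs U (fun y => av q + padicValNat 3 y) -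
  ∑ x ∈ U, ((av q * x + padicValNat 3 (Nat.factorial x) : ℕ) : ℤ)

lemma pairs_half (S : Finset ℕ) : pairs S (vv q) =
    pairs (half 0 S) (fun y => av q + padicValNat 3 y) + pairs (half 1 S) (fun y => av q + padicValNat 3 y) := by
  rw [pairs, sum_half]
  simp_rw [sum_half S]
  congr 1
  · rw [pairs]
    refine Finset.sum_congr rfl fun x _ => ?_
    refine (congrArg₂ (· + ·) (Finset.sum_congr rfl fun y _ => ?_) (Finset.sum_eq_zero fun y _ => ?_)).trans (add_zero _)
    · by_cases h : x < y
      · rw [if_pos h, if_pos (by omega), vv, if_pos (by omega)]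
        congr 3; omega
      · rw [if_neg h, if_neg (by omega)]
    · split_ifs
      · rw [vv, if_neg (by omega)]
      · rfl
  · rw [pairs]
    refine Finset.sum_congr rfl fun x _ => ?_
    refine (congrArg₂ (· + ·) (Finset.sum_eq_zero fun y _ => ?_) (Finset.sum_congr rfl fun y _ => ?_)).trans (zero_add _)
    · split_ifs
      · rw [vv, if_neg (by omega)]
      · rfl
    · by_cases h : x < y
      · rw [if_pos h, if_pos (by omega), vv, if_pos (by omega)]
        congr 3; omega
      · rw [if_neg h, if_neg (by omega)]

lemma val_theta' (hq : 2 ≤ q) (h3 : 3 ∣ q + 1) (S : Finset ℕ) : padicValRat 3 (theta q (sS S)) = gU q (half 0 S) + gU q (half 1 S) := by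
  rw [val_theta hq h3, pairs_half, sum_half, gU, gU]
  have e0 : ∀ x, 2 * x / 2 = x := fun x => by omega
  have e1 : ∀ x, (2 * x + 1) / 2 = x := fun x => by omega
  simp_rw [e0, e1]
  ring

lemma pairs_const (U : Finset ℕ) (c : ℤ) : pairs U (fun _ => c) = c * ∑ i ∈ Finset.range U.card, (i : ℤ) := by
  rw [pairs, ← pairs_orderEmb U rfl (fun _ _ => c), Finset.mul_sum, ← Finset.sum_range_reflect, Finset.sum_range]
  refine Finset.sum_congr rfl fun i _ => ?_
  have := i.2
  simp only [Finset.sum_const, Fin.card_Ioi, nsmul_eq_mul]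
  rw [mul_comm]

lemma gU_ge (U : Finset ℕ) : -(av q * wt U + padicValNat 3 (Nat.factorial (wt U)) : ℤ) ≤ gU q U := by
  have h1 := pairs_ge U
  have h2 : pairs U (fun y => (av q : ℤ) + padicValNat 3 y) = pairs U (fun _ => (av q : ℤ)) + pairs U (fun y => padicValNat 3 y) := by
    simp only [pairs, ← Finset.sum_add_distrib]
    refine Finset.sum_congr rfl fun x _ => Finset.sum_congr rfl fun y _ => ?_
    split_ifs <;> simp
  have h3 : (wt U : ℤ) + ∑ i ∈ Finset.range U.card, (i:ℤ) = ∑ x ∈ U, (x:ℤ) := by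
    have := wt_add U
    zify at this
    exact this
  rw [gU, h2, pairs_const]
  push_cast
  rw [Finset.sum_add_distrib, ← Finset.mul_sum, ← h3]
  push_cast at h1
  linarith

end val

end OEB

namespace OEB

namespace PSH
variable {L B : Type} {q : ℕ} (Z : PSH L B q)

lemma val_rep (hq : 2 ≤ q) (h3 : 3 ∣ q + 1) {l : L} {S : Finset ℕ} {ρ χ : B} (h : Z.Rep l S ρ χ) :
    (padicValNat 3 (Z.d χ) : ℤ) + av q * (Z.deg ρ / 2 : ℕ) + padicValNat 3 (Nat.factorial (Z.deg ρ / 2)) =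
      padicValNat 3 (Z.d ρ) + av q * (Z.deg χ / 2 : ℕ) + padicValNat 3 (Nat.factorial (Z.deg χ / 2)) +
      gU q (half 0 S) + gU q (half 1 S) := by
  have h1 := h.D_eq
  have p1 := (phi_pos hq (Z.deg χ)).ne'
  have p2 := (phi_pos hq (Z.deg ρ)).ne'
  have d1 : (Z.d χ : ℚ) ≠ 0 := by exact_mod_cast (Z.dpos χ).ne'
  have d2 : (Z.d ρ : ℚ) ≠ 0 := by exact_mod_cast (Z.dpos ρ).ne'
  have t : theta q (sS S) ≠ 0 := by
    intro ht
    rw [ht, zero_mul] at h1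
    exact (div_ne_zero d1 p1) h1
  have h2 := congrArg (padicValRat 3) h1
  rw [padicValRat.div d1 p1, padicValRat.mul t (div_ne_zero d2 p2), padicValRat.div d2 p2, val_phi hq h3, val_phi hq h3,
    val_theta' hq h3, padicValRat.of_nat, padicValRat.of_nat] at h2
  linarith

lemma sum_range_id2 (n : ℕ) : (2 * ∑ i ∈ Finset.range n, (i : ℤ)) = n * (n - 1) := by
  induction n with
  | zero => simp
  | succ n ih => rw [Finset.sum_range_succ, mul_add, ih]; push_cast; ring

lemma fact_val (K w0 w1 N : ℕ) (h : K + w0 + w1 ≤ N) :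
    padicValNat 3 (Nat.factorial K) + padicValNat 3 (Nat.factorial w0) + padicValNat 3 (Nat.factorial w1) ≤
      padicValNat 3 (Nat.factorial N) := by
  have d1 : K.factorial * w0.factorial * w1.factorial ∣ N.factorial :=
    ((mul_dvd_mul_right (Nat.factorial_mul_factorial_dvd_factorial_add K w0) _).trans
      (Nat.factorial_mul_factorial_dvd_factorial_add (K + w0) w1)).trans (Nat.factorial_dvd_factorial h)
  have n1 := Nat.factorial_ne_zero K
  have n2 := Nat.factorial_ne_zero w0
  have n3 := Nat.factorial_ne_zero w1
  rw [← padicValNat.mul n1 n2, ← padicValNat.mul (mul_ne_zero n1 n2) n3]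
  exact (padicValNat_dvd_iff_le (Nat.factorial_ne_zero N)).mp (pow_padicValNat_dvd.trans d1)

lemma num_core (a K N w0 w1 fK fN f0 f1 x d : ℕ) (g0 g1 : ℤ) (a1 : 1 ≤ a)
    (h1 : ((0 : ℕ) : ℤ) + a * K + fK = d + a * N + fN + g0 + g1) (h2 : -(a * w0 + f0 : ℤ) ≤ g0)
    (h3 : -(a * w1 + f1 : ℤ) ≤ g1) (hf : fK + f0 + f1 ≤ fN) (hx : N = K + w0 + w1 + x) : x = 0 ∧ d = 0 := by
  subst hx
  push_cast at h1
  zify at hf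
  rw [mul_add, mul_add, mul_add] at h1
  have h5 : (a : ℤ) * x ≥ x := by
    have : (1 : ℤ) ≤ a := by exact_mod_cast a1
    have : (0 : ℤ) ≤ x := by positivity
    nlinarith
  have h6 : (a : ℤ) * x + d ≤ 0 := by linarith
  constructor <;> omega

lemma e_core (e : ℤ) (h : 2 * e ^ 2 - e < 2) : e = 0 ∨ e = 1 := by
  have : -1 < e := by nlinarith
  have : e < 2 := by nlinarith
  omega

lemma e_core0 (e : ℤ) : 0 ≤ 2 * e ^ 2 - e := by
  rcases le_or_gt e 0 with h | h <;> nlinarith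

lemma val_main (hq : 2 ≤ q) (h3 : 3 ∣ q + 1) {l : L} {S : Finset ℕ} {ρ χ : B} (h : Z.Rep l S ρ χ) {M : ℕ}
    (hS : S.card = 2 * M + 1) (hd : ¬ 3 ∣ Z.d χ) :
    ¬ 3 ∣ Z.d ρ ∧ (((half 1 S).card = M ∧ Z.deg χ % 2 = Z.deg ρ % 2) ∨
      ((half 1 S).card = M + 1 ∧ Z.deg χ % 2 = 1 ∧ Z.deg ρ % 2 = 0)) ∧
      Z.deg χ / 2 = Z.deg ρ / 2 + wt (half 0 S) + wt (half 1 S) := by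
  have h1 := Z.val_rep hq h3 h
  rw [padicValNat.eq_zero_of_not_dvd hd] at h1
  have g0 := gU_ge (q := q) (half 0 S)
  have g1 := gU_ge (q := q) (half 1 S)
  have a1 := av_pos hq h3
  obtain ⟨e, he⟩ : ∃ e : ℤ, ((half 1 S).card : ℤ) = M + e := ⟨(half 1 S).card - M, by ring⟩
  have hc := card_half S
  have hc0 : ((half 0 S).card : ℤ) = M + 1 - e := by zify at hc hS; linarith
  have hdeg := h.deg
  rw [sum_half S (fun x => x), Finset.sum_add_distrib, ← Finset.mul_sum, ← Finset.mul_sum, hS, Finset.sum_const, smul_eq_mul, mul_one] at hdeg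
  rw [← wt_add (half 0 S), ← wt_add (half 1 S)] at hdeg
  zify at hdeg
  have s1 := sum_range_id2 (2 * M + 1)
  have s2 := sum_range_id2 (half 0 S).card
  have s3 := sum_range_id2 (half 1 S).card
  have hn : (Z.deg χ : ℤ) = Z.deg ρ + 2 * wt (half 0 S) + 2 * wt (half 1 S) + (2 * e ^ 2 - e) := by
    rw [hc0] at s2
    rw [he] at s3 hdeg
    push_cast at s1 s2 s3 hdeg
    linarith
  have hc : 0 ≤ 2 * e ^ 2 - e := by
    exact e_core0 e
  have hle : Z.deg ρ / 2 + wt (half 0 S) + wt (half 1 S) ≤ Z.deg χ / 2 := by omega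
  have hf := fact_val _ _ _ _ hle
  obtain ⟨x, hx⟩ := Nat.exists_eq_add_of_le hle
  have hx0 : x = 0 ∧ padicValNat 3 (Z.d ρ) = 0 :=
    num_core (av q) _ _ _ _ _ _ _ _ x _ _ _ a1 h1 g0 g1 hf hx
  obtain ⟨rfl, hr⟩ := hx0
  refine ⟨?_, ?_, by omega⟩
  · intro hdv
    have := one_le_padicValNat_of_dvd (Z.dpos ρ).ne' hdv
    omega
  · have h6 : 2 * e ^ 2 - e < 2 := by omega
    have h7 := e_core e h6
    rcases h7 with rfl | rfl
    · left; constructor <;> omega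
    · right; refine ⟨?_, ?_, ?_⟩ <;> omega

lemma val_swap (hq : 2 ≤ q) (h3 : 3 ∣ q + 1) {l : L} {S : Finset ℕ} {ρ χ χ' : B} (h : Z.Rep l S ρ χ)
    (h' : Z.Rep l (swapT S) ρ χ') (hd : Z.deg χ / 2 = Z.deg χ' / 2) (hx : ¬ 3 ∣ Z.d χ) : ¬ 3 ∣ Z.d χ' := by
  have h1 := Z.val_rep hq h3 h
  have h2 := Z.val_rep hq h3 h'
  rw [half_swapT0, half_swapT1, ← hd] at h2
  intro hdv
  have h4 := one_le_padicValNat_of_dvd (Z.dpos _).ne' hdv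
  rw [padicValNat.eq_zero_of_not_dvd hx] at h1
  omega

/-- degree of the swapped character -/
lemma deg_swap {l : L} {S : Finset ℕ} {ρ χ χ' : B} (h : Z.Rep l S ρ χ)
    (h' : Z.Rep l (swapT S) ρ χ') : Z.deg χ + (half 0 S).card = Z.deg χ' + (half 1 S).card := by
  have h1 := h.deg
  have h2 := h'.deg
  rw [card_swapT] at h2
  rw [sum_half S (fun x => x), Finset.sum_add_distrib, ← Finset.mul_sum, ← Finset.mul_sum, Finset.sum_const, smul_eq_mul, mul_one] at h1
  rw [sum_half (swapT S) (fun x => x), half_swapT0, half_swapT1, Finset.sum_add_distrib, ← Finset.mul_sum, ← Finset.mul_sum, Finset.sum_const, smul_eq_mul, mul_one] at h2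
  omega

lemma half_insert {S : Finset ℕ} {x : ℕ} (hx : x ∈ S) (hx' : x + 1 ∉ S) :
    (x % 2 = 0 ∧ (half 1 (insert (x+1) (S.erase x))).card = (half 1 S).card + 1) ∨
    (x % 2 = 1 ∧ (half 1 (insert (x+1) (S.erase x))).card + 1 = (half 1 S).card) := by
  rcases Nat.even_or_odd' x with ⟨y, rfl | rfl⟩
  · left
    refine ⟨by omega, ?_⟩
    have : half 1 (insert (2 * y+1) (S.erase (2*y))) = insert y (half 1 S) := by
      ext z
      rw [mem_half (by omega), Finset.mem_insert, Finset.mem_insert, mem_half (by omega), Finset.mem_erase]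
      constructor
      · rintro (h | h)
        · left; omega
        · right; exact h.2
      · rintro (h | h)
        · left; omega
        · right; exact ⟨by omega, h⟩
    rw [this, Finset.card_insert_of_notMem]
    rwa [mem_half (by omega)]
  · right
    refine ⟨by omega, ?_⟩
    have : half 1 (insert (2 * y+1+1) (S.erase (2*y+1))) = (half 1 S).erase y := by
      ext z
      rw [mem_half (by omega), Finset.mem_insert, Finset.mem_erase, Finset.mem_erase, mem_half (by omega)]
      constructor
      · rintro (h | h)
        · omega
        · exact ⟨by omega, h.2⟩
      · rintro h
        right; exact ⟨by omega, h.2⟩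
    rw [this]
    apply Finset.card_erase_add_one
    rwa [mem_half (by omega)]

theorem abstract_main (hq : 2 ≤ q) (h3 : 3 ∣ q + 1) (m : ℕ)
    (hmod : ∀ b, Z.deg b = 2 * m + 1 → ¬ 3 ∣ Z.d b → ∃ l ψ, (Z.e l 1 (Finsupp.single b 1)) ψ ≠ 0 ∧ ¬ 3 ∣ Z.d ψ) :
    Nonempty ({b // Z.deg b = 2 * m + 1 ∧ ¬ 3 ∣ Z.d b} ≃ L × {b // Z.deg b = 2 * m ∧ ¬ 3 ∣ Z.d b}) := by
  -- existence
  have ex : ∀ χ, Z.deg χ = 2 * m + 1 → ¬ 3 ∣ Z.d χ → ∃ l ρ S, S.card = 2 * (m + 1) + 1 ∧ (half 1 S).card = m + 2 ∧ Z.Rep l S ρ χ := by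
    intro χ hχ hd
    obtain ⟨l, ψ, hne, hψ⟩ := hmod χ hχ hd
    rw [← Z.adj] at hne
    have hdeg : Z.deg ψ = 2 * m := by
      have := Z.deg_h _ _ _ _ hne
      omega
    obtain ⟨S, ρ, hS, hR⟩ := Z.exists_rep hq l (2 * (m + 1) + 1) ψ (by omega)
    obtain ⟨x, hx, hx', hR'⟩ := Z.pieri_one hq hR (by omega) (by exact_mod_cast hne)
    have v1 := Z.val_main hq h3 hR hS hψ
    have hS' : (insert (x+1) (S.erase x)).card = 2 * (m + 1) + 1 := by
      rw [Finset.card_insert_of_notMem (fun h => hx' (Finset.mem_of_mem_erase h)), Finset.card_erase_add_one hx, hS]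
    have v2 := Z.val_main hq h3 hR' hS' hd
    refine ⟨l, ρ, _, hS', ?_, hR'⟩
    rcases half_insert hx hx' with h | h <;> omega
  -- uniqueness
  have un : ∀ χ, Z.deg χ = 2 * m + 1 → ¬ 3 ∣ Z.d χ → ∀ l l' ρ ρ' S S', S.card = 2 * (m + 1) + 1 → (half 1 S).card = m + 2 →
      S'.card = 2 * (m + 1) + 1 → (half 1 S').card = m + 2 → Z.Rep l S ρ χ → Z.Rep l' S' ρ' χ → l = l' := by
    intro χ hχ hd l l' ρ ρ' S S' hS hS1 hS' hS1' hR hR'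
    by_contra hl
    have v1 := Z.val_main hq h3 hR hS hd
    obtain ⟨T, σ, hT, hRT⟩ := Z.exists_rep hq l' (2 * (m + 1) + 1) ρ (by omega)
    have v2 := Z.val_main hq h3 hRT hT v1.1
    obtain ⟨ψ, hψ⟩ := Rep.indep Z hq hl hR hRT
    have := (hψ.unique Z hR' (hT.trans hS'.symm)).1
    subst this
    omega
  have single_inj : ∀ b b' : B, Finsupp.single b (1:ℤ) = Finsupp.single b' 1 → b = b' :=
    fun b b' h => Finsupp.single_left_injective one_ne_zero h
  have fex : ∀ χ : {b // Z.deg b = 2 * m + 1 ∧ ¬ 3 ∣ Z.d b}, ∃ p : L × {b // Z.deg b = 2 * m ∧ ¬ 3 ∣ Z.d b},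
      ∃ ρ S, S.card = 2 * (m + 1) + 1 ∧ (half 1 S).card = m + 2 ∧ Z.Rep p.1 S ρ χ.1 ∧ Z.Rep p.1 (swapT S) ρ p.2.1 := by
    rintro ⟨χ, hχ, hd⟩
    obtain ⟨l, ρ, S, hS, hS1, hR⟩ := ex χ hχ hd
    obtain ⟨ψ, hψ⟩ := Z.exists_rep_of hq l ρ hR.free (swapT S)
    have h1 := Z.deg_swap hR hψ
    have h2 := card_half S
    have h3' : Z.deg ψ = 2 * m := by omega
    exact ⟨(l, ⟨ψ, h3', Z.val_swap hq h3 hR hψ (by omega) hd⟩), ρ, S, hS, hS1, hR, hψ⟩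
  choose f hf using fex
  refine ⟨Equiv.ofBijective f ⟨?_, ?_⟩⟩
  · intro χ χ' hff
    obtain ⟨ρ, S, hS, hS1, hR, hR'⟩ := hf χ
    obtain ⟨ρ2, S2, hS2, hS12, hR2, hR2'⟩ := hf χ'
    rw [← hff] at hR2 hR2'
    obtain ⟨e1, rfl⟩ := Rep.unique Z hR' hR2' (by rw [card_swapT, card_swapT, hS, hS2])
    have e2 : S = S2 := by rw [← swapT_swapT S, e1, swapT_swapT]
    subst e2
    exact Subtype.ext (single_inj _ _ (hR.eq.symm.trans hR2.eq))
  · rintro ⟨l, ψ, hψ, hd⟩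
    obtain ⟨S, ρ, hS, hR⟩ := Z.exists_rep hq l (2 * (m + 1) + 1) ψ (by omega)
    have v1 := Z.val_main hq h3 hR hS hd
    obtain ⟨χ, hχ⟩ := Z.exists_rep_of hq l ρ hR.free (swapT S)
    have h1 := Z.deg_swap hR hχ
    have h2 := card_half S
    have hc : Z.deg χ = 2 * m + 1 := by omega
    have hdc := Z.val_swap hq h3 hR hχ (by omega) hd
    refine ⟨⟨χ, hc, hdc⟩, ?_⟩
    obtain ⟨ρ2, S2, hS2, hS12, hR2, hR2'⟩ := hf ⟨χ, hc, hdc⟩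
    have el := un χ hc hdc _ l _ _ _ _ hS2 hS12 (by rw [card_swapT, hS]) (by rw [half_swapT1]; omega) hR2 hχ
    rw [el] at hR2 hR2'
    obtain ⟨e1, rfl⟩ := Rep.unique Z hR2 hχ (by rw [card_swapT, hS, hS2])
    rw [e1, swapT_swapT] at hR2'
    exact Prod.ext el (Subtype.ext (single_inj _ _ (hR2'.eq.symm.trans hR.eq)))

end PSH
end OEB

namespace OEB

section chars
variable {G : Type} [Group G] [Fintype G]
set_option linter.unusedSectionVars false

instance instInv : Invertible (Nat.card G : ℂ) := invertibleOfNonzero (by simp [Nat.card_eq_fintype_card])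

lemma irr_of_irreducible {V : Type} [AddCommGroup V] [Module ℂ V] [FiniteDimensional ℂ V] (ρ : Representation ℂ G V)
    [ρ.IsIrreducible] : ρ.character ∈ Irr G := by
  refine ⟨FDRep.of ρ, ?_, ?_⟩
  · rw [FDRep.simple_iff_char_is_norm_one]
    have h := Representation.char_orthonormal ρ ρ
    rw [if_pos ⟨Representation.Equiv.refl ρ⟩] at h
    have h0 : (Nat.card G : ℂ) ≠ 0 := by simp [Nat.card_eq_fintype_card]
    field_simp at h
    exact h
  · rfl

lemma irr_class {χ : G → ℂ} (h : χ ∈ Irr G) (x y : G) : χ (x * y * x⁻¹) = χ y := by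
  obtain ⟨V, _, rfl⟩ := h
  exact V.char_conj y x

lemma irr_orth {χ ψ : G → ℂ} (h : χ ∈ Irr G) (h' : ψ ∈ Irr G) :
    ∑ g, χ g * ψ g⁻¹ = if χ = ψ then (Nat.card G : ℂ) else 0 := by
  obtain ⟨V, hV, rfl⟩ := h
  obtain ⟨W, hW, rfl⟩ := h'
  have h := FDRep.char_orthonormal V W
  have h0 : (Nat.card G : ℂ) ≠ 0 := by simp [Nat.card_eq_fintype_card]
  split_ifs at h with hi
  · rw [if_pos (FDRep.char_iso hi.some)]
    field_simp at h
    exact h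
  · rw [if_neg]
    · simpa using h
    · intro he
      have h2 := FDRep.char_orthonormal V V
      rw [if_pos ⟨CategoryTheory.Iso.refl _⟩] at h2
      rw [← he, h2] at h
      exact one_ne_zero h


def Tf (f : G → ℂ) {V : Type} [AddCommGroup V] [Module ℂ V] (ρ : Representation ℂ G V) : V →ₗ[ℂ] V := ∑ g, f g • ρ g⁻¹

lemma Tf_apply (f : G → ℂ) {V : Type} [AddCommGroup V] [Module ℂ V] (ρ : Representation ℂ G V) (v : V) :
    Tf f ρ v = ∑ g, f g • ρ g⁻¹ v := by simp [Tf]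

lemma Tf_irr (f : G → ℂ) (hf : ∀ x y, f (x * y * x⁻¹) = f y)
    (h0 : ∀ χ ∈ Irr G, ∑ g, f g * χ g⁻¹ = 0) {V : Type} [AddCommGroup V] [Module ℂ V] [FiniteDimensional ℂ V]
    (ρ : Representation ℂ G V) [ρ.IsIrreducible] : Tf f ρ = 0 := by
  have hT : ∀ (y : G) (v : V), Tf f ρ (ρ y v) = ρ y (Tf f ρ v) := by
    intro y v
    rw [Tf_apply, Tf_apply, map_sum, ← (MulAut.conj y).toEquiv.sum_comp]
    refine Finset.sum_congr rfl fun g _ => ?_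
    simp only [MulEquiv.toEquiv_eq_coe, EquivLike.coe_coe, MulAut.conj_apply, map_smul]
    rw [hf, ← Module.End.mul_apply, ← Module.End.mul_apply, ← map_mul, ← map_mul]
    congr 3
    group
  let T : ρ.IntertwiningMap ρ := LinearMap.intertwiningMap_of_isIntertwiningMap ρ ρ (Tf f ρ) hT
  obtain ⟨c, hc⟩ := (Representation.IsIrreducible.algebraMap_intertwiningMap_bijective_of_isAlgClosed (ρ := ρ)).2 T
  have h1 : Tf f ρ = c • LinearMap.id := by
    have h2 : T.toLinearMap = Tf f ρ := rfl
    rw [← h2, ← hc]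
    ext v
    simp [Algebra.algebraMap_eq_smul_one]
  have h2 := h0 _ (irr_of_irreducible ρ)
  have h3 : ∑ g, f g * ρ.character g⁻¹ = LinearMap.trace ℂ V (Tf f ρ) := by
    simp [Tf, Representation.character]
  rw [h3, h1, map_smul, LinearMap.trace_id, smul_eq_mul] at h2
  rw [h1]
  rcases mul_eq_zero.mp h2 with h | h
  · rw [h, zero_smul]
  · have : Module.finrank ℂ V = 0 := by exact_mod_cast h
    have := Module.finrank_zero_iff.mp this
    ext v
    exact Subsingleton.elim _ _

lemma Tf_zero (f : G → ℂ) (hf : ∀ x y, f (x * y * x⁻¹) = f y)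
    (h0 : ∀ χ ∈ Irr G, ∑ g, f g * χ g⁻¹ = 0) (n : ℕ) : ∀ {V : Type} [AddCommGroup V] [Module ℂ V] [FiniteDimensional ℂ V]
    (ρ : Representation ℂ G V), Module.finrank ℂ V = n → Tf f ρ = 0 := by
  induction n using Nat.strong_induction_on with
  | _ n ih =>
  intro V _ _ _ ρ hn
  by_cases hirr : ρ.IsIrreducible
  · exact Tf_irr f hf h0 ρ
  by_cases hs : Subsingleton V
  · ext v; exact Subsingleton.elim _ _
  have hnt : Nontrivial V := not_subsingleton_iff_nontrivial.mp hs
  have : ∃ W : Subrepresentation ρ, W ≠ ⊥ ∧ W ≠ ⊤ := by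
    by_contra hc
    push Not at hc
    apply hirr
    have : Nontrivial (Subrepresentation ρ) := ⟨⊥, ⊤, fun h => by
      have := congrArg Subrepresentation.toSubmodule h
      exact bot_ne_top this⟩
    exact ⟨fun W => or_iff_not_imp_left.mpr (hc W)⟩
  obtain ⟨W, hb, ht⟩ := this
  obtain ⟨W', hW⟩ := exists_isCompl W
  have hb' : W' ≠ ⊥ := by
    rintro rfl
    exact ht (by simpa using hW.sup_eq_top)
  have ht' : W' ≠ ⊤ := by
    rintro rfl
    exact hb (by simpa using hW.inf_eq_bot)
  have sub : ∀ U : Subrepresentation ρ, U ≠ ⊤ → ∀ v ∈ U.toSubmodule, Tf f ρ v = 0 := by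
    intro U hU v hv
    have hlt : Module.finrank ℂ U.toSubmodule < n := by
      rw [← hn]
      apply Submodule.finrank_lt
      intro h
      exact hU (Subrepresentation.toSubmodule_injective h)
    have := ih _ hlt U.toRepresentation rfl
    have h2 := congrArg (Submodule.subtype _) (LinearMap.congr_fun this ⟨v, hv⟩)
    rw [Tf_apply, map_sum] at h2
    rw [Tf_apply]
    refine Eq.trans ?_ h2
    refine Finset.sum_congr rfl fun g _ => ?_
    rfl
  ext v
  have hv : v ∈ (W ⊔ W').toSubmodule := by rw [hW.sup_eq_top]; trivial
  rw [Subrepresentation.toSubmodule_sup, Submodule.mem_sup] at hv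
  obtain ⟨a, ha, b, hb, rfl⟩ := hv
  rw [map_add, sub W ht a ha, sub W' ht' b hb]; simp

def regRep : Representation ℂ G (G → ℂ) where
  toFun g := { toFun := fun φ x => φ (g⁻¹ * x), map_add' := fun _ _ => rfl, map_smul' := fun _ _ => rfl }
  map_one' := by ext; simp
  map_mul' := by intro a b; ext; simp [mul_assoc]

lemma regRep_apply (g : G) (φ : G → ℂ) (x : G) : regRep g φ x = φ (g⁻¹ * x) := rfl

lemma class_complete (f : G → ℂ) (hf : ∀ x y, f (x * y * x⁻¹) = f y)
    (h0 : ∀ χ ∈ Irr G, ∑ g, f g * χ g⁻¹ = 0) : f = 0 := by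
  have h := Tf_zero f hf h0 _ (regRep (G := G)) rfl
  funext g
  have h2 := congrFun (LinearMap.congr_fun h (Pi.single 1 1)) g⁻¹
  rw [Tf_apply, Finset.sum_apply] at h2
  rw [Finset.sum_eq_single g] at h2
  · simpa [regRep_apply] using h2
  · intro b _ hb
    rw [Pi.smul_apply, regRep_apply, Pi.single_eq_of_ne, smul_zero]
    intro h
    apply hb
    rw [inv_inv] at h
    exact mul_inv_eq_one.mp h
  · simp

instance irr_finite : Finite (Irr G) := by
  have : LinearIndependent ℂ (fun χ : Irr G => (χ : G → ℂ)) := by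
    rw [linearIndependent_iff']
    intro s c hc χ hχ
    have h1 : ∑ g, (∑ ψ ∈ s, c ψ • (ψ : G → ℂ)) g * (χ : G → ℂ) g⁻¹ = 0 := by rw [hc]; simp
    simp only [Finset.sum_apply, Pi.smul_apply, smul_eq_mul, Finset.sum_mul, mul_assoc] at h1
    rw [Finset.sum_comm] at h1
    simp only [← Finset.mul_sum] at h1
    rw [Finset.sum_eq_single χ] at h1
    · rw [irr_orth χ.2 χ.2, if_pos rfl] at h1
      exact (mul_eq_zero.mp h1).resolve_right (by simp [Nat.card_eq_fintype_card])
    · intro ψ _ hψ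
      rw [irr_orth ψ.2 χ.2, if_neg (fun h => hψ (Subtype.ext h)), mul_zero]
    · intro h; exact absurd hχ h
  exact this.finite

instance irr_fintype : Fintype (Irr G) := Fintype.ofFinite _

lemma col_orth (g g' : G) : ∑ χ : Irr G, (χ : G → ℂ) g⁻¹ * (χ : G → ℂ) g' = (Finset.univ.filter (fun z : G => z * g = g' * z)).card := by
  let f : G → ℂ := fun g' => ∑ χ : Irr G, (χ : G → ℂ) g⁻¹ * (χ : G → ℂ) g' - (Finset.univ.filter (fun z : G => z * g = g' * z)).card
  have : f = 0 := by
    apply class_complete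
    · intro x y
      simp only [f]
      congr 1
      · refine Finset.sum_congr rfl fun χ _ => ?_
        rw [irr_class χ.2]
      · congr 1
        apply Finset.card_bij' (fun z _ => x⁻¹ * z) (fun z _ => x * z)
        · intro z hz
          simp only [Finset.mem_filter, Finset.mem_univ, true_and] at hz ⊢
          rw [mul_assoc, hz]; group
        · intro z hz
          simp only [Finset.mem_filter, Finset.mem_univ, true_and] at hz ⊢
          rw [mul_assoc, hz]; group
        · intro z _; simp
        · intro z _; simp
    · intro ψ hψ
      have h1 : ∀ g', ((Finset.univ.filter (fun z : G => z * g = g' * z)).card : ℂ) = ∑ z : G, if g' = z * g * z⁻¹ then 1 else 0 := by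
        intro g'
        rw [Finset.card_filter]
        push_cast
        refine Finset.sum_congr rfl fun z _ => ?_
        congr 1
        rw [eq_mul_inv_iff_mul_eq]
        exact propext ⟨Eq.symm, Eq.symm⟩
      simp only [f, sub_mul, Finset.sum_sub_distrib, h1, Finset.sum_mul]
      rw [Finset.sum_comm, Finset.sum_comm (γ := G) (α := G)]
      simp only [mul_assoc, ← Finset.mul_sum, ite_mul, one_mul, zero_mul, Finset.sum_ite_eq', Finset.mem_univ, if_true]
      rw [Finset.sum_eq_single (⟨ψ, hψ⟩ : Irr G)]
      · rw [irr_orth hψ hψ, if_pos rfl]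
        have : ∀ z, ψ (z * (g * z⁻¹))⁻¹ = ψ g⁻¹ := by
          intro z
          rw [← irr_class hψ z g⁻¹]
          congr 1; group
        simp only [this, Finset.sum_const, Finset.card_univ, Nat.card_eq_fintype_card, nsmul_eq_mul]
        ring
      · intro χ _ hχ
        rw [irr_orth χ.2 hψ, if_neg (fun h => hχ (Subtype.ext h)), mul_zero]
      · simp
  have h2 := congrFun this g'
  exact sub_eq_zero.mp h2

end chars
end OEB

namespace OEB

section geom
variable {F : Type} [Field F] [Fintype F]
variable {V V' W Y : Type} [AddCommGroup V] [Module F V] [AddCommGroup V'] [Module F V']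
  [AddCommGroup W] [Module F W] [AddCommGroup Y] [Module F Y] [Finite V] [Finite V'] [Finite W] [Finite Y]
set_option linter.all false

instance finLin : Finite (V →ₗ[F] W) := Finite.of_injective (fun f => (f : V → W)) DFunLike.coe_injective
instance finLinE : Finite (V ≃ₗ[F] W) := Finite.of_injective (fun f => (f : V → W)) DFunLike.coe_injective
instance fintLin : Fintype (V →ₗ[F] W) := Fintype.ofFinite _
instance fintLinE : Fintype (V ≃ₗ[F] W) := Fintype.ofFinite _

/-- evaluate a function on the matrix group at an endomorphism, zero at non-units -/
def evM {n : ℕ} (χ : GL (Fin n) F → ℂ) (M : Module.End F (Fin n → F)) : ℂ :=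
  if h : IsUnit M then χ (Matrix.GeneralLinearGroup.toLin.symm h.unit) else 0

/-- evaluate a class function on the matrix group at an endomorphism of an abstract space -/
def XV {n : ℕ} (χ : GL (Fin n) F → ℂ) (V : Type) [AddCommGroup V] [Module F V] (g : Module.End F V) : ℂ :=
  if h : Nonempty (V ≃ₗ[F] (Fin n → F)) then evM χ (h.some.conj g) else 0

def IsClass {G : Type} [Group G] (χ : G → ℂ) : Prop := ∀ x y, χ (x * y * x⁻¹) = χ y

def starf {G : Type} [Group G] (χ : G → ℂ) : G → ℂ := fun g => χ g⁻¹

lemma IsClass.star {G : Type} [Group G] {χ : G → ℂ} (h : IsClass χ) : IsClass (starf χ) := by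
  intro x y
  simp only [starf]
  rw [← h x y⁻¹]
  congr 1; group

lemma conj_isUnit (e : V ≃ₗ[F] V') (g : Module.End F V) : IsUnit (e.conj g) ↔ IsUnit g := by
  constructor
  · intro h
    have := h.map (LinearEquiv.conjRingEquiv e.symm)
    have h2 : (LinearEquiv.conjRingEquiv e.symm) (e.conj g) = g := by
      ext x; simp [LinearEquiv.conjRingEquiv, LinearEquiv.conj_apply]
    rwa [h2] at this
  · intro h
    exact h.map (LinearEquiv.conjRingEquiv e)

lemma evM_conj {n : ℕ} {χ : GL (Fin n) F → ℂ} (h : IsClass χ) (M : Module.End F (Fin n → F))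
    (e : (Fin n → F) ≃ₗ[F] (Fin n → F)) : evM χ (e.conj M) = evM χ M := by
  unfold evM
  by_cases hM : IsUnit M
  · rw [dif_pos hM, dif_pos ((conj_isUnit e M).mpr hM)]
    let E := (LinearMap.GeneralLinearGroup.generalLinearEquiv F (Fin n → F)).symm e
    rw [← h (Matrix.GeneralLinearGroup.toLin.symm E) (Matrix.GeneralLinearGroup.toLin.symm hM.unit), ← map_inv, ← map_mul, ← map_mul]
    congr 2
    ext1
    rfl
  · rw [dif_neg hM, dif_neg (fun h => hM ((conj_isUnit e M).mp h))]

lemma XV_eq {n : ℕ} {χ : GL (Fin n) F → ℂ} (h : IsClass χ) (g : Module.End F V) (e : V ≃ₗ[F] (Fin n → F)) :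
    XV χ V g = evM χ (e.conj g) := by
  have hn : Nonempty (V ≃ₗ[F] (Fin n → F)) := ⟨e⟩
  rw [XV, dif_pos hn, ← evM_conj h (hn.some.conj g) (hn.some.symm.trans e)]
  congr 1
  ext x; simp [LinearEquiv.conj_apply]

lemma XV_conj {n : ℕ} {χ : GL (Fin n) F → ℂ} (h : IsClass χ) (g : Module.End F V) (e : V ≃ₗ[F] V') :
    XV χ V' (e.conj g) = XV χ V g := by
  by_cases hn : Nonempty (V ≃ₗ[F] (Fin n → F))
  · obtain ⟨f⟩ := hn
    rw [XV_eq h g f, XV_eq h _ (e.symm.trans f)]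
    congr 1
    ext x; simp [LinearEquiv.conj_apply]
  · rw [XV, XV, dif_neg hn, dif_neg]
    rintro ⟨f⟩
    exact hn ⟨e.trans f⟩

lemma XV_nonunit {n : ℕ} (χ : GL (Fin n) F → ℂ) (g : Module.End F V) (hg : ¬ IsUnit g) : XV χ V g = 0 := by
  unfold XV
  split_ifs with h
  · rw [evM, dif_neg (fun h' => hg ((conj_isUnit _ g).mp h'))]
  · rfl

lemma XV_dim {n : ℕ} (χ : GL (Fin n) F → ℂ) (g : Module.End F V) (hg : Module.finrank F V ≠ n) : XV χ V g = 0 := by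
  unfold XV
  rw [dif_neg]
  rintro ⟨e⟩
  exact hg (by rw [e.finrank_eq]; simp)

/-- matrices as endomorphisms of an abstract space -/
def lin {n : ℕ} (e : V ≃ₗ[F] (Fin n → F)) (A : GL (Fin n) F) : Module.End F V :=
  e.symm.conj (Matrix.GeneralLinearGroup.toLin A : Module.End F (Fin n → F))

lemma lin_isUnit {n : ℕ} (e : V ≃ₗ[F] (Fin n → F)) (A : GL (Fin n) F) : IsUnit (lin e A) :=
  (conj_isUnit _ _).mpr (Units.isUnit _)

lemma lin_surj {n : ℕ} (e : V ≃ₗ[F] (Fin n → F)) (g : Module.End F V) (hg : IsUnit g) : ∃ A, lin e A = g := by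
  refine ⟨Matrix.GeneralLinearGroup.toLin.symm ((conj_isUnit e g).mpr hg).unit, ?_⟩
  ext x
  simp [lin, LinearEquiv.conj_apply]

lemma lin_inj {n : ℕ} (e : V ≃ₗ[F] (Fin n → F)) : Function.Injective (lin e) := by
  intro A B h
  have h2 := e.symm.conj.injective h
  exact Matrix.GeneralLinearGroup.toLin.injective (Units.ext h2)

lemma lin_mul {n : ℕ} (e : V ≃ₗ[F] (Fin n → F)) (A B : GL (Fin n) F) : lin e (A * B) = lin e A * lin e B := by
  ext x; simp [lin, LinearEquiv.conj_apply]

lemma lin_one {n : ℕ} (e : V ≃ₗ[F] (Fin n → F)) : lin e 1 = 1 := by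
  ext x; simp [lin, LinearEquiv.conj_apply]

lemma XV_lin {n : ℕ} {χ : GL (Fin n) F → ℂ} (h : IsClass χ) (e : V ≃ₗ[F] (Fin n → F)) (A : GL (Fin n) F) :
    XV χ V (lin e A) = χ A := by
  rw [XV_eq h _ e]
  have : e.conj (lin e A) = (Matrix.GeneralLinearGroup.toLin A : Module.End F (Fin n → F)) := by
    ext x; simp [lin, LinearEquiv.conj_apply]
  rw [this, evM, dif_pos (Units.isUnit _)]
  congr 1
  rw [MulEquiv.symm_apply_eq]
  ext1; rfl

lemma sum_lin {n : ℕ} (e : V ≃ₗ[F] (Fin n → F)) (φ : Module.End F V → ℂ) (hφ : ∀ g, ¬ IsUnit g → φ g = 0) :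
    ∑ g : Module.End F V, φ g = ∑ A : GL (Fin n) F, φ (lin e A) := by
  symm
  apply Finset.sum_of_injOn (lin e)
  · exact (lin_inj e).injOn
  · simp
  · intro g _ hg
    apply hφ
    intro hu
    obtain ⟨A, rfl⟩ := lin_surj e g hu
    exact hg ⟨A, by simp, rfl⟩
  · simp

/-- linear equivalences from matrices -/
lemma sum_equiv {n : ℕ} (e : V ≃ₗ[F] (Fin n → F)) (e' : V' ≃ₗ[F] (Fin n → F)) (φ : (V ≃ₗ[F] V') → ℂ) :
    ∑ z, φ z = ∑ A : GL (Fin n) F, φ (e.trans ((LinearMap.GeneralLinearGroup.generalLinearEquiv F _ (Matrix.GeneralLinearGroup.toLin A)).trans e'.symm)) := by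
  symm
  refine Fintype.sum_bijective _ ⟨?_, ?_⟩ _ _ (fun A => rfl)
  · intro A B h
    apply Matrix.GeneralLinearGroup.toLin.injective
    apply (LinearMap.GeneralLinearGroup.generalLinearEquiv F _).injective
    refine LinearEquiv.ext fun x => ?_
    have := congrArg (fun z : V ≃ₗ[F] V' => e' (z (e.symm x))) h
    simpa using this
  · intro z
    refine ⟨Matrix.GeneralLinearGroup.toLin.symm ((LinearMap.GeneralLinearGroup.generalLinearEquiv F _).symm (e.symm.trans (z.trans e'))), ?_⟩
    ext x
    simp

lemma col_orth_V {n : ℕ} (e : V ≃ₗ[F] (Fin n → F)) (e' : V' ≃ₗ[F] (Fin n → F)) (g : Module.End F V) (hg : IsUnit g)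
    (g' : Module.End F V') (hg' : IsUnit g') :
    ∑ c : Irr (GL (Fin n) F), XV c.1 V g * XV (starf c.1) V' g' = ∑ z : V ≃ₗ[F] V', if (z : V →ₗ[F] V') ∘ₗ g = g' ∘ₗ (z : V →ₗ[F] V') then 1 else 0 := by
  obtain ⟨A, rfl⟩ := lin_surj e g hg
  obtain ⟨B, rfl⟩ := lin_surj e' g' hg'
  have : ∀ c : Irr (GL (Fin n) F), XV c.1 V (lin e A) * XV (starf c.1) V' (lin e' B) = c.1 B⁻¹ * c.1 A := by
    intro c
    have hc : IsClass c.1 := irr_class c.2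
    rw [XV_lin hc, XV_lin hc.star, starf, mul_comm]
  rw [Finset.sum_congr rfl (fun c _ => this c), col_orth, sum_equiv e e', Finset.card_filter]
  push_cast
  rw [← Equiv.sum_comp (Equiv.inv (GL (Fin n) F))]
  refine Finset.sum_congr rfl fun z _ => ?_
  congr 1
  apply propext
  rw [Equiv.inv_apply, inv_mul_eq_iff_eq_mul, ← mul_assoc, eq_mul_inv_iff_mul_eq, eq_comm]
  rw [← (lin_inj e).eq_iff, lin_mul, lin_mul]
  constructor
  · intro h
    ext x
    have := congrArg (fun u => e'.symm (e (u x))) h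
    simpa [lin, LinearEquiv.conj_apply] using this
  · intro h
    ext x
    have := congrArg (fun u => e.symm (e' (u x))) h
    simpa [lin, LinearEquiv.conj_apply] using this

end geom
end OEB

namespace OEB

section geom2
variable {F : Type} [Field F] [Fintype F]
variable {V V' W Y X : Type} [AddCommGroup V] [Module F V] [AddCommGroup V'] [Module F V']
  [AddCommGroup W] [Module F W] [AddCommGroup Y] [Module F Y] [AddCommGroup X] [Module F X]
  [Finite V] [Finite V'] [Finite W] [Finite Y] [Finite X]
set_option linter.all false

/-- block triangular endomorphism -/
def blk (a : Module.End F W) (C : Y →ₗ[F] W) (E : Module.End F Y) : Module.End F (W × Y) :=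
  LinearMap.prod (a ∘ₗ LinearMap.fst F W Y + C ∘ₗ LinearMap.snd F W Y) (E ∘ₗ LinearMap.snd F W Y)

@[simp] lemma blk_apply (a : Module.End F W) (C : Y →ₗ[F] W) (E : Module.End F Y) (p : W × Y) :
    blk a C E p = (a p.1 + C p.2, E p.2) := rfl

lemma det_blk (a : Module.End F W) (C : Y →ₗ[F] W) (E : Module.End F Y) :
    LinearMap.det (blk a C E) = LinearMap.det a * LinearMap.det E := by
  let b := Module.finBasis F W
  let b' := Module.finBasis F Y
  rw [← LinearMap.det_toMatrix (b.prod b'), ← LinearMap.det_toMatrix b, ← LinearMap.det_toMatrix b',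
    ← Matrix.det_fromBlocks_zero₂₁ _ (LinearMap.toMatrix b' b C)]
  congr 1
  ext i j
  rcases i with i | i <;> rcases j with j | j <;> simp [LinearMap.toMatrix_apply, Matrix.fromBlocks]

lemma isUnit_det (g : Module.End F V) : IsUnit g ↔ LinearMap.det g ≠ 0 := by
  rw [LinearMap.isUnit_iff_isUnit_det, isUnit_iff_ne_zero]

lemma isUnit_blk (a : Module.End F W) (C : Y →ₗ[F] W) (E : Module.End F Y) :
    IsUnit (blk a C E) ↔ IsUnit a ∧ IsUnit E := by
  rw [isUnit_det, isUnit_det, isUnit_det, det_blk, mul_ne_zero_iff]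

lemma blk_inj : Function.Injective (fun p : Module.End F W × (Y →ₗ[F] W) × Module.End F Y => blk p.1 p.2.1 p.2.2) := by
  rintro ⟨a, C, E⟩ ⟨a', C', E'⟩ h
  have h1 : ∀ w y, blk a C E (w, y) = blk a' C' E' (w, y) := fun w y => LinearMap.congr_fun h (w, y)
  have ha : a = a' := by
    ext w
    have := congrArg Prod.fst (h1 w 0)
    simpa using this
  have hC : C = C' := by
    ext w
    have := congrArg Prod.fst (h1 0 w)
    simpa using this
  have hE : E = E' := by
    ext w
    have := congrArg Prod.snd (h1 0 w)
    simpa using this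
  rw [ha, hC, hE]

/-- first factor -/
def W0 (F W Y : Type) [Field F] [AddCommGroup W] [Module F W] [AddCommGroup Y] [Module F Y] : Submodule F (W × Y) :=
  LinearMap.range (LinearMap.inl F W Y)

lemma mem_W0 (p : W × Y) : p ∈ W0 F W Y ↔ p.2 = 0 := by
  constructor
  · rintro ⟨w, rfl⟩; rfl
  · intro h; exact ⟨p.1, by ext <;> simp [h]⟩

lemma blk_stab (a : Module.End F W) (C : Y →ₗ[F] W) (E : Module.End F Y) : ∀ x ∈ W0 F W Y, blk a C E x ∈ W0 F W Y := by
  intro x hx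
  rw [mem_W0] at *
  simp [hx]

lemma exists_blk (g : Module.End F (W × Y)) (hg : ∀ x ∈ W0 F W Y, g x ∈ W0 F W Y) : ∃ a C E, g = blk a C E := by
  refine ⟨LinearMap.fst F W Y ∘ₗ g ∘ₗ LinearMap.inl F W Y, LinearMap.fst F W Y ∘ₗ g ∘ₗ LinearMap.inr F W Y,
    LinearMap.snd F W Y ∘ₗ g ∘ₗ LinearMap.inr F W Y, ?_⟩
  refine LinearMap.ext fun p => ?_
  have h1 : g p = g (p.1, 0) + g (0, p.2) := by rw [← map_add]; simp
  have h2 := (mem_W0 _).mp (hg (p.1, 0) ((mem_W0 _).mpr rfl))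
  rw [h1]
  ext
  · simp
  · simp [h2]

lemma sum_blk (φ : Module.End F (W × Y) → ℂ) (hφ : ∀ g, ¬ (∀ x ∈ W0 F W Y, g x ∈ W0 F W Y) → φ g = 0) :
    ∑ g, φ g = ∑ a, ∑ C, ∑ E, φ (blk a C E) := by
  rw [← Fintype.sum_prod_type', ← Fintype.sum_prod_type' (f := fun (p : Module.End F W × (Y →ₗ[F] W)) E => φ (blk p.1 p.2 E)),
    ← (Equiv.prodAssoc _ _ _).symm.sum_comp]
  symm
  apply Finset.sum_of_injOn (fun p : Module.End F W × (Y →ₗ[F] W) × Module.End F Y => blk p.1 p.2.1 p.2.2)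
  · exact blk_inj.injOn
  · simp
  · intro g _ hg
    apply hφ
    intro hs
    obtain ⟨a, C, E, rfl⟩ := exists_blk g hs
    exact hg ⟨(a, C, E), by simp, rfl⟩
  · simp

/-- twisted class function -/
def fX {n : ℕ} (χ : GL (Fin n) F → ℂ) (l : MulChar F ℂ) (V : Type) [AddCommGroup V] [Module F V] (g : Module.End F V) : ℂ :=
  l (LinearMap.det g) * XV χ V g

lemma det_conj' (g : Module.End F V) (e : V ≃ₗ[F] V') : LinearMap.det (e.conj g) = LinearMap.det g := by
  rw [LinearEquiv.conj_apply]
  exact LinearMap.det_conj g e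

lemma fX_conj {n : ℕ} {χ : GL (Fin n) F → ℂ} (h : IsClass χ) (l : MulChar F ℂ) (g : Module.End F V) (e : V ≃ₗ[F] V') :
    fX χ l V' (e.conj g) = fX χ l V g := by
  rw [fX, fX, XV_conj h, det_conj']

/-- evaluate on an invariant subspace -/
def RR {n : ℕ} (χ : GL (Fin n) F → ℂ) (l : MulChar F ℂ) (U : Submodule F V) (g : Module.End F V) : ℂ :=
  if h : ∀ x ∈ U, g x ∈ U then fX χ l U (g.restrict h) else 0

lemma RR_eq {n : ℕ} {χ : GL (Fin n) F → ℂ} (h : IsClass χ) (l : MulChar F ℂ) (j : X →ₗ[F] V) (hj : Function.Injective j)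
    (g : Module.End F V) (a : Module.End F X) (hg : ∀ x, g (j x) = j (a x)) :
    RR χ l (LinearMap.range j) g = fX χ l X a := by
  have hs : ∀ x ∈ LinearMap.range j, g x ∈ LinearMap.range j := by
    rintro _ ⟨x, rfl⟩
    exact ⟨a x, (hg x).symm⟩
  rw [RR, dif_pos hs, ← fX_conj h l a (LinearEquiv.ofInjective j hj)]
  congr 1
  refine LinearMap.ext fun y => ?_
  obtain ⟨x, rfl⟩ := (LinearEquiv.ofInjective j hj).surjective y
  ext
  simp [LinearEquiv.conj_apply, hg]

lemma RR_conj {n : ℕ} {χ : GL (Fin n) F → ℂ} (h : IsClass χ) (l : MulChar F ℂ) (U : Submodule F V) (g : Module.End F V)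
    (z : V ≃ₗ[F] V') : RR χ l (U.map (z : V →ₗ[F] V')) (z.conj g) = RR χ l U g := by
  by_cases hs : ∀ x ∈ U, g x ∈ U
  · have : U.map (z : V →ₗ[F] V') = LinearMap.range ((z : V →ₗ[F] V') ∘ₗ U.subtype) := by
      rw [LinearMap.range_comp, Submodule.range_subtype]
    rw [this, RR_eq h l _ _ _ (g.restrict hs)]
    · rw [RR, dif_pos hs]
    · intro x; simp [LinearEquiv.conj_apply]
    · exact z.injective.comp U.injective_subtype
  · rw [RR, RR, dif_neg hs, dif_neg]
    intro h2
    apply hs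
    intro x hx
    have := h2 (z x) ⟨x, hx, rfl⟩
    obtain ⟨y, hy, hyx⟩ := this
    have h3 : y = g x := by
      apply z.injective
      simpa [LinearEquiv.conj_apply] using hyx
    rw [← h3]; exact hy

lemma RR_blk {n : ℕ} {χ : GL (Fin n) F → ℂ} (h : IsClass χ) (l : MulChar F ℂ) (a : Module.End F W) (C : Y →ₗ[F] W) (E : Module.End F Y) :
    RR χ l (W0 F W Y) (blk a C E) = fX χ l W a := by
  apply RR_eq h l
  · exact LinearMap.inl_injective
  · intro x; ext <;> simp

/-- the double coset sum -/
def Ph {n n' : ℕ} (μ l l' : MulChar F ℂ) (χ : GL (Fin n) F → ℂ) (χ' : GL (Fin n') F → ℂ) (U U' : Submodule F V) : ℂ :=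
  ∑ g : Module.End F V, μ (LinearMap.det g) * RR χ l U g * RR χ' l' U' g

lemma Ph_conj {n n' : ℕ} (μ l l' : MulChar F ℂ) {χ : GL (Fin n) F → ℂ} {χ' : GL (Fin n') F → ℂ} (h : IsClass χ) (h' : IsClass χ')
    (U U' : Submodule F V) (z : V ≃ₗ[F] V') :
    Ph μ l l' χ χ' (U.map (z : V →ₗ[F] V')) (U'.map (z : V →ₗ[F] V')) = Ph μ l l' χ χ' U U' := by
  unfold Ph
  rw [← z.conj.toEquiv.sum_comp]
  refine Finset.sum_congr rfl fun g _ => ?_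
  change μ (LinearMap.det (z.conj g)) * RR χ l _ (z.conj g) * RR χ' l' _ (z.conj g) = _
  rw [RR_conj h, RR_conj h', det_conj']

lemma parseval_gen {n : ℕ} (e : V ≃ₗ[F] (Fin n → F)) (e' : V' ≃ₗ[F] (Fin n → F)) (φ : Module.End F V → ℂ) (φ' : Module.End F V' → ℂ)
    (hφ : ∀ g, ¬ IsUnit g → φ g = 0) :
    ∑ c : Irr (GL (Fin n) F), (∑ g, φ g * XV c.1 V g) * (∑ g, φ' g * XV (starf c.1) V' g) =
    ∑ z : V ≃ₗ[F] V', ∑ g, φ g * φ' (z.conj g) := by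
  have h1 : ∀ c : Irr (GL (Fin n) F), (∑ g, φ g * XV c.1 V g) * (∑ g, φ' g * XV (starf c.1) V' g) =
    ∑ g, ∑ g', φ g * φ' g' * (XV c.1 V g * XV (starf c.1) V' g') := by
    intro c
    rw [Finset.sum_mul_sum]
    refine Finset.sum_congr rfl fun g _ => Finset.sum_congr rfl fun g' _ => ?_
    ring
  rw [Finset.sum_congr rfl (fun c _ => h1 c), Finset.sum_comm]
  conv_rhs => rw [Finset.sum_comm]
  refine Finset.sum_congr rfl fun g _ => ?_
  rw [Finset.sum_comm]
  conv_lhs => simp only [← Finset.mul_sum]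
  by_cases hg : IsUnit g
  · have h2 : ∀ g' : Module.End F V', φ g * φ' g' * ∑ c : Irr (GL (Fin n) F), XV c.1 V g * XV (starf c.1) V' g' =
      ∑ z : V ≃ₗ[F] V', if g' = z.conj g then φ g * φ' g' else 0 := by
      intro g'
      have h3 : ∀ z : V ≃ₗ[F] V', g' = z.conj g ↔ (z : V →ₗ[F] V') ∘ₗ g = g' ∘ₗ (z : V →ₗ[F] V') := by
        intro z
        constructor
        · rintro rfl
          ext x; simp [LinearEquiv.conj_apply]
        · intro h
          ext x
          have := LinearMap.congr_fun h (z.symm x)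
          simpa [LinearEquiv.conj_apply] using this.symm
      by_cases hg' : IsUnit g'
      · rw [col_orth_V e e' g hg g' hg', Finset.mul_sum]
        refine Finset.sum_congr rfl fun z _ => ?_
        simp only [h3]
        simp
      · rw [Finset.sum_eq_zero, Finset.sum_eq_zero, mul_zero]
        · intro z _
          rw [if_neg]
          rintro rfl
          exact hg' ((conj_isUnit z g).mpr hg)
        · intro c _
          rw [XV_nonunit _ _ hg', mul_zero]
    rw [Finset.sum_congr rfl (fun g' _ => h2 g'), Finset.sum_comm]
    refine Finset.sum_congr rfl fun z _ => ?_
    simp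
  · simp [hφ g hg]

end geom2
end OEB

namespace OEB

section geom3
variable {F : Type} [Field F] [Fintype F]
variable {V V' M : Type} [AddCommGroup V] [Module F V] [AddCommGroup V'] [Module F V']
  [AddCommGroup M] [Module F M] [Finite V] [Finite V'] [Finite M]
set_option linter.all false

/-- number of isomorphisms carrying a pair of subspaces to another pair -/
def cnt (A B : Submodule F M) (U U' : Submodule F V) : ℂ :=
  ∑ y : M ≃ₗ[F] V, if A.map (y : M →ₗ[F] V) = U ∧ B.map (y : M →ₗ[F] V) = U' then 1 else 0

lemma map_trans {V V' M : Type} [AddCommGroup V] [Module F V] [AddCommGroup V'] [Module F V']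
  [AddCommGroup M] [Module F M] (A : Submodule F M) (y : M ≃ₗ[F] V) (z : V ≃ₗ[F] V') :
    A.map ((y.trans z : M ≃ₗ[F] V') : M →ₗ[F] V') = (A.map (y : M →ₗ[F] V)).map (z : V →ₗ[F] V') := by
  rw [LinearEquiv.coe_trans, Submodule.map_comp]

lemma map_symm_eq (A : Submodule F M) (U : Submodule F V) (y : M ≃ₗ[F] V) :
    A.map (y : M →ₗ[F] V) = U ↔ U.map (y.symm : V →ₗ[F] M) = A := by
  constructor
  · rintro rfl
    rw [← map_trans]; simp
  · rintro rfl
    rw [← map_trans]; simp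

/-- precomposition equivalence -/
def transEquiv (z : V ≃ₗ[F] V') : (M ≃ₗ[F] V) ≃ (M ≃ₗ[F] V') where
  toFun y := y.trans z
  invFun y := y.trans z.symm
  left_inv y := by ext; simp
  right_inv y := by ext; simp

def transEquiv' (y : M ≃ₗ[F] V) : (V ≃ₗ[F] V') ≃ (M ≃ₗ[F] V') where
  toFun z := y.trans z
  invFun z := y.symm.trans z
  left_inv y := by ext; simp
  right_inv y := by ext; simp

lemma cnt_torsor (A B : Submodule F M) (U U' : Submodule F V) (y : M ≃ₗ[F] V)
    (h : A.map (y : M →ₗ[F] V) = U ∧ B.map (y : M →ₗ[F] V) = U') : cnt A B U U' = cnt A B A B := by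
  unfold cnt
  rw [← (transEquiv y).sum_comp]
  refine Finset.sum_congr rfl fun w _ => ?_
  congr 1
  change (A.map ((w.trans y : M ≃ₗ[F] V) : M →ₗ[F] V) = U ∧ B.map ((w.trans y : M ≃ₗ[F] V) : M →ₗ[F] V) = U') = _
  rw [map_trans, map_trans, map_symm_eq (V := V), map_symm_eq (V := V), (map_symm_eq _ _ _).mp h.1, (map_symm_eq _ _ _).mp h.2]
  exact propext ⟨fun h => ⟨h.1.symm, h.2.symm⟩, fun h => ⟨h.1.symm, h.2.symm⟩⟩

lemma cnt_torsor' (A B : Submodule F M) (U U' : Submodule F V) (y : M ≃ₗ[F] V)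
    (h : A.map (y : M →ₗ[F] V) = U ∧ B.map (y : M →ₗ[F] V) = U') : cnt A B U U' = cnt U U' U U' := by
  unfold cnt
  rw [← (transEquiv' y).sum_comp]
  refine Finset.sum_congr rfl fun w _ => ?_
  congr 1
  change (A.map ((y.trans w : M ≃ₗ[F] V) : M →ₗ[F] V) = U ∧ B.map ((y.trans w : M ≃ₗ[F] V) : M →ₗ[F] V) = U') = _
  rw [map_trans, map_trans, h.1, h.2]

lemma orbit_main {n n' : ℕ} (μ l l' : MulChar F ℂ) {χ : GL (Fin n) F → ℂ} {χ' : GL (Fin n') F → ℂ} (h : IsClass χ) (h' : IsClass χ')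
    (A B : Submodule F M) (U : Submodule F V) (U' : Submodule F V') :
    cnt A B A B * ∑ z : V ≃ₗ[F] V', (if ∃ y : M ≃ₗ[F] V, A.map (y : M →ₗ[F] V) = U ∧ B.map (y : M →ₗ[F] V) = U'.map (z.symm : V' →ₗ[F] V)
      then Ph μ l l' χ χ' U (U'.map (z.symm : V' →ₗ[F] V)) else 0) = cnt A A U U * cnt B B U' U' * Ph μ l l' χ χ' A B := by
  rw [Finset.mul_sum]
  have h1 : ∀ z : V ≃ₗ[F] V', cnt A B A B * (if ∃ y : M ≃ₗ[F] V, A.map (y : M →ₗ[F] V) = U ∧ B.map (y : M →ₗ[F] V) = U'.map (z.symm : V' →ₗ[F] V)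
      then Ph μ l l' χ χ' U (U'.map (z.symm : V' →ₗ[F] V)) else 0) = cnt A B U (U'.map (z.symm : V' →ₗ[F] V)) * Ph μ l l' χ χ' A B := by
    intro z
    split_ifs with hy
    · obtain ⟨y, hy⟩ := hy
      rw [cnt_torsor A B _ _ y hy, ← Ph_conj μ l l' h h' A B y, hy.1, hy.2]
    · rw [mul_zero, cnt, Finset.sum_eq_zero, zero_mul]
      intro y _
      rw [if_neg]
      intro hy2
      exact hy ⟨y, hy2⟩
  rw [Finset.sum_congr rfl (fun z _ => h1 z), ← Finset.sum_mul]
  congr 1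
  unfold cnt
  rw [Finset.sum_comm, Finset.sum_mul]
  refine Finset.sum_congr rfl fun y _ => ?_
  by_cases hy : A.map (y : M →ₗ[F] V) = U
  · simp only [hy, true_and, and_self, if_true, one_mul]
    rw [← (transEquiv' y).sum_comp]
    refine Finset.sum_congr rfl fun z _ => ?_
    congr 1
    apply propext
    change _ ↔ B.map ((y.trans z : M ≃ₗ[F] V') : M →ₗ[F] V') = U'
    rw [map_trans, map_symm_eq (V := V')]
    exact eq_comm
  · simp [hy]

section adapted
variable {T A B D : Type} [AddCommGroup T] [Module F T] [AddCommGroup A] [Module F A]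
  [AddCommGroup B] [Module F B] [AddCommGroup D] [Module F D] [Finite T] [Finite A] [Finite B] [Finite D]

variable (F T A B D) in
/-- inclusion -/
def jA : T × A →ₗ[F] (T × (A × B)) × D :=
  LinearMap.inl F (T × (A × B)) D ∘ₗ LinearMap.prodMap LinearMap.id (LinearMap.inl F A B)

variable (F T A B D) in
/-- inclusion -/
def jB : T × B →ₗ[F] (T × (A × B)) × D :=
  LinearMap.inl F (T × (A × B)) D ∘ₗ LinearMap.prodMap LinearMap.id (LinearMap.inr F A B)

variable (F T A B D) in
def TA : Submodule F ((T × (A × B)) × D) := LinearMap.range (jA F T A B D)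
variable (F T A B D) in
def TB : Submodule F ((T × (A × B)) × D) := LinearMap.range (jB F T A B D)

lemma jA_apply (p : T × A) : jA F T A B D p = ((p.1, (p.2, 0)), 0) := rfl
lemma jB_apply (p : T × B) : jB F T A B D p = ((p.1, (0, p.2)), 0) := rfl

lemma jA_inj : Function.Injective (jA F T A B D) := by
  rintro ⟨t, a⟩ ⟨t', a'⟩ h
  simpa [jA_apply] using h

lemma jB_inj : Function.Injective (jB F T A B D) := by
  rintro ⟨t, a⟩ ⟨t', a'⟩ h
  simpa [jB_apply] using h

lemma mem_TA (p : (T × (A × B)) × D) : p ∈ TA F T A B D ↔ p.1.2.2 = 0 ∧ p.2 = 0 := by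
  constructor
  · rintro ⟨w, rfl⟩; simp [jA_apply]
  · rintro ⟨h, h'⟩; exact ⟨(p.1.1, p.1.2.1), by ext <;> simp [jA_apply, h, h']⟩

lemma mem_TB (p : (T × (A × B)) × D) : p ∈ TB F T A B D ↔ p.1.2.1 = 0 ∧ p.2 = 0 := by
  constructor
  · rintro ⟨w, rfl⟩; simp [jB_apply]
  · rintro ⟨h, h'⟩; exact ⟨(p.1.1, p.1.2.2), by ext <;> simp [jB_apply, h, h']⟩

lemma finrank_TA : Module.finrank F (TA F T A B D) = Module.finrank F T + Module.finrank F A := by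
  rw [TA, LinearMap.finrank_range_of_inj jA_inj, Module.finrank_prod]

lemma finrank_TB : Module.finrank F (TB F T A B D) = Module.finrank F T + Module.finrank F B := by
  rw [TB, LinearMap.finrank_range_of_inj jB_inj, Module.finrank_prod]

lemma finrank_TAB : Module.finrank F (TA F T A B D ⊓ TB F T A B D : Submodule F _) = Module.finrank F T := by
  have : (TA F T A B D ⊓ TB F T A B D : Submodule F _) = LinearMap.range (LinearMap.inl F (T × (A × B)) D ∘ₗ LinearMap.inl F T (A × B)) := by
    ext p
    rw [Submodule.mem_inf, mem_TA, mem_TB]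
    constructor
    · rintro ⟨⟨h1, h2⟩, h3, _⟩
      exact ⟨p.1.1, by ext <;> simp [h1, h2, h3]⟩
    · rintro ⟨w, rfl⟩
      simp
  rw [this, LinearMap.finrank_range_of_inj]
  intro t t' h
  simpa using h

lemma exists_adapted (U U' : Submodule F V) (hT : Module.finrank F T = Module.finrank F (U ⊓ U' : Submodule F V))
    (hA : Module.finrank F T + Module.finrank F A = Module.finrank F U)
    (hB : Module.finrank F T + Module.finrank F B = Module.finrank F U')
    (hD : Module.finrank F T + (Module.finrank F A + Module.finrank F B) + Module.finrank F D = Module.finrank F V) :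
    ∃ y : ((T × (A × B)) × D) ≃ₗ[F] V, (TA F T A B D).map (y : _ →ₗ[F] V) = U ∧ (TB F T A B D).map (y : _ →ₗ[F] V) = U' := by
  obtain ⟨C, hC⟩ := exists_isCompl (U ⊓ U')
  obtain ⟨D0, hD0⟩ := exists_isCompl (U ⊔ U')
  have e1 : (U ⊓ U') ⊔ (C ⊓ U) = U := by
    rw [← sup_inf_assoc_of_le C (inf_le_left : U ⊓ U' ≤ U), hC.sup_eq_top, top_inf_eq]
  have e2 : (U ⊓ U') ⊔ (C ⊓ U') = U' := by
    rw [← sup_inf_assoc_of_le C (inf_le_right : U ⊓ U' ≤ U'), hC.sup_eq_top, top_inf_eq]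
  have f0 : ∀ K : Submodule F V, (U ⊓ U') ⊓ (C ⊓ K) = ⊥ := by
    intro K
    rw [← inf_assoc, hC.inf_eq_bot, bot_inf_eq]
  have f1 := Submodule.finrank_sup_add_finrank_inf_eq (U ⊓ U') (C ⊓ U)
  have f2 := Submodule.finrank_sup_add_finrank_inf_eq (U ⊓ U') (C ⊓ U')
  have f3 := Submodule.finrank_sup_add_finrank_inf_eq (U ⊔ U') D0
  have f4 := Submodule.finrank_sup_add_finrank_inf_eq U U'
  rw [f0, e1, finrank_bot] at f1
  rw [f0, e2, finrank_bot] at f2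
  rw [hD0.sup_eq_top, hD0.inf_eq_bot, finrank_bot, finrank_top] at f3
  let iT : T ≃ₗ[F] (U ⊓ U' : Submodule F V) := LinearEquiv.ofFinrankEq _ _ hT
  let iA : A ≃ₗ[F] (C ⊓ U : Submodule F V) := LinearEquiv.ofFinrankEq _ _ (by omega)
  let iB : B ≃ₗ[F] (C ⊓ U' : Submodule F V) := LinearEquiv.ofFinrankEq _ _ (by omega)
  let iD : D ≃ₗ[F] D0 := LinearEquiv.ofFinrankEq _ _ (by omega)
  let kT : T →ₗ[F] V := (U ⊓ U').subtype ∘ₗ iT.toLinearMap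
  let kA : A →ₗ[F] V := (C ⊓ U).subtype ∘ₗ iA.toLinearMap
  let kB : B →ₗ[F] V := (C ⊓ U').subtype ∘ₗ iB.toLinearMap
  let kD : D →ₗ[F] V := D0.subtype ∘ₗ iD.toLinearMap
  have rT : LinearMap.range kT = U ⊓ U' := by
    simp only [kT]; rw [LinearMap.range_comp_of_range_eq_top _ (LinearEquiv.range iT), Submodule.range_subtype]
  have rA : LinearMap.range kA = C ⊓ U := by
    simp only [kA]; rw [LinearMap.range_comp_of_range_eq_top _ (LinearEquiv.range iA), Submodule.range_subtype]
  have rB : LinearMap.range kB = C ⊓ U' := by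
    simp only [kB]; rw [LinearMap.range_comp_of_range_eq_top _ (LinearEquiv.range iB), Submodule.range_subtype]
  have rD : LinearMap.range kD = D0 := by
    simp only [kD]; rw [LinearMap.range_comp_of_range_eq_top _ (LinearEquiv.range iD), Submodule.range_subtype]
  let y0 : ((T × (A × B)) × D) →ₗ[F] V := LinearMap.coprod (LinearMap.coprod kT (LinearMap.coprod kA kB)) kD
  have hs : Function.Surjective y0 := by
    rw [← LinearMap.range_eq_top]
    simp only [y0]
    rw [LinearMap.range_coprod, LinearMap.range_coprod, LinearMap.range_coprod, rT, rA, rB, rD]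
    have : (U ⊓ U') ⊔ (C ⊓ U ⊔ C ⊓ U') = U ⊔ U' := by
      rw [sup_sup_distrib_left, e1, e2]
    rw [this, hD0.sup_eq_top]
  have hfr : Module.finrank F ((T × (A × B)) × D) = Module.finrank F V := by
    rw [Module.finrank_prod, Module.finrank_prod, Module.finrank_prod, hD]
  have hi : Function.Injective y0 := (LinearMap.injective_iff_surjective_of_finrank_eq_finrank hfr).mpr hs
  refine ⟨LinearEquiv.ofBijective y0 ⟨hi, hs⟩, ?_, ?_⟩
  · rw [TA, ← LinearMap.range_comp]
    have : ((LinearEquiv.ofBijective y0 ⟨hi, hs⟩ : _ ≃ₗ[F] V) : _ →ₗ[F] V) ∘ₗ jA F T A B D = LinearMap.coprod kT kA := by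
      refine LinearMap.ext fun p => ?_
      change y0 (jA F T A B D p) = _
      simp [y0, jA_apply]
    rw [this, LinearMap.range_coprod, rT, rA, e1]
  · rw [TB, ← LinearMap.range_comp]
    have : ((LinearEquiv.ofBijective y0 ⟨hi, hs⟩ : _ ≃ₗ[F] V) : _ →ₗ[F] V) ∘ₗ jB F T A B D = LinearMap.coprod kT kB := by
      refine LinearMap.ext fun p => ?_
      change y0 (jB F T A B D p) = _
      simp [y0, jB_apply]
    rw [this, LinearMap.range_coprod, rT, rB, e2]

lemma adapted_finrank (U U' : Submodule F V) (y : ((T × (A × B)) × D) ≃ₗ[F] V)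
    (h : (TA F T A B D).map (y : _ →ₗ[F] V) = U ∧ (TB F T A B D).map (y : _ →ₗ[F] V) = U') :
    Module.finrank F (U ⊓ U' : Submodule F V) = Module.finrank F T := by
  rw [← h.1, ← h.2, ← Submodule.map_inf _ y.injective, LinearEquiv.finrank_map_eq, finrank_TAB]

end adapted

lemma exists_single (A : Submodule F M) (U : Submodule F V) (h : Module.finrank F A = Module.finrank F U)
    (hM : Module.finrank F M = Module.finrank F V) : ∃ y : M ≃ₗ[F] V, A.map (y : M →ₗ[F] V) = U := by
  obtain ⟨C, hC⟩ := exists_isCompl A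
  obtain ⟨D, hD⟩ := exists_isCompl U
  have f1 := Submodule.finrank_add_eq_of_isCompl hC
  have f2 := Submodule.finrank_add_eq_of_isCompl hD
  let i : A ≃ₗ[F] U := LinearEquiv.ofFinrankEq _ _ h
  let j : C ≃ₗ[F] D := LinearEquiv.ofFinrankEq _ _ (by omega)
  refine ⟨(Submodule.prodEquivOfIsCompl A C hC).symm.trans ((i.prodCongr j).trans (Submodule.prodEquivOfIsCompl U D hD)), ?_⟩
  apply Submodule.eq_of_le_of_finrank_eq
  · rintro _ ⟨x, hx, rfl⟩
    have : (Submodule.prodEquivOfIsCompl A C hC).symm x = (⟨x, hx⟩, 0) :=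
      Submodule.prodEquivOfIsCompl_symm_apply_left A C hC ⟨x, hx⟩
    simp [this]
  · rw [LinearEquiv.finrank_map_eq, h]

end geom3
end OEB

namespace OEB

section geom4
variable {F : Type} [Field F] [Fintype F]
variable {V V' W Y : Type} [AddCommGroup V] [Module F V] [AddCommGroup V'] [Module F V']
  [AddCommGroup W] [Module F W] [AddCommGroup Y] [Module F Y]
  [Finite V] [Finite V'] [Finite W] [Finite Y]
variable {T A B D : Type} [AddCommGroup T] [Module F T] [AddCommGroup A] [Module F A]
  [AddCommGroup B] [Module F B] [AddCommGroup D] [Module F D] [Finite T] [Finite A] [Finite B] [Finite D]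
set_option linter.all false

lemma sum_prodMap (φ : Module.End F (A × B) → ℂ) (hφ : ∀ g, ¬ ((∀ a, (g (a, 0)).2 = 0) ∧ (∀ b, (g (0, b)).1 = 0)) → φ g = 0) :
    ∑ g, φ g = ∑ a : Module.End F A, ∑ b : Module.End F B, φ (LinearMap.prodMap a b) := by
  rw [← Fintype.sum_prod_type']
  symm
  apply Finset.sum_of_injOn (fun p : Module.End F A × Module.End F B => (LinearMap.prodMap p.1 p.2 : Module.End F (A × B)))
  · rintro ⟨a, b⟩ _ ⟨a', b'⟩ _ h
    have h1 : ∀ p, LinearMap.prodMap a b p = LinearMap.prodMap a' b' p := fun p => LinearMap.congr_fun h p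
    ext x
    · simpa using congrArg Prod.fst (h1 (x, 0))
    · simpa using congrArg Prod.snd (h1 (0, x))
  · simp
  · intro g _ hg
    apply hφ
    rintro ⟨h1, h2⟩
    apply hg
    refine ⟨(LinearMap.fst F A B ∘ₗ g ∘ₗ LinearMap.inl F A B, LinearMap.snd F A B ∘ₗ g ∘ₗ LinearMap.inr F A B), by simp, ?_⟩
    refine LinearMap.ext fun p => ?_
    have h3 : g p = g (p.1, 0) + g (0, p.2) := by rw [← map_add]; simp
    rw [h3]
    ext
    · simp [h2]
    · simp [h1]
  · simp

/-- block endomorphism preserving both subspaces -/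
def blk4 (x : Module.End F T) (CA : A →ₗ[F] T) (CB : B →ₗ[F] T) (EA : Module.End F A) (EB : Module.End F B)
    (CD : D →ₗ[F] (T × (A × B))) (ED : Module.End F D) : Module.End F ((T × (A × B)) × D) :=
  blk (blk x (LinearMap.coprod CA CB) (LinearMap.prodMap EA EB)) CD ED

lemma blk4_jA (x : Module.End F T) (CA : A →ₗ[F] T) (CB : B →ₗ[F] T) (EA : Module.End F A) (EB : Module.End F B)
    (CD : D →ₗ[F] (T × (A × B))) (ED : Module.End F D) (p : T × A) :
    blk4 x CA CB EA EB CD ED (jA F T A B D p) = jA F T A B D (blk x CA EA p) := by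
  simp [blk4, jA_apply]

lemma blk4_jB (x : Module.End F T) (CA : A →ₗ[F] T) (CB : B →ₗ[F] T) (EA : Module.End F A) (EB : Module.End F B)
    (CD : D →ₗ[F] (T × (A × B))) (ED : Module.End F D) (p : T × B) :
    blk4 x CA CB EA EB CD ED (jB F T A B D p) = jB F T A B D (blk x CB EB p) := by
  simp [blk4, jB_apply]

lemma det_blk4 (x : Module.End F T) (CA : A →ₗ[F] T) (CB : B →ₗ[F] T) (EA : Module.End F A) (EB : Module.End F B)
    (CD : D →ₗ[F] (T × (A × B))) (ED : Module.End F D) :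
    LinearMap.det (blk4 x CA CB EA EB CD ED) = LinearMap.det x * LinearMap.det EA * LinearMap.det EB * LinearMap.det ED := by
  rw [blk4, det_blk, det_blk, LinearMap.det_prodMap]; ring

lemma sum_blk4 (φ : Module.End F ((T × (A × B)) × D) → ℂ)
    (hφ : ∀ g, ¬ ((∀ x ∈ TA F T A B D, g x ∈ TA F T A B D) ∧ (∀ x ∈ TB F T A B D, g x ∈ TB F T A B D)) → φ g = 0) :
    ∑ g, φ g = ∑ CD, ∑ ED, ∑ x, ∑ CA, ∑ CB, ∑ EA, ∑ EB, φ (blk4 x CA CB EA EB CD ED) := by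
  rw [sum_blk, Finset.sum_comm]
  · refine Finset.sum_congr rfl fun CD _ => ?_
    rw [Finset.sum_comm]
    refine Finset.sum_congr rfl fun ED _ => ?_
    rw [sum_blk]
    · refine Finset.sum_congr rfl fun x _ => ?_
      rw [← (LinearMap.coprodEquiv F (M := A) (M₂ := B) (M₃ := T)).toEquiv.sum_comp, Fintype.sum_prod_type]
      refine Finset.sum_congr rfl fun CA _ => Finset.sum_congr rfl fun CB _ => ?_
      rw [sum_prodMap]
      · rfl
      · intro e he
        apply hφ
        rintro ⟨hA, hB⟩
        apply he
        constructor
        · intro a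
          have := (mem_TA _).mp (hA ((0, (a, 0)), 0) ((mem_TA _).mpr ⟨rfl, rfl⟩))
          simpa using this
        · intro a
          have := (mem_TB _).mp (hB ((0, (0, a)), 0) ((mem_TB _).mpr ⟨rfl, rfl⟩))
          simpa using this
    · intro u hu
      apply hφ
      rintro ⟨hA, hB⟩
      apply hu
      intro x hx
      rw [mem_W0] at hx ⊢
      have h1 := (mem_TA _).mp (hA (x, 0) ((mem_TA _).mpr (by simp [hx])))
      have h2 := (mem_TB _).mp (hB (x, 0) ((mem_TB _).mpr (by simp [hx])))
      ext
      · simpa using h2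
      · simpa using h1
  · intro g hg
    apply hφ
    rintro ⟨hA, hB⟩
    apply hg
    intro x hx
    rw [mem_W0] at hx ⊢
    have e : x = ((x.1.1, (x.1.2.1, 0)), 0) + ((0, (0, x.1.2.2)), 0) := by
      ext <;> simp [hx]
    have h1 := (mem_TA _).mp (hA ((x.1.1, (x.1.2.1, 0)), 0) ((mem_TA _).mpr (by simp)))
    have h2 := (mem_TB _).mp (hB ((0, (0, x.1.2.2)), 0) ((mem_TB _).mpr (by simp)))
    rw [e, map_add, Prod.snd_add, h1.2, h2.2, add_zero]

variable (F) in
/-- order of the general linear group -/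
def gam (V : Type) [AddCommGroup V] [Module F V] [Finite V] : ℂ := ∑ g : Module.End F V, if IsUnit g then 1 else 0

variable (F) in
def hom (V W : Type) [AddCommGroup V] [Module F V] [AddCommGroup W] [Module F W] [Finite V] [Finite W] : ℂ :=
  (Fintype.card (V →ₗ[F] W) : ℂ)

lemma gam_ne : gam F V ≠ 0 := by
  unfold gam
  rw [Finset.sum_boole]
  have : (1 : Module.End F V) ∈ Finset.univ.filter (fun g : Module.End F V => IsUnit g) := by simp
  exact_mod_cast (Finset.card_pos.mpr ⟨_, this⟩).ne'

lemma hom_ne : hom F V W ≠ 0 := by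
  unfold hom
  exact_mod_cast Fintype.card_ne_zero

lemma sum_equiv_end (φ : Module.End F V → ℂ) : ∑ y : V ≃ₗ[F] V, φ (y : V →ₗ[F] V) = ∑ g, if IsUnit g then φ g else 0 := by
  apply Finset.sum_of_injOn (fun y : V ≃ₗ[F] V => (y : V →ₗ[F] V))
  · intro y _ y' _ h
    exact LinearEquiv.toLinearMap_injective h
  · simp
  · intro g _ hg
    rw [if_neg]
    intro hu
    apply hg
    exact ⟨LinearMap.GeneralLinearGroup.generalLinearEquiv F V hu.unit, by simp, rfl⟩
  · intro y _
    rw [if_pos]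
    exact ⟨(LinearMap.GeneralLinearGroup.generalLinearEquiv F V).symm y, rfl⟩

lemma card_equiv : (Fintype.card (V ≃ₗ[F] V) : ℂ) = gam F V := by
  rw [gam, ← sum_equiv_end (fun _ => 1)]; simp

lemma map_eq_iff_stab (U : Submodule F V) (y : V ≃ₗ[F] V) : U.map (y : V →ₗ[F] V) = U ↔ ∀ x ∈ U, (y : V →ₗ[F] V) x ∈ U := by
  constructor
  · intro h x hx
    rw [← h]
    exact ⟨x, hx, rfl⟩
  · intro h
    apply Submodule.eq_of_le_of_finrank_eq
    · rintro _ ⟨x, hx, rfl⟩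
      exact h x hx
    · rw [LinearEquiv.finrank_map_eq]

lemma cnt_self (U U' : Submodule F V) : cnt U U' U U' = ∑ g : Module.End F V,
    if IsUnit g ∧ (∀ x ∈ U, g x ∈ U) ∧ (∀ x ∈ U', g x ∈ U') then 1 else 0 := by
  unfold cnt
  simp only [map_eq_iff_stab]
  rw [sum_equiv_end (fun g : Module.End F V => if (∀ x ∈ U, g x ∈ U) ∧ (∀ x ∈ U', g x ∈ U') then (1:ℂ) else 0)]
  refine Finset.sum_congr rfl fun g _ => ?_
  by_cases h : IsUnit g <;> simp [h]

lemma cnt_W0 : cnt (W0 F W Y) (W0 F W Y) (W0 F W Y) (W0 F W Y) = gam F W * gam F Y * hom F Y W := by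
  rw [cnt_self, sum_blk]
  · have : ∀ (a : Module.End F W) (C : Y →ₗ[F] W) (E : Module.End F Y),
      (if IsUnit (blk a C E) ∧ (∀ x ∈ W0 F W Y, blk a C E x ∈ W0 F W Y) ∧ (∀ x ∈ W0 F W Y, blk a C E x ∈ W0 F W Y) then (1:ℂ) else 0)
        = (if IsUnit a then 1 else 0) * (if IsUnit E then 1 else 0) := by
      intro a C E
      have h := blk_stab a C E
      have hu := isUnit_blk a C E
      have e : (IsUnit (blk a C E) ∧ (∀ x ∈ W0 F W Y, blk a C E x ∈ W0 F W Y) ∧ (∀ x ∈ W0 F W Y, blk a C E x ∈ W0 F W Y)) ↔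
        (IsUnit a ∧ IsUnit E) := ⟨fun k => hu.mp k.1, fun k => ⟨hu.mpr k, h, h⟩⟩
      rw [if_congr e rfl rfl]
      by_cases h1 : IsUnit a <;> by_cases h2 : IsUnit E <;> simp [h1, h2]
    simp only [this, ← Finset.mul_sum, ← Finset.sum_mul, Finset.sum_const, Finset.card_univ, nsmul_eq_mul]
    rw [gam, gam, hom]; ring
  · intro g hg
    rw [if_neg]
    intro h
    exact hg h.2.1

lemma stab_TA (x : Module.End F T) (CA : A →ₗ[F] T) (CB : B →ₗ[F] T) (EA : Module.End F A) (EB : Module.End F B)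
    (CD : D →ₗ[F] (T × (A × B))) (ED : Module.End F D) :
    (∀ p ∈ TA F T A B D, blk4 x CA CB EA EB CD ED p ∈ TA F T A B D) ∧ (∀ p ∈ TB F T A B D, blk4 x CA CB EA EB CD ED p ∈ TB F T A B D) := by
  constructor
  · rintro _ ⟨p, rfl⟩
    rw [blk4_jA]; exact ⟨_, rfl⟩
  · rintro _ ⟨p, rfl⟩
    rw [blk4_jB]; exact ⟨_, rfl⟩

lemma cnt_TAB : cnt (TA F T A B D) (TB F T A B D) (TA F T A B D) (TB F T A B D) =
    gam F T * gam F A * gam F B * gam F D * hom F A T * hom F B T * hom F D (T × (A × B)) := by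
  rw [cnt_self, sum_blk4]
  · have : ∀ (x : Module.End F T) (CA : A →ₗ[F] T) (CB : B →ₗ[F] T) (EA : Module.End F A) (EB : Module.End F B)
      (CD : D →ₗ[F] (T × (A × B))) (ED : Module.End F D),
      (if IsUnit (blk4 x CA CB EA EB CD ED) ∧ (∀ p ∈ TA F T A B D, blk4 x CA CB EA EB CD ED p ∈ TA F T A B D) ∧ (∀ p ∈ TB F T A B D, blk4 x CA CB EA EB CD ED p ∈ TB F T A B D) then (1:ℂ) else 0)
        = (if IsUnit x then 1 else 0) * ((if IsUnit EA then 1 else 0) * ((if IsUnit EB then 1 else 0) * (if IsUnit ED then 1 else 0))) := by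
      intro x CA CB EA EB CD ED
      have h := stab_TA x CA CB EA EB CD ED
      have e : (IsUnit (blk4 x CA CB EA EB CD ED) ∧ (∀ p ∈ TA F T A B D, blk4 x CA CB EA EB CD ED p ∈ TA F T A B D) ∧ (∀ p ∈ TB F T A B D, blk4 x CA CB EA EB CD ED p ∈ TB F T A B D))
        ↔ (LinearMap.det x * LinearMap.det EA * LinearMap.det EB * LinearMap.det ED ≠ 0) := by
        rw [← det_blk4 x CA CB EA EB CD ED, ← isUnit_det]
        exact ⟨fun k => k.1, fun k => ⟨k, h⟩⟩
      rw [if_congr e rfl rfl]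
      simp only [isUnit_det, mul_ne_zero_iff]
      by_cases h1 : LinearMap.det x = 0 <;> by_cases h2 : LinearMap.det EA = 0 <;> by_cases h3 : LinearMap.det EB = 0 <;>
        by_cases h4 : LinearMap.det ED = 0 <;> simp [h1, h2, h3, h4]
    simp only [this]
    simp only [← Finset.mul_sum, ← Finset.sum_mul, Finset.sum_const, Finset.card_univ, nsmul_eq_mul]
    rw [gam, gam, gam, gam, hom, hom, hom]; ring
  · intro g hg
    rw [if_neg]
    intro h
    exact hg h.2

/-- partial sums over the parabolic -/
def UU {n : ℕ} (l : MulChar F ℂ) (χ : GL (Fin n) F → ℂ) (Y : Type) [AddCommGroup Y] [Module F Y] [Finite Y]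
    (x : Module.End F W) : ℂ := ∑ C : Y →ₗ[F] W, ∑ E : Module.End F Y, l (LinearMap.det E) * XV χ (W × Y) (blk x C E)

lemma Ph_TAB {n n' : ℕ} (μ l l' : MulChar F ℂ) {χ : GL (Fin n) F → ℂ} {χ' : GL (Fin n') F → ℂ} (h : IsClass χ) (h' : IsClass χ') :
    Ph μ l l' χ χ' (TA F T A B D) (TB F T A B D) = hom F D (T × (A × B)) * (∑ E : Module.End F D, μ (LinearMap.det E)) *
      ∑ x : Module.End F T, (μ * l * l') (LinearMap.det x) * UU (μ * l) χ A x * UU (μ * l') χ' B x := by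
  rw [Ph, sum_blk4]
  · have : ∀ (x : Module.End F T) (CA : A →ₗ[F] T) (CB : B →ₗ[F] T) (EA : Module.End F A) (EB : Module.End F B)
      (CD : D →ₗ[F] (T × (A × B))) (ED : Module.End F D),
      μ (LinearMap.det (blk4 x CA CB EA EB CD ED)) * RR χ l (TA F T A B D) (blk4 x CA CB EA EB CD ED) * RR χ' l' (TB F T A B D) (blk4 x CA CB EA EB CD ED)
        = μ (LinearMap.det ED) * ((μ * l * l') (LinearMap.det x) * (((μ * l) (LinearMap.det EA) * XV χ (T × A) (blk x CA EA)) *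
           ((μ * l') (LinearMap.det EB) * XV χ' (T × B) (blk x CB EB)))) := by
      intro x CA CB EA EB CD ED
      rw [TA, RR_eq h l _ jA_inj _ _ (blk4_jA x CA CB EA EB CD ED), TB, RR_eq h' l' _ jB_inj _ _ (blk4_jB x CA CB EA EB CD ED),
        det_blk4, fX, fX, det_blk, det_blk]
      simp only [MulChar.mul_apply, map_mul]
      ring
    simp only [this]
    have h2 : ∀ x : Module.End F T, ∑ CA : A →ₗ[F] T, ∑ CB : B →ₗ[F] T, ∑ EA : Module.End F A, ∑ EB : Module.End F B,
      (((μ * l) (LinearMap.det EA) * XV χ (T × A) (blk x CA EA)) *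
           ((μ * l') (LinearMap.det EB) * XV χ' (T × B) (blk x CB EB))) = UU (μ * l) χ A x * UU (μ * l') χ' B x := by
      intro x
      rw [UU, UU, Finset.sum_mul_sum]
      refine Finset.sum_congr rfl fun CA _ => Finset.sum_congr rfl fun CB _ => ?_
      rw [Finset.sum_mul_sum]
    simp only [← Finset.mul_sum, h2, ← Finset.sum_mul, Finset.sum_const, Finset.card_univ, nsmul_eq_mul]
    simp only [UU, hom, mul_assoc]
    rw [mul_left_comm]
  · intro g hg
    by_cases hA : ∀ x ∈ TA F T A B D, g x ∈ TA F T A B D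
    · have hB : ¬ ∀ x ∈ TB F T A B D, g x ∈ TB F T A B D := fun hB => hg ⟨hA, hB⟩
      rw [RR, RR, dif_neg hB, mul_zero]
    · rw [RR, dif_neg hA, mul_zero, zero_mul]

end geom4
end OEB

namespace OEB

section geom5
variable {F : Type} [Field F] [Fintype F]
variable {V V' W Y : Type} [AddCommGroup V] [Module F V] [AddCommGroup V'] [Module F V']
  [AddCommGroup W] [Module F W] [AddCommGroup Y] [Module F Y]
  [Finite V] [Finite V'] [Finite W] [Finite Y]
set_option linter.all false

def toGL {n : ℕ} (e : V ≃ₗ[F] (Fin n → F)) : (V ≃ₗ[F] V) →* GL (Fin n) F where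
  toFun y := Matrix.GeneralLinearGroup.toLin.symm ((LinearMap.GeneralLinearGroup.generalLinearEquiv F (Fin n → F)).symm (e.symm.trans (y.trans e)))
  map_one' := by
    rw [MulEquiv.symm_apply_eq, MulEquiv.symm_apply_eq, map_one, map_one]
    refine LinearEquiv.ext fun x => ?_
    simp
  map_mul' a b := by
    rw [← map_mul, ← map_mul]
    congr 2
    refine LinearEquiv.ext fun x => ?_
    simp

lemma lin_toGL {n : ℕ} (e : V ≃ₗ[F] (Fin n → F)) (y : V ≃ₗ[F] V) : lin e (toGL e y) = (y : V →ₗ[F] V) := by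
  ext x
  simp [lin, toGL, LinearEquiv.conj_apply]
  change e.symm (e (y (e.symm (e x)))) = y x
  simp

lemma XV_toGL {n : ℕ} (e : V ≃ₗ[F] (Fin n → F)) {χ : GL (Fin n) F → ℂ} (h : IsClass χ) (y : V ≃ₗ[F] V) :
    XV χ V (y : V →ₗ[F] V) = χ (toGL e y) := by
  rw [← lin_toGL e y, XV_lin h]

variable (F W Y) in
/-- parabolic subgroup together with its projection -/
def PP : Subgroup ((W ≃ₗ[F] W) × ((W × Y) ≃ₗ[F] (W × Y))) where
  carrier := {p | ∀ w, p.2 (w, 0) = (p.1 w, 0)}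
  one_mem' := by intro w; rfl
  mul_mem' := by
    intro a b ha hb w
    change a.2 (b.2 (w, 0)) = (a.1 (b.1 w), 0)
    rw [hb, ha]
  inv_mem' := by
    intro a ha w
    change a.2.symm (w, 0) = (a.1.symm w, 0)
    rw [LinearEquiv.symm_apply_eq, ha]
    simp

instance fintPP : Fintype (PP F W Y) := Fintype.ofFinite _

lemma sum_PP (φ : Module.End F (W × Y) → ℂ) (hφ : ∀ g, ¬ (IsUnit g ∧ ∀ x ∈ W0 F W Y, g x ∈ W0 F W Y) → φ g = 0) :
    ∑ p : PP F W Y, φ (p.1.2 : (W × Y) →ₗ[F] (W × Y)) = ∑ g, φ g := by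
  apply Finset.sum_of_injOn (fun p : PP F W Y => (p.1.2 : (W × Y) →ₗ[F] (W × Y)))
  · rintro ⟨⟨a, g⟩, h⟩ _ ⟨⟨a', g'⟩, h'⟩ _ hh
    have h1 : g = g' := LinearEquiv.toLinearMap_injective hh
    subst h1
    have h2 : a = a' := by
      ext w
      have e1 := h w
      have e2 := h' w
      rw [e1] at e2
      exact congrArg Prod.fst e2
    subst h2
    rfl
  · simp
  · intro g _ hg
    apply hφ
    rintro ⟨hu, hs⟩
    apply hg
    obtain ⟨a, C, E, rfl⟩ := exists_blk g hs
    have hua := ((isUnit_blk a C E).mp hu).1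
    refine ⟨⟨(LinearMap.GeneralLinearGroup.generalLinearEquiv F W hua.unit, LinearMap.GeneralLinearGroup.generalLinearEquiv F _ hu.unit), ?_⟩, by simp, rfl⟩
    intro w
    change blk a C E (w, 0) = (a w, 0)
    simp
  · simp

lemma isUnit_equiv (y : V ≃ₗ[F] V) : IsUnit (y : Module.End F V) :=
  ⟨(LinearMap.GeneralLinearGroup.generalLinearEquiv F V).symm y, rfl⟩

lemma card_PP : (Nat.card (PP F W Y) : ℂ) = gam F W * gam F Y * hom F Y W := by
  rw [← cnt_W0, cnt_self, ← sum_PP]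
  · rw [Nat.card_eq_fintype_card, Fintype.card, Finset.card_eq_sum_ones]
    push_cast
    refine Finset.sum_congr rfl fun p _ => ?_
    rw [if_pos]
    have : ∀ x ∈ W0 F W Y, (p.1.2 : (W × Y) →ₗ[F] (W × Y)) x ∈ W0 F W Y := by
      intro x hx
      rw [mem_W0] at hx
      have : x = (x.1, 0) := by ext <;> simp [hx]
      rw [this, LinearEquiv.coe_coe, p.2, mem_W0]
    exact ⟨isUnit_equiv _, this, this⟩
  · intro g hg
    rw [if_neg]
    exact fun h => hg ⟨h.1, h.2.1⟩

/-- twisted representation of the parabolic -/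
def twist {n : ℕ} (e : W ≃ₗ[F] (Fin n → F)) (l : MulChar F ℂ) {X : Type} [AddCommGroup X] [Module ℂ X] (ρ : Representation ℂ (GL (Fin n) F) X) :
    Representation ℂ (PP F W Y) X where
  toFun p := (l (LinearMap.det (p.1.2 : (W × Y) →ₗ[F] (W × Y))) * l⁻¹ (LinearMap.det (p.1.1 : W →ₗ[F] W))) • ρ (toGL e p.1.1)
  map_one' := by
    have h1 : (((1 : PP F W Y).1.2 : (W × Y) ≃ₗ[F] (W × Y)) : (W × Y) →ₗ[F] (W × Y)) = LinearMap.id := rfl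
    have h2 : (((1 : PP F W Y).1.1 : W ≃ₗ[F] W) : W →ₗ[F] W) = LinearMap.id := rfl
    rw [h1, h2, LinearMap.det_id, LinearMap.det_id, map_one, map_one]
    simp
  map_mul' a b := by
    have h1 : (((a * b : PP F W Y).1.2 : (W × Y) ≃ₗ[F] (W × Y)) : (W × Y) →ₗ[F] (W × Y)) = a.1.2.toLinearMap ∘ₗ b.1.2.toLinearMap := rfl
    have h2 : (((a * b : PP F W Y).1.1 : W ≃ₗ[F] W) : W →ₗ[F] W) = a.1.1.toLinearMap ∘ₗ b.1.1.toLinearMap := rfl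
    have h3 : (a * b : PP F W Y).1.1 = a.1.1 * b.1.1 := rfl
    rw [h1, h2, h3, LinearMap.det_comp, LinearMap.det_comp, map_mul, map_mul, map_mul, map_mul, smul_mul_smul_comm]
    congr 1
    ring

lemma twist_char {n : ℕ} (e : W ≃ₗ[F] (Fin n → F)) (l : MulChar F ℂ) {X : Type} [AddCommGroup X] [Module ℂ X] (ρ : Representation ℂ (GL (Fin n) F) X)
    (p : PP F W Y) : (twist e l ρ).character p = (l (LinearMap.det (p.1.2 : (W × Y) →ₗ[F] (W × Y))) * l⁻¹ (LinearMap.det (p.1.1 : W →ₗ[F] W))) * ρ.character (toGL e p.1.1) := by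
  have : twist e l ρ p = (l (LinearMap.det (p.1.2 : (W × Y) →ₗ[F] (W × Y))) * l⁻¹ (LinearMap.det (p.1.1 : W →ₗ[F] W))) • ρ (toGL e p.1.1) := rfl
  rw [Representation.character, this, map_smul]; rfl

lemma RR_PP {n : ℕ} {χ : GL (Fin n) F → ℂ} (h : IsClass χ) (l : MulChar F ℂ) (p : PP F W Y) :
    RR χ l (W0 F W Y) (p.1.2 : (W × Y) →ₗ[F] (W × Y)) = l (LinearMap.det (p.1.1 : W →ₗ[F] W)) * XV χ W (p.1.1 : W →ₗ[F] W) := by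
  rw [W0, RR_eq h l _ LinearMap.inl_injective _ (p.1.1 : W →ₗ[F] W), fX]
  intro x
  exact p.2 x

lemma mult_nat {n N : ℕ} (e : W ≃ₗ[F] (Fin n → F)) (e' : (W × Y) ≃ₗ[F] (Fin N → F)) (l : MulChar F ℂ) {χ : GL (Fin n) F → ℂ} {χ' : GL (Fin N) F → ℂ}
    (h : χ ∈ Irr (GL (Fin n) F)) (h' : χ' ∈ Irr (GL (Fin N) F)) :
    ∃ k : ℕ, (gam F W * gam F Y * hom F Y W)⁻¹ * ∑ g, l⁻¹ (LinearMap.det g) * RR (starf χ) l (W0 F W Y) g * XV χ' (W × Y) g = k ∧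
      (gam F W * gam F Y * hom F Y W)⁻¹ * ∑ g, l (LinearMap.det g) * RR χ l⁻¹ (W0 F W Y) g * XV (starf χ') (W × Y) g = k := by
  have hc : IsClass χ := irr_class h
  have hc' : IsClass χ' := irr_class h'
  obtain ⟨X, hX, rfl⟩ := h
  obtain ⟨X', hX', rfl⟩ := h'
  have key := Representation.card_inv_mul_sum_char_mul_char_eq_finrank (twist (Y := Y) e l X.ρ) (X'.ρ.comp ((toGL e').comp ((MonoidHom.snd _ _).comp (PP F W Y).subtype)))
  refine ⟨Module.finrank ℂ ((twist (Y := Y) e l X.ρ).IntertwiningMap (X'.ρ.comp ((toGL e').comp ((MonoidHom.snd _ _).comp (PP F W Y).subtype)))), ?_, ?_⟩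
  · rw [← key, ← card_PP, ← sum_PP]
    · congr 1
      refine Finset.sum_congr rfl fun p _ => ?_
      rw [twist_char, RR_PP hc.star, XV_toGL e hc.star, XV_toGL e' hc', mul_comm]
      have h1 : ((p⁻¹).1.1 : W ≃ₗ[F] W) = (p.1.1)⁻¹ := rfl
      have h2 : ((p⁻¹).1.2 : (W × Y) ≃ₗ[F] (W × Y)) = (p.1.2)⁻¹ := rfl
      have h3 : LinearMap.det (((p.1.1)⁻¹ : W ≃ₗ[F] W) : W →ₗ[F] W) = (LinearMap.det (p.1.1 : W →ₗ[F] W))⁻¹ := eq_inv_of_mul_eq_one_left (LinearEquiv.det_symm_mul_det _)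
      have h4 : LinearMap.det (((p.1.2)⁻¹ : (W × Y) ≃ₗ[F] (W × Y)) : (W × Y) →ₗ[F] (W × Y)) = (LinearMap.det (p.1.2 : (W × Y) →ₗ[F] (W × Y)))⁻¹ := eq_inv_of_mul_eq_one_left (LinearEquiv.det_symm_mul_det _)
      rw [h1, h2, h3, h4, MulChar.inv_apply', MulChar.inv_apply', inv_inv, map_inv, starf]
      change _ = X'.character (toGL e' p.1.2) * (_ * X.character _)
      ring
    · intro g hg
      by_cases hu : IsUnit g
      · rw [RR, dif_neg (fun h => hg ⟨hu, h⟩)]; simp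
      · rw [XV_nonunit _ _ hu, mul_zero]
  · rw [← key, ← card_PP, ← sum_PP]
    · congr 1
      refine Fintype.sum_equiv (Equiv.inv (PP F W Y)) _ _ fun p => ?_
      rw [Equiv.inv_apply, inv_inv, RR_PP hc, XV_toGL e hc, XV_toGL e' hc'.star, twist_char, starf, ← map_inv]
      change _ = X'.character (toGL e' (p.1.2)⁻¹) * (_ * X.character _)
      ring
    · intro g hg
      by_cases hu : IsUnit g
      · rw [RR, dif_neg (fun h => hg ⟨hu, h⟩)]; simp
      · rw [XV_nonunit _ _ hu, mul_zero]

end geom5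
end OEB

namespace OEB

section geom6
variable {F : Type} [Field F] [Fintype F]
variable {V V' W Y W' Y' T A B D : Type} [AddCommGroup V] [Module F V] [AddCommGroup V'] [Module F V']
  [AddCommGroup W] [Module F W] [AddCommGroup Y] [Module F Y]
  [AddCommGroup W'] [Module F W'] [AddCommGroup Y'] [Module F Y']
  [AddCommGroup T] [Module F T] [AddCommGroup A] [Module F A] [AddCommGroup B] [Module F B] [AddCommGroup D] [Module F D]
  [Finite V] [Finite V'] [Finite W] [Finite Y] [Finite W'] [Finite Y'] [Finite T] [Finite A] [Finite B] [Finite D]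
set_option linter.all false

lemma mulchar_det_nonunit (l : MulChar F ℂ) (g : Module.End F V) (hg : ¬ IsUnit g) : l (LinearMap.det g) = 0 := by
  rw [isUnit_det, not_not] at hg
  rw [hg]; exact l.map_zero

lemma UU_nonunit {n : ℕ} (l : MulChar F ℂ) (χ : GL (Fin n) F → ℂ) (x : Module.End F W) (hx : ¬ IsUnit x) : UU l χ Y x = 0 := by
  unfold UU
  refine Finset.sum_eq_zero fun C _ => Finset.sum_eq_zero fun E _ => ?_
  rw [XV_nonunit, mul_zero]
  intro h
  exact hx ((isUnit_blk x C E).mp h).1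

lemma sum_RR_UU {n N : ℕ} (l : MulChar F ℂ) {χ : GL (Fin n) F → ℂ} (h : IsClass χ) (χ' : GL (Fin N) F → ℂ) :
    ∑ g, l (LinearMap.det g) * RR χ l⁻¹ (W0 F W Y) g * XV χ' (W × Y) g = ∑ x : Module.End F W, XV χ W x * UU l χ' Y x := by
  rw [sum_blk]
  · refine Finset.sum_congr rfl fun x _ => ?_
    unfold UU
    rw [Finset.mul_sum]
    refine Finset.sum_congr rfl fun C _ => ?_
    rw [Finset.mul_sum]
    refine Finset.sum_congr rfl fun E _ => ?_
    rw [RR_blk h, fX, det_blk, map_mul]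
    by_cases hx : IsUnit x
    · have h1 : l (LinearMap.det x) * l⁻¹ (LinearMap.det x) = 1 := by
        rw [← MulChar.mul_apply, mul_inv_cancel, MulChar.one_apply]
        rw [isUnit_det] at hx
        exact isUnit_iff_ne_zero.mpr hx
      linear_combination (l (LinearMap.det E) * XV χ W x * XV χ' (W × Y) (blk x C E)) * h1
    · rw [XV_nonunit χ x hx]; ring
  · intro g hg
    rw [RR, dif_neg hg]; ring

lemma UU_conj {n : ℕ} (l : MulChar F ℂ) {χ : GL (Fin n) F → ℂ} (h : IsClass χ) (x : Module.End F W) (z : W ≃ₗ[F] W') :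
    UU l χ Y (z.conj x) = UU l χ Y x := by
  unfold UU
  refine (Fintype.sum_equiv (LinearEquiv.congrRight z).toEquiv _ _ fun C => ?_).symm
  refine Finset.sum_congr rfl fun E _ => ?_
  rw [← XV_conj h (blk x C E) (z.prodCongr (LinearEquiv.refl F Y))]
  congr 2
  refine LinearMap.ext fun p => ?_
  ext <;> simp [LinearEquiv.conj_apply]
  rfl

lemma sum_mulchar_det (μ : MulChar F ℂ) : ∑ E : Module.End F D, μ (LinearMap.det E) = if μ = 1 ∨ Module.finrank F D = 0 then gam F D else 0 := by
  by_cases h1 : μ = 1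
  · rw [if_pos (Or.inl h1), h1, gam]
    refine Finset.sum_congr rfl fun E _ => ?_
    by_cases hE : IsUnit E
    · rw [if_pos hE, MulChar.one_apply]
      rw [isUnit_det] at hE
      exact isUnit_iff_ne_zero.mpr hE
    · rw [if_neg hE, mulchar_det_nonunit _ _ hE]
  by_cases h2 : Module.finrank F D = 0
  · rw [if_pos (Or.inr h2), gam]
    refine Finset.sum_congr rfl fun E _ => ?_
    have := Module.finrank_zero_iff.mp h2
    rw [LinearMap.det_eq_one_of_subsingleton, map_one, if_pos]
    rw [isUnit_det, LinearMap.det_eq_one_of_subsingleton]; simp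
  · rw [if_neg (by tauto)]
    obtain ⟨a, ha⟩ := (MulChar.ne_one_iff).mp h1
    have : ∃ g : D ≃ₗ[F] D, LinearMap.det (g : D →ₗ[F] D) = a := by
      have hN : Nontrivial D := by
        by_contra hn
        rw [not_nontrivial_iff_subsingleton] at hn
        exact h2 Module.finrank_zero_of_subsingleton
      let bb := Module.finBasis F D
      have i0 : Fin (Module.finrank F D) := ⟨0, Nat.pos_of_ne_zero h2⟩
      let M : Matrix (Fin (Module.finrank F D)) (Fin (Module.finrank F D)) F := Matrix.diagonal (fun i => if i = i0 then (a : F) else 1)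
      have hd : LinearMap.det (Matrix.toLin bb bb M) = a := by
        rw [LinearMap.det_toLin, Matrix.det_diagonal, Finset.prod_ite_eq' Finset.univ i0]; simp
      have hu : IsUnit (Matrix.toLin bb bb M : Module.End F D) := by
        rw [isUnit_det, hd]; exact a.ne_zero
      exact ⟨LinearMap.GeneralLinearGroup.generalLinearEquiv F D hu.unit, hd⟩
    obtain ⟨g, hg⟩ := this
    have h3 : ∑ E : Module.End F D, μ (LinearMap.det E) = μ a * ∑ E : Module.End F D, μ (LinearMap.det E) := by
      rw [Finset.mul_sum]
      refine (Fintype.sum_equiv (LinearEquiv.congrRight g).toEquiv _ _ fun E => ?_).symm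
      rw [← map_mul, ← hg, ← LinearMap.det_comp]
      rfl
    have h4 : (1 - μ a) * ∑ E : Module.End F D, μ (LinearMap.det E) = 0 := by linear_combination h3
    rcases mul_eq_zero.mp h4 with h5 | h5
    · exact absurd (sub_eq_zero.mp h5).symm ha
    · exact h5

lemma finrank_W0 : Module.finrank F (W0 F W Y) = Module.finrank F W := by
  rw [W0, LinearMap.finrank_range_of_inj LinearMap.inl_injective]

lemma mackey_i {n n' : ℕ} (μ l l' : MulChar F ℂ) {χ : GL (Fin n) F → ℂ} {χ' : GL (Fin n') F → ℂ} (h : IsClass χ) (h' : IsClass χ')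
    (hW : Module.finrank F T + Module.finrank F A = Module.finrank F W)
    (hW' : Module.finrank F T + Module.finrank F B = Module.finrank F W')
    (hY : Module.finrank F B + Module.finrank F D = Module.finrank F Y)
    (hY' : Module.finrank F A + Module.finrank F D = Module.finrank F Y') :
    ∑ z : (W × Y) ≃ₗ[F] (W' × Y'), (if Module.finrank F (W0 F W Y ⊓ (W0 F W' Y').map (z.symm : (W' × Y') →ₗ[F] (W × Y)) : Submodule F (W × Y)) = Module.finrank F T
      then Ph μ l l' χ χ' (W0 F W Y) ((W0 F W' Y').map (z.symm : (W' × Y') →ₗ[F] (W × Y))) else 0)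
     = (gam F W * gam F Y * hom F Y W) * (gam F W' * gam F Y' * hom F Y' W') * ((gam F T * gam F A * hom F A T)⁻¹ * (gam F B * hom F B T)⁻¹ *
       ((if μ = 1 ∨ Module.finrank F D = 0 then 1 else 0) * ∑ x : Module.End F T, (μ * l * l') (LinearMap.det x) * UU (μ * l) χ A x * UU (μ * l') χ' B x)) := by
  have o := orbit_main μ l l' h h' (TA F T A B D) (TB F T A B D) (W0 F W Y) (W0 F W' Y')
  rw [cnt_TAB, Ph_TAB μ l l' h h', sum_mulchar_det] at o
  have hc : ∀ z : (W × Y) ≃ₗ[F] (W' × Y'), (∃ y : ((T × (A × B)) × D) ≃ₗ[F] (W × Y), (TA F T A B D).map (y : _ →ₗ[F] (W × Y)) = W0 F W Y ∧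
      (TB F T A B D).map (y : _ →ₗ[F] (W × Y)) = (W0 F W' Y').map (z.symm : (W' × Y') →ₗ[F] (W × Y))) ↔
      Module.finrank F (W0 F W Y ⊓ (W0 F W' Y').map (z.symm : (W' × Y') →ₗ[F] (W × Y)) : Submodule F (W × Y)) = Module.finrank F T := by
    intro z
    constructor
    · rintro ⟨y, hy⟩
      exact adapted_finrank _ _ y hy
    · intro hz
      apply exists_adapted
      · exact hz.symm
      · rw [finrank_W0, hW]
      · rw [LinearEquiv.finrank_map_eq, finrank_W0, hW']
      · rw [Module.finrank_prod]; omega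
  have c1 : cnt (TA F T A B D) (TA F T A B D) (W0 F W Y) (W0 F W Y) = gam F W * gam F Y * hom F Y W := by
    obtain ⟨y, hy⟩ := exists_single (TA F T A B D) (W0 F W Y) (by rw [finrank_TA, finrank_W0, hW])
      (by simp only [Module.finrank_prod]; omega)
    rw [cnt_torsor' _ _ _ _ y ⟨hy, hy⟩, cnt_W0]
  have c2 : cnt (TB F T A B D) (TB F T A B D) (W0 F W' Y') (W0 F W' Y') = gam F W' * gam F Y' * hom F Y' W' := by
    obtain ⟨y, hy⟩ := exists_single (TB F T A B D) (W0 F W' Y') (by rw [finrank_TB, finrank_W0, hW'])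
      (by simp only [Module.finrank_prod]; omega)
    rw [cnt_torsor' _ _ _ _ y ⟨hy, hy⟩, cnt_W0]
  rw [c1, c2] at o
  simp only [hc] at o
  have g1 : gam F T ≠ 0 := gam_ne
  have g2 : gam F A ≠ 0 := gam_ne
  have g3 : gam F B ≠ 0 := gam_ne
  have g4 : gam F D ≠ 0 := gam_ne
  have g5 : hom F A T ≠ 0 := hom_ne
  have g6 : hom F B T ≠ 0 := hom_ne
  have g7 : hom F D (T × (A × B)) ≠ 0 := hom_ne
  have g8 : gam F T * gam F A * gam F B * gam F D * hom F A T * hom F B T * hom F D (T × (A × B)) ≠ 0 := by positivity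
  refine mul_left_cancel₀ g8 (o.trans ?_)
  split_ifs
  · field_simp
  · ring

end geom6
end OEB

namespace OEB

section geom7
variable {F : Type} [Field F] [Fintype F]
set_option linter.all false

variable (F) in
/-- order of parabolic -/
def KK (n r : ℕ) : ℂ := gam F (Fin n → F) * gam F (Fin r → F) * hom F (Fin r → F) (Fin n → F)

lemma KK_ne (n r : ℕ) : KK F n r ≠ 0 := mul_ne_zero (mul_ne_zero gam_ne gam_ne) hom_ne

/-- the raw pairing sum -/
def SS {n N : ℕ} (l : MulChar F ℂ) (r : ℕ) (χ : GL (Fin n) F → ℂ) (χ' : GL (Fin N) F → ℂ) : ℂ :=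
  ∑ x : Module.End F (Fin n → F), XV χ (Fin n → F) x * UU l χ' (Fin r → F) x

lemma SS_dim {n N : ℕ} (l : MulChar F ℂ) (r : ℕ) (χ : GL (Fin n) F → ℂ) (χ' : GL (Fin N) F → ℂ) (hN : N ≠ n + r) : SS l r χ χ' = 0 := by
  unfold SS UU
  refine Finset.sum_eq_zero fun x _ => ?_
  rw [Finset.sum_eq_zero, mul_zero]
  refine fun C _ => Finset.sum_eq_zero fun E _ => ?_
  rw [XV_dim, mul_zero]
  rw [Module.finrank_prod]; simp; omega

def e0 (n r N : ℕ) (h : N = n + r) : ((Fin n → F) × (Fin r → F)) ≃ₗ[F] (Fin N → F) :=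
  LinearEquiv.ofFinrankEq _ _ (by rw [Module.finrank_prod]; simp [h])

lemma exists_mult {n N : ℕ} (l : MulChar F ℂ) (r : ℕ) (b : Irr (GL (Fin n) F)) (c : Irr (GL (Fin N) F)) :
    ∃ k : ℕ, SS l⁻¹ r (starf b.1) c.1 = KK F n r * k ∧ SS l r b.1 (starf c.1) = KK F n r * k := by
  by_cases hN : N = n + r
  · obtain ⟨k, h1, h2⟩ := mult_nat (LinearEquiv.refl F (Fin n → F)) (e0 n r N hN) l b.2 c.2
    have hb : IsClass b.1 := irr_class b.2
    have hc : IsClass c.1 := irr_class c.2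
    refine ⟨k, ?_, ?_⟩
    · have := sum_RR_UU (Y := Fin r → F) l⁻¹ (W := Fin n → F) hb.star c.1
      rw [inv_inv] at this
      rw [this] at h1
      rw [← h1]
      exact (mul_inv_cancel_left₀ (KK_ne n r) _).symm
    · rw [sum_RR_UU (Y := Fin r → F) l (W := Fin n → F) hb] at h2
      rw [← h2]
      exact (mul_inv_cancel_left₀ (KK_ne n r) _).symm
  · exact ⟨0, by rw [SS_dim _ _ _ _ hN]; simp, by rw [SS_dim _ _ _ _ hN]; simp⟩

/-- the multiplicity -/
def mN {n N : ℕ} (l : MulChar F ℂ) (r : ℕ) (b : Irr (GL (Fin n) F)) (c : Irr (GL (Fin N) F)) : ℕ := (exists_mult l r b c).choose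

lemma mN_1 {n N : ℕ} (l : MulChar F ℂ) (r : ℕ) (b : Irr (GL (Fin n) F)) (c : Irr (GL (Fin N) F)) :
    SS l⁻¹ r (starf b.1) c.1 = KK F n r * mN l r b c := (exists_mult l r b c).choose_spec.1

lemma mN_2 {n N : ℕ} (l : MulChar F ℂ) (r : ℕ) (b : Irr (GL (Fin n) F)) (c : Irr (GL (Fin N) F)) :
    SS l r b.1 (starf c.1) = KK F n r * mN l r b c := (exists_mult l r b c).choose_spec.2

lemma mN_dim {n N : ℕ} (l : MulChar F ℂ) (r : ℕ) (b : Irr (GL (Fin n) F)) (c : Irr (GL (Fin N) F)) (h : N ≠ n + r) : mN l r b c = 0 := by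
  have := mN_1 l r b c
  rw [SS_dim _ _ _ _ h] at this
  have := (mul_eq_zero.mp this.symm).resolve_left (KK_ne n r)
  exact_mod_cast this

lemma mackey_lhs {n n' N : ℕ} (l l' : MulChar F ℂ) (s t : ℕ) (b : Irr (GL (Fin n) F)) (b' : Irr (GL (Fin n') F)) (h : N = n + s) (h' : N = n' + t) :
    KK F n s * KK F n' t * ∑ c : Irr (GL (Fin N) F), (mN l' s b c : ℂ) * mN l t b' c =
    ∑ z : ((Fin n → F) × (Fin s → F)) ≃ₗ[F] ((Fin n' → F) × (Fin t → F)),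
      Ph (l'⁻¹ * l) l' l⁻¹ (starf b.1) b'.1 (W0 F (Fin n → F) (Fin s → F)) ((W0 F (Fin n' → F) (Fin t → F)).map (z.symm : _ →ₗ[F] ((Fin n → F) × (Fin s → F)))) := by
  have hb : IsClass b.1 := irr_class b.2
  have hb' : IsClass b'.1 := irr_class b'.2
  have key := parseval_gen (e0 n s N h) (e0 n' t N h')
    (fun g => l'⁻¹ (LinearMap.det g) * RR (starf b.1) l' (W0 F (Fin n → F) (Fin s → F)) g)
    (fun g => l (LinearMap.det g) * RR b'.1 l⁻¹ (W0 F (Fin n' → F) (Fin t → F)) g)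
    (by intro g hg; beta_reduce; rw [mulchar_det_nonunit _ _ hg, zero_mul])
  rw [Finset.mul_sum]
  refine Eq.trans ?_ (key.trans ?_)
  · refine Finset.sum_congr rfl fun c _ => ?_
    have e1 := sum_RR_UU (Y := Fin s → F) l'⁻¹ (W := Fin n → F) hb.star c.1
    rw [inv_inv] at e1
    have e2 := sum_RR_UU (Y := Fin t → F) l (W := Fin n' → F) hb' (starf c.1)
    have m1 := mN_1 l' s b c
    have m2 := mN_2 l t b' c
    rw [SS, ← e1] at m1
    rw [SS, ← e2] at m2
    rw [m1, m2]; ring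
  · refine Finset.sum_congr rfl fun z _ => ?_
    rw [Ph]
    refine Finset.sum_congr rfl fun g _ => ?_
    have := RR_conj hb' l⁻¹ ((W0 F (Fin n' → F) (Fin t → F)).map (z.symm : _ →ₗ[F] ((Fin n → F) × (Fin s → F)))) g z
    rw [← map_trans] at this
    rw [← this, det_conj', MulChar.mul_apply]
    have e3 : (W0 F (Fin n' → F) (Fin t → F)).map ((z.symm.trans z : _ ≃ₗ[F] _) : _ →ₗ[F] ((Fin n' → F) × (Fin t → F))) = W0 F (Fin n' → F) (Fin t → F) := by
      rw [LinearEquiv.symm_trans_self]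
      exact Submodule.map_id _
    rw [e3]; ring

lemma mackey_rhs {k n n' : ℕ} (l l' : MulChar F ℂ) (s t : ℕ) (b : Irr (GL (Fin n) F)) (b' : Irr (GL (Fin n') F)) :
    ∑ a : Irr (GL (Fin k) F), (mN l t a b : ℂ) * mN l' s a b' =
    (KK F k t)⁻¹ * (gam F (Fin s → F) * hom F (Fin s → F) (Fin k → F))⁻¹ * ∑ x : Module.End F (Fin k → F), UU l (starf b.1) (Fin t → F) x * UU l'⁻¹ b'.1 (Fin s → F) x := by
  have hb : IsClass b.1 := irr_class b.2
  have hb' : IsClass b'.1 := irr_class b'.2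
  have key := parseval_gen (LinearEquiv.refl F (Fin k → F)) (LinearEquiv.refl F (Fin k → F))
    (fun x => UU l (starf b.1) (Fin t → F) x) (fun x => UU l'⁻¹ b'.1 (Fin s → F) x) (fun x hx => UU_nonunit _ _ _ hx)
  simp only [UU_conj _ hb'] at key
  rw [Finset.sum_const, Finset.card_univ, nsmul_eq_mul, card_equiv] at key
  have g1 : gam F (Fin k → F) ≠ 0 := gam_ne
  have g2 : gam F (Fin s → F) ≠ 0 := gam_ne
  have g3 : hom F (Fin s → F) (Fin k → F) ≠ 0 := hom_ne
  have h1 : ∀ a : Irr (GL (Fin k) F), (mN l t a b : ℂ) * mN l' s a b' = (KK F k t)⁻¹ * (KK F k s)⁻¹ *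
    ((∑ g, UU l (starf b.1) (Fin t → F) g * XV a.1 (Fin k → F) g) * ∑ g, UU l'⁻¹ b'.1 (Fin s → F) g * XV (starf a.1) (Fin k → F) g) := by
    intro a
    have m1 := mN_2 l t a b
    have m2 := mN_1 l' s a b'
    have e1 : SS l t a.1 (starf b.1) = ∑ g, UU l (starf b.1) (Fin t → F) g * XV a.1 (Fin k → F) g := by
      rw [SS]; exact Finset.sum_congr rfl fun x _ => mul_comm _ _
    have e2 : SS l'⁻¹ s (starf a.1) b'.1 = ∑ g, UU l'⁻¹ b'.1 (Fin s → F) g * XV (starf a.1) (Fin k → F) g := by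
      rw [SS]; exact Finset.sum_congr rfl fun x _ => mul_comm _ _
    rw [← e1, ← e2, m1, m2]
    have k1 := KK_ne (F := F) k t
    have k2 := KK_ne (F := F) k s
    field_simp
  rw [Finset.sum_congr rfl fun a _ => h1 a, ← Finset.mul_sum, key]
  have k1 := KK_ne (F := F) k t
  rw [KK, KK]
  have g4 : gam F (Fin t → F) ≠ 0 := gam_ne
  have g5 : hom F (Fin t → F) (Fin k → F) ≠ 0 := hom_ne
  field_simp

lemma mackey_full {n n' N : ℕ} (l l' : MulChar F ℂ) (s t : ℕ) (b : Irr (GL (Fin n) F)) (b' : Irr (GL (Fin n') F)) (h : N = n + s) (h' : N = n' + t) :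
    ∑ c : Irr (GL (Fin N) F), mN l' s b c * mN l t b' c = ∑ i ∈ Finset.range (t + 1),
      if (l = l' ∨ i = 0) ∧ i ≤ s ∧ t ≤ n + i then ∑ a : Irr (GL (Fin (n + i - t)) F), mN l (t - i) a b * mN l' (s - i) a b' else 0 := by
  have hb : IsClass b.1 := irr_class b.2
  have hb' : IsClass b'.1 := irr_class b'.2
  have L := mackey_lhs l l' s t b b' h h'
  have k1 := KK_ne (F := F) n s
  have k2 := KK_ne (F := F) n' t
  apply Nat.cast_injective (R := ℂ)
  push_cast
  refine mul_left_cancel₀ (mul_ne_zero k1 k2) (L.trans ?_)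
  rw [Finset.mul_sum]
  have part : ∀ z : ((Fin n → F) × (Fin s → F)) ≃ₗ[F] ((Fin n' → F) × (Fin t → F)),
      Ph (l'⁻¹ * l) l' l⁻¹ (starf b.1) b'.1 (W0 F (Fin n → F) (Fin s → F)) ((W0 F (Fin n' → F) (Fin t → F)).map (z.symm : _ →ₗ[F] ((Fin n → F) × (Fin s → F))))
      = ∑ i ∈ Finset.range (t + 1), if (i ≤ s ∧ t ≤ n + i) ∧ Module.finrank F (W0 F (Fin n → F) (Fin s → F) ⊓ (W0 F (Fin n' → F) (Fin t → F)).map (z.symm : _ →ₗ[F] ((Fin n → F) × (Fin s → F))) : Submodule F _) = n + i - t then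
        Ph (l'⁻¹ * l) l' l⁻¹ (starf b.1) b'.1 (W0 F (Fin n → F) (Fin s → F)) ((W0 F (Fin n' → F) (Fin t → F)).map (z.symm : _ →ₗ[F] ((Fin n → F) × (Fin s → F)))) else 0 := by
    intro z
    set U := W0 F (Fin n → F) (Fin s → F) with hU
    set U' := (W0 F (Fin n' → F) (Fin t → F)).map (z.symm : _ →ₗ[F] ((Fin n → F) × (Fin s → F))) with hU'
    have d1 : Module.finrank F U = n := by rw [hU, finrank_W0]; simp
    have d2 : Module.finrank F U' = n' := by rw [hU', LinearEquiv.finrank_map_eq, finrank_W0]; simp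
    have d3 := Submodule.finrank_sup_add_finrank_inf_eq U U'
    have d4 := Submodule.finrank_le (U ⊔ U')
    have d5 := Submodule.finrank_mono (inf_le_left : U ⊓ U' ≤ U)
    have d6 := Submodule.finrank_mono (inf_le_right : U ⊓ U' ≤ U')
    have d7 : Module.finrank F ((Fin n → F) × (Fin s → F)) = n + s := by simp
    rw [Finset.sum_eq_single (Module.finrank F (U ⊓ U' : Submodule F _) + t - n)]
    · rw [if_pos]; omega
    · intro i _ hi
      rw [if_neg]; omega
    · intro hi
      exfalso; apply hi; rw [Finset.mem_range]; omega
  rw [Finset.sum_congr rfl fun z _ => part z, Finset.sum_comm]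
  refine Finset.sum_congr rfl fun i hi => ?_
  have hi := Finset.mem_range.mp hi
  by_cases hv : i ≤ s ∧ t ≤ n + i
  · have MI := mackey_i (W := Fin n → F) (Y := Fin s → F) (W' := Fin n' → F) (Y' := Fin t → F)
      (T := Fin (n + i - t) → F) (A := Fin (t - i) → F) (B := Fin (s - i) → F) (D := Fin i → F) (l'⁻¹ * l) l' l⁻¹ hb.star hb'
      (by simp; omega) (by simp; omega) (by simp; omega) (by simp; omega)
    simp only [Module.finrank_fin_fun] at MI
    simp only [hv, true_and, and_true]
    rw [MI]
    rw [show l'⁻¹ * l * l' = l by rw [mul_comm l'⁻¹, inv_mul_cancel_right], show l * l⁻¹ = 1 by simp, show l'⁻¹ * l * l⁻¹ = l'⁻¹ by simp]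
    have hx : ∑ x : Module.End F (Fin (n + i - t) → F), (1 : MulChar F ℂ) (LinearMap.det x) * UU l (starf b.1) (Fin (t - i) → F) x * UU l'⁻¹ b'.1 (Fin (s - i) → F) x
      = ∑ x : Module.End F (Fin (n + i - t) → F), UU l (starf b.1) (Fin (t - i) → F) x * UU l'⁻¹ b'.1 (Fin (s - i) → F) x := by
      refine Finset.sum_congr rfl fun x _ => ?_
      by_cases hx : IsUnit x
      · rw [MulChar.one_apply, one_mul]
        rw [isUnit_det] at hx
        exact isUnit_iff_ne_zero.mpr hx
      · rw [UU_nonunit _ _ _ hx]; ring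
    have hl : (l'⁻¹ * l = 1) ↔ l = l' := by rw [inv_mul_eq_one]; exact eq_comm
    rw [hx]
    have M2 := mackey_rhs (k := n + i - t) l l' (s - i) (t - i) b b'
    simp only [hl]
    split_ifs with hh
    · push_cast
      rw [M2, KK, KK, KK]; ring
    · simp
  · rw [if_neg (fun hh => hv hh.2), Finset.sum_eq_zero]
    · simp
    · intro z _
      rw [if_neg (fun hh => hv hh.1)]

end geom7
end OEB

namespace OEB

section geom8
variable {F : Type} [Field F] [Fintype F]
set_option linter.all false

lemma gam_card (n : ℕ) : gam F (Fin n → F) = (Nat.card (GL (Fin n) F) : ℂ) := by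
  rw [gam, sum_lin (LinearEquiv.refl F (Fin n → F))]
  · rw [Nat.card_eq_fintype_card, Fintype.card, Finset.card_eq_sum_ones]
    push_cast
    exact Finset.sum_congr rfl fun A _ => by rw [if_pos (lin_isUnit _ _)]
  · intro g hg
    rw [if_neg hg]

lemma card_equiv' {V V' : Type} [AddCommGroup V] [Module F V] [AddCommGroup V'] [Module F V'] [Finite V] [Finite V'] {n : ℕ}
    (e : V ≃ₗ[F] (Fin n → F)) (e' : V' ≃ₗ[F] (Fin n → F)) : (Fintype.card (V ≃ₗ[F] V') : ℂ) = gam F (Fin n → F) := by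
  rw [gam_card, Fintype.card, Finset.card_eq_sum_ones]
  push_cast
  rw [sum_equiv e e', Nat.card_eq_fintype_card]
  simp

lemma hom_card (n r : ℕ) : hom F (Fin r → F) (Fin n → F) = (Fintype.card F : ℂ) ^ (n * r) := by
  have : Fintype.card ((Fin r → F) →ₗ[F] (Fin n → F)) = Fintype.card F ^ (n * r) := by
    rw [Module.card_eq_pow_finrank (K := F)]
    simp [Module.finrank_linearMap, mul_comm]
  rw [hom, this]; push_cast; rfl

lemma gam_phi (n : ℕ) : gam F (Fin n → F) = (((Fintype.card F : ℚ) ^ (n * (n - 1) / 2) * phi (Fintype.card F) n : ℚ) : ℂ) := by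
  rw [gam_card, Matrix.card_GL_field]
  have hq : 1 ≤ Fintype.card F := Fintype.card_pos
  have h1 : ((∏ i : Fin n, (Fintype.card F ^ n - Fintype.card F ^ (i : ℕ)) : ℕ) : ℚ) = (Fintype.card F : ℚ) ^ (n * (n - 1) / 2) * phi (Fintype.card F) n := by
    rw [phi, ← Finset.sum_range_id, ← Finset.prod_pow_eq_pow_sum]
    rw [← Finset.prod_range_reflect (fun i => (Fintype.card F : ℚ) ^ (i + 1) - 1), ← Finset.prod_mul_distrib, Finset.prod_range]
    push_cast
    refine Finset.prod_congr rfl fun i _ => ?_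
    rw [Nat.cast_sub (Nat.pow_le_pow_right hq i.2.le)]
    push_cast
    rw [mul_sub, ← pow_add, mul_one]
    congr 2
    omega
  rw [← h1]; push_cast; rfl

lemma KK_zero (n : ℕ) : KK F n 0 = gam F (Fin n → F) := by
  rw [KK, hom_card, gam_card 0, Nat.card_unique]; simp

lemma sum_XV_star {n : ℕ} (b c : Irr (GL (Fin n) F)) :
    ∑ x : Module.End F (Fin n → F), XV (starf b.1) (Fin n → F) x * XV c.1 (Fin n → F) x = if b = c then gam F (Fin n → F) else 0 := by
  have hb : IsClass b.1 := irr_class b.2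
  have hc : IsClass c.1 := irr_class c.2
  rw [sum_lin (LinearEquiv.refl F (Fin n → F))]
  · simp only [XV_lin hb.star, XV_lin hc, starf]
    have := irr_orth c.2 b.2
    rw [gam_card]
    rw [Finset.sum_congr rfl fun A _ => mul_comm _ _, this]
    simp only [Subtype.ext_iff, eq_comm]
  · intro g hg
    rw [XV_nonunit _ _ hg, zero_mul]

lemma mN_zero {n : ℕ} (l : MulChar F ℂ) (b c : Irr (GL (Fin n) F)) : mN l 0 b c = if b = c then 1 else 0 := by
  have hc : IsClass c.1 := irr_class c.2
  have m := mN_1 l 0 b c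
  have hU : ∀ x : Module.End F (Fin n → F), UU l⁻¹ c.1 (Fin 0 → F) x = XV c.1 (Fin n → F) x := by
    intro x
    have hs : Subsingleton ((Fin 0 → F) →ₗ[F] (Fin n → F)) := ⟨fun f g => by ext x; exact x.elim0⟩
    have hs2 : Subsingleton (Module.End F (Fin 0 → F)) := ⟨fun f g => by ext x; exact x.elim0⟩
    rw [UU, Fintype.sum_subsingleton _ 0, Fintype.sum_subsingleton _ 1]
    rw [← XV_conj hc x (LinearEquiv.ofLinear (LinearMap.inl F (Fin n → F) (Fin 0 → F)) (LinearMap.fst F _ _)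
      (by ext x <;> first | rfl | exact x.elim0 | simp) (by ext; simp))]
    rw [map_one, map_one, one_mul]
    congr 1
    refine LinearMap.ext fun p => ?_
    refine Prod.ext ?_ (Subsingleton.elim _ _)
    simp [LinearEquiv.conj_apply]
  rw [SS, Finset.sum_congr rfl fun x _ => by rw [hU x], sum_XV_star, KK_zero] at m
  have g : gam F (Fin n → F) ≠ 0 := gam_ne
  apply Nat.cast_injective (R := ℂ)
  apply mul_left_cancel₀ g
  rw [← m]
  split_ifs <;> simp

lemma XV_one {n : ℕ} {V : Type} [AddCommGroup V] [Module F V] [Finite V] {χ : GL (Fin n) F → ℂ} (h : IsClass χ) (e : V ≃ₗ[F] (Fin n → F)) :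
    XV χ V 1 = χ 1 := by
  rw [← lin_one e, XV_lin h]

lemma blk_one {W Y : Type} [AddCommGroup W] [Module F W] [AddCommGroup Y] [Module F Y] [Finite W] [Finite Y] : blk (1 : Module.End F W) 0 (1 : Module.End F Y) = 1 := by
  refine LinearMap.ext fun p => ?_
  ext <;> simp

lemma sum_mN_deg {n N : ℕ} (l : MulChar F ℂ) (r : ℕ) (b : Irr (GL (Fin n) F)) (h : N = n + r) :
    KK F n r * ∑ c : Irr (GL (Fin N) F), (mN l r b c : ℂ) * c.1 1 = gam F (Fin N → F) * b.1 1 := by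
  have hb : IsClass b.1 := irr_class b.2
  have key := parseval_gen (LinearEquiv.refl F (Fin N → F)) (e0 n r N h)
    (fun g => if g = 1 then 1 else 0)
    (fun g => l (LinearMap.det g) * RR b.1 l⁻¹ (W0 F (Fin n → F) (Fin r → F)) g)
    (by intro g hg; beta_reduce; rw [if_neg]; rintro rfl; exact hg isUnit_one)
  simp only [ite_mul, one_mul, zero_mul, Finset.sum_ite_eq', Finset.mem_univ, if_true] at key
  rw [Finset.mul_sum]
  refine Eq.trans ?_ (key.trans ?_)
  · refine Finset.sum_congr rfl fun c _ => ?_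
    have hc : IsClass c.1 := irr_class c.2
    have e2 := sum_RR_UU (Y := Fin r → F) l (W := Fin n → F) hb (starf c.1)
    have m2 := mN_2 l r b c
    rw [SS, ← e2] at m2
    rw [m2, XV_one hc (LinearEquiv.refl F _)]; ring
  · have h1 : ∀ z : (Fin N → F) ≃ₗ[F] ((Fin n → F) × (Fin r → F)), z.conj 1 = 1 := by
      intro z
      ext x <;> simp [LinearEquiv.conj_apply]
    simp only [h1]
    rw [Finset.sum_const, Finset.card_univ, nsmul_eq_mul, card_equiv' (LinearEquiv.refl F _) (e0 n r N h)]
    have : RR b.1 l⁻¹ (W0 F (Fin n → F) (Fin r → F)) 1 = b.1 1 := by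
      rw [← blk_one, RR_blk hb, fX, XV_one hb (LinearEquiv.refl F _)]; simp
    rw [this]
    simp

lemma sum_mN_deg' {n N : ℕ} (l : MulChar F ℂ) (r : ℕ) (b : Irr (GL (Fin n) F)) (h : N = n + r) :
    (phi (Fintype.card F) n : ℂ) * phi (Fintype.card F) r * ∑ c : Irr (GL (Fin N) F), (mN l r b c : ℂ) * c.1 1 = phi (Fintype.card F) N * b.1 1 := by
  have k := sum_mN_deg l r b h
  rw [KK, hom_card, gam_phi, gam_phi, gam_phi] at k
  push_cast at k
  have hq : (Fintype.card F : ℂ) ≠ 0 := by exact_mod_cast Fintype.card_ne_zero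
  have e : N * (N - 1) / 2 = n * (n - 1) / 2 + r * (r - 1) / 2 + n * r := by
    subst h
    rw [← Finset.sum_range_id, ← Finset.sum_range_id, ← Finset.sum_range_id, Finset.sum_range_add, Finset.sum_add_distrib]
    simp; ring
  rw [e, pow_add, pow_add] at k
  have h1 : (Fintype.card F : ℂ) ^ (n * (n - 1) / 2) * (Fintype.card F : ℂ) ^ (r * (r - 1) / 2) * (Fintype.card F : ℂ) ^ (n * r) ≠ 0 := by positivity
  apply mul_left_cancel₀ h1
  linear_combination k

end geom8
end OEB

namespace OEB

section geom9
variable {F : Type} [Field F] [Fintype F]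
variable {W Y : Type} [AddCommGroup W] [Module F W] [AddCommGroup Y] [Module F Y] [Finite W] [Finite Y]
set_option linter.all false

/-- unipotent radical -/
def uni : Multiplicative (Y →ₗ[F] W) →* ((W × Y) ≃ₗ[F] (W × Y)) where
  toFun C := LinearEquiv.ofLinear (blk 1 C.toAdd 1) (blk 1 (-C.toAdd) 1)
    (by refine LinearMap.ext fun p => ?_; ext <;> simp) (by refine LinearMap.ext fun p => ?_; ext <;> simp)
  map_one' := by
    refine LinearEquiv.ext fun p => ?_
    change blk 1 0 1 p = p
    rw [blk_one]; rfl
  map_mul' C C' := by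
    refine LinearEquiv.ext fun p => ?_
    change blk 1 (C.toAdd + C'.toAdd) 1 p = blk 1 C.toAdd 1 (blk 1 C'.toAdd 1 p)
    ext
    · simp; abel
    · simp

lemma uni_coe (C : Multiplicative (Y →ₗ[F] W)) : (uni C : (W × Y) →ₗ[F] (W × Y)) = blk 1 C.toAdd 1 := rfl

/-- one dimensional representation from an additive character -/
def oneD {U : Type} [AddCommGroup U] (ψ : AddChar U ℂ) : Representation ℂ (Multiplicative U) ℂ where
  toFun u := (ψ u.toAdd) • LinearMap.id
  map_one' := by
    rw [toAdd_one, AddChar.map_zero_eq_one, one_smul]; rfl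
  map_mul' a b := by
    rw [toAdd_mul, AddChar.map_add_eq_mul]
    ext
    simp
    ring

lemma oneD_char {U : Type} [AddCommGroup U] (ψ : AddChar U ℂ) (u : Multiplicative U) : (oneD ψ).character u = ψ u.toAdd := by
  have : oneD ψ u = (ψ u.toAdd) • LinearMap.id := rfl
  rw [Representation.character, this, map_smul, LinearMap.trace_id]; simp

lemma fourier_nat {N : ℕ} (e : (W × Y) ≃ₗ[F] (Fin N → F)) {χ : GL (Fin N) F → ℂ} (h : χ ∈ Irr (GL (Fin N) F)) (ψ : AddChar (Y →ₗ[F] W) ℂ) :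
    ∃ k : ℕ, ∑ C : Y →ₗ[F] W, XV χ (W × Y) (blk 1 C 1) * ψ (-C) = hom F Y W * k := by
  have hc : IsClass χ := irr_class h
  obtain ⟨X, hX, rfl⟩ := h
  have key := Representation.card_inv_mul_sum_char_mul_char_eq_finrank (oneD ψ) (X.ρ.comp ((toGL e).comp uni))
  refine ⟨Module.finrank ℂ ((oneD ψ).IntertwiningMap (X.ρ.comp ((toGL e).comp uni))), ?_⟩
  rw [← key]
  have hh : (Nat.card (Multiplicative (Y →ₗ[F] W)) : ℂ) = hom F Y W := by
    rw [hom, ← Nat.card_eq_fintype_card]; rfl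
  rw [hh, mul_inv_cancel_left₀ hom_ne]
  refine Fintype.sum_equiv Multiplicative.ofAdd _ _ fun C => ?_
  rw [oneD_char]
  congr 1
  exact XV_toGL e hc (uni (Multiplicative.ofAdd C))

lemma exists_move (v w : W) (hv : v ≠ 0) (hw : w ≠ 0) : ∃ z : W ≃ₗ[F] W, z v = w := by
  let f := (LinearEquiv.toSpanNonzeroSingleton F W v hv).symm.trans (LinearEquiv.toSpanNonzeroSingleton F W w hw)
  obtain ⟨g, hg⟩ := Submodule.exists_linearEquiv_restrict_eq f
  refine ⟨g, ?_⟩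
  have := hg ⟨v, Submodule.mem_span_singleton_self v⟩
  rw [← this]
  have h1 : (LinearEquiv.toSpanNonzeroSingleton F W v hv).symm ⟨v, Submodule.mem_span_singleton_self v⟩ = 1 := by
    rw [LinearEquiv.symm_apply_eq]
    ext; simp
  simp [f, h1]

lemma uni_conj {N : ℕ} {χ : GL (Fin N) F → ℂ} (h : IsClass χ) (C C' : (Fin 1 → F) →ₗ[F] W) (hC : C ≠ 0) (hC' : C' ≠ 0) :
    XV χ (W × (Fin 1 → F)) (blk 1 C 1) = XV χ (W × (Fin 1 → F)) (blk 1 C' 1) := by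
  have hne : ∀ C : (Fin 1 → F) →ₗ[F] W, C ≠ 0 → C (fun _ => 1) ≠ 0 := by
    intro C hC h0
    apply hC
    refine LinearMap.ext fun y => ?_
    have : y = y 0 • (fun _ => (1 : F)) := by
      ext i; rw [Subsingleton.elim i 0]; simp
    rw [this, map_smul, h0]; simp
  obtain ⟨z, hz⟩ := exists_move (F := F) _ _ (hne C hC) (hne C' hC')
  rw [← XV_conj h (blk 1 C 1) (z.prodCongr (LinearEquiv.refl F (Fin 1 → F)))]
  congr 1
  refine LinearMap.ext fun p => ?_
  have : z (C p.2) = C' p.2 := by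
    have : p.2 = p.2 0 • (fun _ => (1 : F)) := by
      ext i; rw [Subsingleton.elim i 0]; simp
    rw [this, map_smul, map_smul, map_smul, hz]
  ext <;> simp [LinearEquiv.conj_apply, this]

lemma sum_lchar [Fintype (MulChar F ℂ)] (a : F) (ha : a ≠ 0) : ∑ l : MulChar F ℂ, l⁻¹ a = if a = 1 then (Fintype.card F - 1 : ℂ) else 0 := by
  split_ifs with h
  · rw [h]
    simp only [map_one]
    rw [Finset.sum_const, Finset.card_univ, ← Nat.card_eq_fintype_card, MulChar.card_eq_card_units_of_hasEnoughRootsOfUnity,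
      Nat.card_eq_fintype_card, Fintype.card_units]
    rw [nsmul_eq_mul, mul_one, Nat.cast_sub Fintype.card_pos]; simp
  · obtain ⟨c, hc⟩ := MulChar.exists_apply_ne_one_of_hasEnoughRootsOfUnity F ℂ (a := a) h
    have h3 : ∑ l : MulChar F ℂ, l⁻¹ a = c a * ∑ l : MulChar F ℂ, l⁻¹ a := by
      rw [Finset.mul_sum]
      refine Fintype.sum_equiv (Equiv.mulRight c) _ _ fun l => ?_
      rw [Equiv.coe_mulRight, ← MulChar.mul_apply, mul_inv, mul_comm c, inv_mul_cancel_right]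
    have h4 : (1 - c a) * ∑ l : MulChar F ℂ, l⁻¹ a = 0 := by linear_combination h3
    rcases mul_eq_zero.mp h4 with h5 | h5
    · exact absurd (sub_eq_zero.mp h5).symm hc
    · exact h5

lemma end_one (E : Module.End F (Fin 1 → F)) : LinearMap.det E = 1 ↔ E = 1 := by
  constructor
  · intro h
    rw [← LinearMap.det_toMatrix'] at h
    rw [Matrix.det_fin_one] at h
    apply LinearMap.toMatrix'.injective
    ext i j
    rw [Subsingleton.elim i 0, Subsingleton.elim j 0, h]
    rw [LinearMap.toMatrix'_one]; simp
  · rintro rfl; simp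

lemma sum_l_UU [Fintype (MulChar F ℂ)] {N : ℕ} (χ : GL (Fin N) F → ℂ) :
    ∑ l : MulChar F ℂ, UU l⁻¹ χ (Fin 1 → F) (1 : Module.End F W) = (Fintype.card F - 1) * ∑ C : (Fin 1 → F) →ₗ[F] W, XV χ (W × (Fin 1 → F)) (blk 1 C 1) := by
  unfold UU
  rw [Finset.sum_comm, Finset.mul_sum]
  refine Finset.sum_congr rfl fun C _ => ?_
  rw [Finset.sum_comm, Finset.sum_eq_single 1]
  · rw [← Finset.sum_mul, sum_lchar _ (by simp), if_pos (by simp)]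
  · intro E _ hE
    rw [← Finset.sum_mul]
    by_cases hd : LinearMap.det E = 0
    · rw [XV_nonunit, mul_zero]
      rw [isUnit_blk, isUnit_det E]
      exact fun h => h.2 hd
    · rw [sum_lchar _ hd, if_neg, zero_mul]
      rwa [end_one]
  · simp

lemma sum_mN_one {n N : ℕ} (l : MulChar F ℂ) (r : ℕ) (c : Irr (GL (Fin N) F)) :
    KK F n r * ∑ b : Irr (GL (Fin n) F), (mN l r b c : ℂ) * b.1 1 = gam F (Fin n → F) * UU l⁻¹ c.1 (Fin r → F) (1 : Module.End F (Fin n → F)) := by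
  have hc : IsClass c.1 := irr_class c.2
  have key := parseval_gen (LinearEquiv.refl F (Fin n → F)) (LinearEquiv.refl F (Fin n → F))
    (fun g => if g = 1 then 1 else 0) (fun g => UU l⁻¹ c.1 (Fin r → F) g)
    (by intro g hg; beta_reduce; rw [if_neg]; rintro rfl; exact hg isUnit_one)
  simp only [ite_mul, one_mul, zero_mul, Finset.sum_ite_eq', Finset.mem_univ, if_true, UU_conj _ hc] at key
  rw [Finset.sum_const, Finset.card_univ, nsmul_eq_mul, card_equiv] at key
  rw [← key, Finset.mul_sum]
  refine Finset.sum_congr rfl fun b _ => ?_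
  have hb : IsClass b.1 := irr_class b.2
  have m := mN_1 l r b c
  rw [XV_one hb (LinearEquiv.refl F _)]
  have : ∑ x, UU l⁻¹ c.1 (Fin r → F) x * XV (starf b.1) (Fin n → F) x = SS l⁻¹ r (starf b.1) c.1 := by
    rw [SS]; exact Finset.sum_congr rfl fun x _ => mul_comm _ _
  rw [this, m]; ring

lemma hmod_main [Fintype (MulChar F ℂ)] {k : ℕ} (hk : 1 ≤ k) (c : Irr (GL (Fin (k + 1)) F)) :
    ∃ Nn : ℕ, c.1 1 = ∑ l : MulChar F ℂ, ∑ b : Irr (GL (Fin k) F), (mN l 1 b c : ℂ) * b.1 1 + ((Fintype.card F : ℂ) ^ k - 1) * Nn := by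
  have hc : IsClass c.1 := irr_class c.2
  have : Nonempty (Fin k) := ⟨⟨0, hk⟩⟩
  obtain ⟨C0, hC0⟩ : ∃ C0 : (Fin 1 → F) →ₗ[F] (Fin k → F), C0 ≠ 0 := by
    have : Nontrivial ((Fin 1 → F) →ₗ[F] (Fin k → F)) := by
      apply Module.nontrivial_of_finrank_pos (R := F)
      rw [Module.finrank_linearMap]; simp; omega
    exact exists_ne 0
  obtain ⟨ψ, hψ⟩ := AddChar.exists_apply_ne_zero.mpr hC0
  obtain ⟨Nn, hN⟩ := fourier_nat (e0 k 1 (k + 1) rfl) c.2 ψ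
  set x := XV c.1 ((Fin k → F) × (Fin 1 → F)) (blk 1 C0 1) with hx
  have hval : ∀ C : (Fin 1 → F) →ₗ[F] (Fin k → F), XV c.1 ((Fin k → F) × (Fin 1 → F)) (blk 1 C 1) = x + if C = 0 then c.1 1 - x else 0 := by
    intro C
    split_ifs with h0
    · rw [h0, blk_one, XV_one hc (e0 k 1 (k + 1) rfl)]; ring
    · rw [uni_conj hc C C0 h0 hC0, add_zero]
  have hom1 : hom F (Fin 1 → F) (Fin k → F) = (Fintype.card F : ℂ) ^ k := by rw [hom_card, mul_one]
  have hq : (Fintype.card F : ℂ) ^ k ≠ 0 := by rw [← hom1]; exact hom_ne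
  have hs0 : ∑ C : (Fin 1 → F) →ₗ[F] (Fin k → F), ψ (-C) = 0 := by
    rw [Fintype.sum_equiv (Equiv.neg _) (fun C => ψ (-C)) ψ (fun C => rfl)]
    exact AddChar.sum_eq_zero_iff_ne_zero.mpr (by rintro rfl; simp at hψ)
  have e1 : c.1 1 - x = (Fintype.card F : ℂ) ^ k * Nn := by
    rw [← hom1, ← hN]
    simp only [hval, add_mul, ite_mul, zero_mul]
    rw [Finset.sum_add_distrib, ← Finset.mul_sum, hs0]
    simp
  have e2 : ∑ C : (Fin 1 → F) →ₗ[F] (Fin k → F), XV c.1 ((Fin k → F) × (Fin 1 → F)) (blk 1 C 1) = (Fintype.card F : ℂ) ^ k * x + (c.1 1 - x) := by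
    simp only [hval]
    rw [Finset.sum_add_distrib, Finset.sum_const, Finset.card_univ, nsmul_eq_mul]
    rw [← hom1, hom]; simp
  have e3 : ∑ l : MulChar F ℂ, KK F k 1 * ∑ b : Irr (GL (Fin k) F), (mN l 1 b c : ℂ) * b.1 1 = gam F (Fin k → F) * ((Fintype.card F - 1) * ((Fintype.card F : ℂ) ^ k * x + (c.1 1 - x))) := by
    rw [← e2, ← sum_l_UU, Finset.mul_sum]
    exact Finset.sum_congr rfl fun l _ => sum_mN_one l 1 c
  rw [← Finset.mul_sum, KK, hom1] at e3
  have g1 : gam F (Fin 1 → F) = (Fintype.card F - 1 : ℂ) := by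
    rw [gam_phi, phi]; simp
  have g0 : gam F (Fin 1 → F) ≠ 0 := gam_ne
  have g2 : gam F (Fin k → F) ≠ 0 := gam_ne
  rw [← g1] at e3
  have e4 : (Fintype.card F : ℂ) ^ k * ∑ l : MulChar F ℂ, ∑ b : Irr (GL (Fin k) F), (mN l 1 b c : ℂ) * b.1 1 = (Fintype.card F : ℂ) ^ k * x + (c.1 1 - x) := by
    apply mul_left_cancel₀ (mul_ne_zero g0 g2)
    linear_combination e3
  refine ⟨Nn, ?_⟩
  apply mul_left_cancel₀ hq
  rw [mul_add, e4]
  linear_combination ((Fintype.card F : ℂ) ^ k - 1) * e1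

end geom9
end OEB

namespace OEB

section final
variable {F : Type} [Field F] [Fintype F]
set_option linter.all false

variable (F) in
/-- all irreducible characters of all general linear groups -/
abbrev BB : Type := Σ n : ℕ, Irr (GL (Fin n) F)

/-- degree of an irreducible character -/
def dg (b : BB F) : ℕ := Module.finrank ℂ b.2.2.choose

lemma dg_eq (b : BB F) : b.2.1 1 = (dg b : ℂ) := by
  conv_lhs => rw [← b.2.2.choose_spec.2]
  exact FDRep.char_one _

lemma irr_one_ne {G : Type} [Group G] [Fintype G] {χ : G → ℂ} (h : χ ∈ Irr G) : χ 1 ≠ 0 := by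
  intro h0
  have ho := irr_orth h h
  obtain ⟨V, hV, rfl⟩ := h
  rw [FDRep.char_one] at h0
  have h1 : Module.finrank ℂ V.V = 0 := by exact_mod_cast h0
  have h2 : Subsingleton V.V := Module.finrank_zero_iff.mp h1
  have h3 : ∀ g, V.character g = 0 := by
    intro g
    have : V.ρ g = 0 := Subsingleton.elim _ _
    simp [FDRep.character, Representation.character, this]
  simp only [h3, mul_zero, Finset.sum_const_zero, if_true, Nat.card_eq_fintype_card] at ho
  exact Fintype.card_ne_zero (α := G) (by exact_mod_cast ho.symm)

lemma dg_pos (b : BB F) : 0 < dg b := by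
  have := irr_one_ne b.2.2
  rw [dg_eq] at this
  exact Nat.pos_of_ne_zero (by exact_mod_cast this)

/-- multiplicities -/
def MM (l : MulChar F ℂ) (r : ℕ) (b c : BB F) : ℤ := (mN l r b.2 c.2 : ℤ)

lemma MM_dim (l : MulChar F ℂ) (r : ℕ) (b c : BB F) (h : c.1 ≠ b.1 + r) : MM l r b c = 0 := by
  simp [MM, mN_dim l r b.2 c.2 h]

lemma MM_zero (l : MulChar F ℂ) (b c : BB F) : MM l 0 b c = if b = c then 1 else 0 := by
  by_cases h : c.1 = b.1
  · obtain ⟨n, b⟩ := b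
    obtain ⟨n', c⟩ := c
    dsimp at h
    subst h
    simp only [MM, mN_zero]
    by_cases hb : b = c
    · simp [hb]
    · simp [hb]
  · rw [MM_dim l 0 b c (by simpa using h), if_neg]
    rintro rfl
    exact h rfl

/-- finitely supported function on a layer -/
def fib (n : ℕ) (f : BB F → ℤ) : BB F →₀ ℤ :=
  ∑ c : Irr (GL (Fin n) F), Finsupp.single (⟨n, c⟩ : BB F) (f ⟨n, c⟩)

lemma fib_apply (n : ℕ) (f : BB F → ℤ) (b : BB F) : fib n f b = if b.1 = n then f b else 0 := by
  obtain ⟨k, b⟩ := b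
  rw [fib, Finsupp.finset_sum_apply]
  split_ifs with h
  · dsimp at h
    subst h
    rw [Finset.sum_eq_single b]
    · simp
    · intro c _ hc
      rw [Finsupp.single_apply, if_neg]
      intro hh
      exact hc (eq_of_heq (Sigma.mk.inj hh).2)
    · simp
  · refine Finset.sum_eq_zero fun c _ => ?_
    rw [Finsupp.single_apply, if_neg]
    intro hh
    exact h (congrArg Sigma.fst hh).symm

lemma map_fib (T : Module.End ℤ (BB F →₀ ℤ)) (n : ℕ) (f : BB F → ℤ) (b : BB F) :
    (T (fib n f)) b = ∑ c : Irr (GL (Fin n) F), f ⟨n, c⟩ * T (Finsupp.single (⟨n, c⟩ : BB F) 1) b := by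
  rw [fib, map_sum, Finsupp.finset_sum_apply]
  refine Finset.sum_congr rfl fun c _ => ?_
  have : Finsupp.single (⟨n, c⟩ : BB F) (f ⟨n, c⟩) = f ⟨n, c⟩ • Finsupp.single (⟨n, c⟩ : BB F) (1 : ℤ) := by simp
  rw [this, map_smul]
  simp

/-- induction operators -/
def hh (l : MulChar F ℂ) (k : ℤ) : Module.End ℤ (BB F →₀ ℤ) :=
  if 0 ≤ k then Finsupp.linearCombination ℤ (fun b : BB F => fib (b.1 + k.toNat) (MM l k.toNat b)) else 0

/-- restriction operators -/
def ee (l : MulChar F ℂ) (r : ℕ) : Module.End ℤ (BB F →₀ ℤ) :=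
  Finsupp.linearCombination ℤ (fun c : BB F => if r ≤ c.1 then fib (c.1 - r) (fun b => MM l r b c) else 0)

lemma hh_single (l : MulChar F ℂ) (r : ℕ) (b : BB F) :
    hh l r (Finsupp.single b 1) = fib (b.1 + r) (MM l r b) := by
  simp [hh]

lemma ee_single (l : MulChar F ℂ) (r : ℕ) (c : BB F) :
    ee l r (Finsupp.single c 1) = if r ≤ c.1 then fib (c.1 - r) (fun b => MM l r b c) else 0 := by
  simp [ee]

lemma hh_apply (l : MulChar F ℂ) (r : ℕ) (b c : BB F) :
    hh l r (Finsupp.single b 1) c = MM l r b c := by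
  rw [hh_single, fib_apply]
  split_ifs with h
  · rfl
  · rw [MM_dim _ _ _ _ h]

lemma ee_apply (l : MulChar F ℂ) (r : ℕ) (b c : BB F) :
    ee l r (Finsupp.single c 1) b = MM l r b c := by
  rw [ee_single]
  split_ifs with h
  · rw [fib_apply]
    split_ifs with h'
    · rfl
    · rw [MM_dim _ _ _ _ (by omega)]
  · rw [MM_dim _ _ _ _ (by omega)]; rfl

lemma end_ext {B : Type} (S T : Module.End ℤ (B →₀ ℤ))
    (h : ∀ b b', S (Finsupp.single b 1) b' = T (Finsupp.single b 1) b') : S = T := by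
  refine Finsupp.lhom_ext' fun b => LinearMap.ext_ring ?_
  exact Finsupp.ext fun b' => h b b'

lemma ee_hh (l l' : MulChar F ℂ) (s t : ℕ) (b b' : BB F) :
    ee l t (hh l' s (Finsupp.single b 1)) b' =
      ∑ c : Irr (GL (Fin (b.1 + s)) F), MM l' s b ⟨_, c⟩ * MM l t b' ⟨_, c⟩ := by
  rw [hh_single, map_fib]
  refine Finset.sum_congr rfl fun c _ => ?_
  rw [ee_apply]

lemma hh_ee (l l' : MulChar F ℂ) (s t : ℕ) (b b' : BB F) :
    hh l' s (ee l t (Finsupp.single b 1)) b' =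
      if t ≤ b.1 then ∑ c : Irr (GL (Fin (b.1 - t)) F), MM l t ⟨_, c⟩ b * MM l' s ⟨_, c⟩ b' else 0 := by
  rw [ee_single]
  split_ifs with h
  · rw [map_fib]
    refine Finset.sum_congr rfl fun c _ => ?_
    rw [hh_apply]
  · simp

lemma mack1 (l l' : MulChar F ℂ) (s t : ℕ) (b b' : BB F) :
    ee l t (hh l' s (Finsupp.single b 1)) b' =
    ∑ i ∈ Finset.range (t + 1), if l = l' ∨ i = 0 then
      (hh l' ((s : ℤ) - i) (ee l (t - i) (Finsupp.single b 1))) b' else 0 := by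
  have hR : ∀ i ∈ Finset.range (t + 1), (if l = l' ∨ i = 0 then
      (hh l' ((s : ℤ) - i) (ee l (t - i) (Finsupp.single b 1))) b' else 0) =
      if (l = l' ∨ i = 0) ∧ i ≤ s ∧ t ≤ b.1 + i then ∑ a : Irr (GL (Fin (b.1 + i - t)) F),
        MM l (t - i) ⟨_, a⟩ b * MM l' (s - i) ⟨_, a⟩ b' else 0 := by
    intro i hi
    have hi' : i ≤ t := by simpa [Nat.lt_succ_iff] using hi
    by_cases h1 : l = l' ∨ i = 0
    · by_cases h2 : i ≤ s
      · rw [if_pos h1, ← Nat.cast_sub h2, hh_ee]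
        by_cases h3 : t ≤ b.1 + i
        · rw [if_pos (by omega), if_pos ⟨h1, h2, h3⟩]
          have : b.1 - (t - i) = b.1 + i - t := by omega
          exact congrArg (fun K => ∑ a : Irr (GL (Fin K) F),
            MM l (t - i) ⟨K, a⟩ b * MM l' (s - i) ⟨K, a⟩ b') this
        · rw [if_neg (by omega), if_neg (by tauto)]
      · rw [if_pos h1, if_neg (by tauto), hh, if_neg (by omega)]
        rfl
    · rw [if_neg h1, if_neg (by tauto)]
  rw [Finset.sum_congr rfl hR, ee_hh]
  by_cases hd : b.1 + s = b'.1 + t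
  · have := mackey_full l l' s t b.2 b'.2 rfl hd
    simp only [MM]
    exact_mod_cast this
  · rw [Finset.sum_eq_zero, Finset.sum_eq_zero]
    · intro i hi
      have hi' : i ≤ t := by simpa [Nat.lt_succ_iff] using hi
      split_ifs with h
      · refine Finset.sum_eq_zero fun a _ => ?_
        rw [MM_dim l' (s - i) _ b', mul_zero]
        dsimp only
        omega
      · rfl
    · intro c _
      rw [MM_dim l t b', mul_zero]
      exact hd

lemma mack2 (l l' : MulChar F ℂ) (s t : ℕ) (v : BB F →₀ ℤ) :
    ee l t (hh l' s v) = ∑ i ∈ Finset.range (t + 1), if l = l' ∨ i = 0 then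
      hh l' ((s : ℤ) - i) (ee l (t - i) v) else 0 := by
  have key : ee l t ∘ₗ hh l' s = ∑ i ∈ Finset.range (t + 1), if l = l' ∨ i = 0 then
      hh l' ((s : ℤ) - i) ∘ₗ (ee l (t - i)) else 0 := by
    refine end_ext _ _ fun b b' => ?_
    rw [LinearMap.comp_apply, mack1, LinearMap.sum_apply, Finsupp.finset_sum_apply]
    refine Finset.sum_congr rfl fun i _ => ?_
    split_ifs <;> rfl
  have := LinearMap.congr_fun key v
  rw [LinearMap.comp_apply, LinearMap.sum_apply] at this
  rw [this]
  refine Finset.sum_congr rfl fun i _ => ?_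
  split_ifs <;> rfl

lemma phi_ne {q : ℕ} (hq : 2 ≤ q) (n : ℕ) : phi q n ≠ 0 := by
  refine Finset.prod_ne_zero_iff.mpr fun i _ => ?_
  have h1 : (1 : ℚ) < q := by exact_mod_cast hq
  have := one_lt_pow₀ h1 (Nat.succ_ne_zero i)
  exact ne_of_gt (by simpa using this)

lemma dim1 (l : MulChar F ℂ) (r : ℕ) (b : BB F) :
    (hh l r (Finsupp.single b 1)).sum (fun b x => (x : ℚ) * ((dg b : ℚ) / phi (Fintype.card F) b.1)) =
      (dg b : ℚ) / phi (Fintype.card F) b.1 / phi (Fintype.card F) r := by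
  have hq : 2 ≤ Fintype.card F := Fintype.one_lt_card
  have h0 := sum_mN_deg' l r b.2 rfl
  have e1 : ∀ c : Irr (GL (Fin (b.1 + r)) F), c.1 1 = (dg ⟨_, c⟩ : ℂ) := fun c => dg_eq ⟨_, c⟩
  rw [dg_eq b, Finset.sum_congr rfl (fun c _ => by rw [e1 c])] at h0
  have h1 : phi (Fintype.card F) b.1 * phi (Fintype.card F) r *
      ∑ c : Irr (GL (Fin (b.1 + r)) F), (mN l r b.2 c : ℚ) * (dg ⟨_, c⟩ : ℚ) =
      phi (Fintype.card F) (b.1 + r) * dg b := by exact_mod_cast h0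
  have h2 : (hh l r (Finsupp.single b 1)).sum (fun b x => (x : ℚ) * ((dg b : ℚ) / phi (Fintype.card F) b.1)) =
      ∑ c : Irr (GL (Fin (b.1 + r)) F), (mN l r b.2 c : ℚ) * ((dg ⟨_, c⟩ : ℚ) / phi (Fintype.card F) (b.1 + r)) := by
    rw [hh_single, fib, ← Finsupp.sum_finset_sum_index]
    · refine Finset.sum_congr rfl fun c _ => ?_
      rw [Finsupp.sum_single_index]
      · simp [MM]
      · simp
    · simp
    · intros; push_cast; ring
  rw [h2]
  simp only [← mul_div_assoc]
  rw [← Finset.sum_div]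
  have := phi_ne hq b.1
  have := phi_ne hq r
  have := phi_ne hq (b.1 + r)
  field_simp
  linarith

variable (F) in
/-- the positive self-adjoint Hopf structure -/
def ZZ : PSH (MulChar F ℂ) (BB F) (Fintype.card F) where
  deg b := b.1
  d := dg
  h := hh
  e := ee
  h_neg l k hk := by rw [hh, if_neg (by omega)]
  h_zero l := end_ext _ _ fun b b' => by
    have := hh_apply l 0 b b'
    rw [Nat.cast_zero] at this
    rw [this, MM_zero, Module.End.one_apply, Finsupp.single_apply]
  e_zero l := end_ext _ _ fun b b' => by
    rw [ee_apply, MM_zero, Module.End.one_apply, Finsupp.single_apply]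
    simp only [eq_comm]
  adj l r b b' := by rw [hh_apply, ee_apply]
  mackey l l' s t v := by
    rw [mack2]
    refine Finset.sum_congr rfl fun i _ => ?_
    congr
  deg_h l r b b' h := by
    by_contra hc
    exact h (by rw [hh_apply, MM_dim _ _ _ _ hc])
  pos l r b b' := by rw [hh_apply]; exact Int.natCast_nonneg _
  dpos := dg_pos
  dim := dim1

lemma hmodZ (m : ℕ) (hm : 1 ≤ m) (h3 : 3 ∣ Fintype.card F + 1) (b : BB F) (hb : b.1 = 2 * m + 1) (hd : ¬ 3 ∣ dg b) :
    ∃ (l : MulChar F ℂ) (ψ : BB F), ee l 1 (Finsupp.single b 1) ψ ≠ 0 ∧ ¬ 3 ∣ dg ψ := by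
  haveI : Fintype (MulChar F ℂ) := Fintype.ofFinite _
  obtain ⟨n, c⟩ := b
  dsimp at hb
  subst hb
  obtain ⟨Nn, hN⟩ := hmod_main (show 1 ≤ 2 * m by omega) c
  by_contra hcon
  push Not at hcon
  apply hd
  have e1 : ∀ b : Irr (GL (Fin (2 * m)) F), b.1 1 = (dg ⟨_, b⟩ : ℂ) := fun b => dg_eq ⟨_, b⟩
  have e2 : c.1 1 = (dg ⟨_, c⟩ : ℂ) := dg_eq ⟨_, c⟩
  simp only [e1, e2] at hN
  have hN' : (dg ⟨_, c⟩ : ℤ) = ∑ l : MulChar F ℂ, ∑ b : Irr (GL (Fin (2 * m)) F),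
      (mN l 1 b c : ℤ) * dg ⟨_, b⟩ + ((Fintype.card F : ℤ) ^ (2 * m) - 1) * Nn := by exact_mod_cast hN
  have : (3 : ℤ) ∣ (dg ⟨_, c⟩ : ℤ) := by
    rw [hN']
    refine dvd_add (Finset.dvd_sum fun l _ => Finset.dvd_sum fun b _ => ?_) (Dvd.dvd.mul_right ?_ _)
    · by_cases h0 : mN l 1 b c = 0
      · simp [h0]
      · refine Dvd.dvd.mul_left ?_ _
        have := hcon l ⟨_, b⟩ (by rw [ee_apply]; simpa [MM] using h0)
        exact_mod_cast this
    · rw [pow_mul]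
      have h4 : (3 : ℤ) ∣ (Fintype.card F : ℤ) + 1 := by exact_mod_cast h3
      have h5 : (3 : ℤ) ∣ (Fintype.card F : ℤ) ^ 2 - 1 := by
        have : (Fintype.card F : ℤ) ^ 2 - 1 = ((Fintype.card F : ℤ) + 1) * ((Fintype.card F : ℤ) - 1) := by ring
        rw [this]
        exact Dvd.dvd.mul_right h4 _
      have h6 := sub_dvd_pow_sub_pow ((Fintype.card F : ℤ) ^ 2) 1 m
      rw [one_pow] at h6
      exact h5.trans h6
  exact_mod_cast this

lemma irrCop_sub {G : Type} [Group G] {χ : G → ℂ} {p : ℕ} (h : χ ∈ IrrCoprime p G) : χ ∈ Irr G := by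
  obtain ⟨V, h1, h2, _⟩ := h
  exact ⟨V, h1, h2⟩

lemma irrCop_iff (n : ℕ) (χ : Irr (GL (Fin n) F)) : χ.1 ∈ IrrCoprime 3 (GL (Fin n) F) ↔ ¬ 3 ∣ dg (⟨n, χ⟩ : BB F) := by
  have h3 : ∀ k, Nat.Coprime k 3 ↔ ¬ 3 ∣ k := fun k => by
    rw [Nat.coprime_comm, Nat.Prime.coprime_iff_not_dvd Nat.prime_three]
  constructor
  · rintro ⟨V, h1, h2, h4⟩
    have := dg_eq (⟨n, χ⟩ : BB F)
    rw [← h3]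
    have h5 : (⟨n, χ⟩ : BB F).2.1 1 = (Module.finrank ℂ V : ℂ) := by
      dsimp only
      rw [← h2]
      exact FDRep.char_one V
    rw [h5] at this
    have h6 : Module.finrank ℂ V = dg (⟨n, χ⟩ : BB F) := by exact_mod_cast this
    rw [← h6]
    exact h4
  · intro h
    exact ⟨χ.2.choose, χ.2.choose_spec.1, χ.2.choose_spec.2, (h3 _).mpr h⟩

variable (F) in
/-- comparison of index sets -/
def cmpE (n : ℕ) : IrrCoprime 3 (GL (Fin n) F) ≃ {b : BB F // b.1 = n ∧ ¬ 3 ∣ dg b} :=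
  Equiv.ofBijective
    (fun χ => ⟨⟨n, ⟨χ.1, irrCop_sub χ.2⟩⟩, rfl, (irrCop_iff n ⟨χ.1, irrCop_sub χ.2⟩).mp χ.2⟩) (by
    constructor
    · intro χ χ' h
      have h1 := congrArg Subtype.val h
      have h2 := eq_of_heq (Sigma.mk.inj h1).2
      exact Subtype.ext (Subtype.mk.inj h2)
    · rintro ⟨⟨k, χ⟩, hk, hd⟩
      dsimp at hk
      subst hk
      exact ⟨⟨χ.1, (irrCop_iff k χ).mpr hd⟩, rfl⟩)

/-- one-dimensional representation -/
def oneM (l : MulChar F ℂ) : Representation ℂ Fˣ ℂ where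
  toFun u := (l u) • LinearMap.id
  map_one' := by simp; rfl
  map_mul' x y := by
    refine LinearMap.ext fun z => ?_
    simp only [Units.val_mul, map_mul, LinearMap.smul_apply, LinearMap.id_apply, Module.End.mul_apply, smul_eq_mul]
    ring

lemma oneM_char (l : MulChar F ℂ) (u : Fˣ) : (oneM l).character u = l u := by
  have : oneM l u = (l u) • LinearMap.id := rfl
  rw [Representation.character, this]
  simp

lemma oneM_irr (l : MulChar F ℂ) : (fun u : Fˣ => l u) ∈ Irr Fˣ := by
  have hc : FDRep.character (FDRep.of (oneM l)) = fun u : Fˣ => l u := by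
    funext u
    exact oneM_char l u
  refine ⟨FDRep.of (oneM l), ?_, hc⟩
  rw [FDRep.simple_iff_char_is_norm_one, hc]
  have : ∀ g : Fˣ, l g * l (g⁻¹ : Fˣ) = 1 := fun g => by
    rw [← map_mul]; simp
  rw [Finset.sum_congr rfl (fun g _ => this g)]
  simp [Nat.card_eq_fintype_card]

lemma mul_irr_bij : Function.Bijective (fun l : MulChar F ℂ => (⟨fun u : Fˣ => l u, oneM_irr l⟩ : Irr Fˣ)) := by
  constructor
  · intro l l' h
    refine MulChar.ext fun u => ?_
    exact congrFun (congrArg Subtype.val h) u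
  · haveI : Fintype (MulChar F ℂ) := Fintype.ofFinite _
    rintro ⟨χ, hχ⟩
    by_contra hcon
    have h0 : ∀ l : MulChar F ℂ, ∑ u : Fˣ, χ u * l⁻¹ (u : F) = 0 := by
      intro l
      have := irr_orth hχ (oneM_irr l)
      rw [if_neg (fun h => hcon ⟨l, Subtype.ext h.symm⟩)] at this
      rw [← this]
      refine Finset.sum_congr rfl fun u _ => ?_
      rw [MulChar.inv_apply_eq_inv']
      congr 1
      refine inv_eq_of_mul_eq_one_right ?_
      rw [← map_mul]
      simp
    have h1 : ∑ l : MulChar F ℂ, ∑ u : Fˣ, χ u * l⁻¹ (u : F) = 0 := Finset.sum_eq_zero fun l _ => h0 l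
    rw [Finset.sum_comm] at h1
    simp only [← Finset.mul_sum] at h1
    rw [Finset.sum_congr rfl (fun u _ => by rw [sum_lchar (u : F) u.ne_zero]), Finset.sum_eq_single 1] at h1
    · simp only [Units.val_one, if_true] at h1
      have h2 : ((Fintype.card F : ℂ) - 1) ≠ 0 := by
        have : Fintype.card F ≠ 1 := ne_of_gt Fintype.one_lt_card
        exact sub_ne_zero.mpr (by exact_mod_cast this)
      exact (mul_ne_zero (irr_one_ne hχ) h2) h1
    · intro u _ hu
      rw [if_neg (by simpa using hu), mul_zero]
    · simp

end final
end OEB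

/-- Let `m ≥ 1` and let `q` be a prime power with `3 ∣ q + 1`; let `F` be the field with `q`
elements.  Then there is a bijection between `Irr_{3'}(GL_{2m+1}(F))` and
`Irr(Fˣ) × Irr_{3'}(GL_{2m}(F))`. -/
theorem odd_even_bijection_GL (m q : ℕ) (hm : 1 ≤ m) (hq : IsPrimePow q) (h3 : 3 ∣ q + 1)
    (F : Type) [Field F] [Fintype F] (hF : Fintype.card F = q) :
    Nonempty ((IrrCoprime 3 (GL (Fin (2 * m + 1)) F)) ≃
      ((Irr Fˣ) × (IrrCoprime 3 (GL (Fin (2 * m)) F)))) := by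
  subst hF
  obtain ⟨E⟩ := OEB.PSH.abstract_main (OEB.ZZ F) Fintype.one_lt_card h3 m
    (fun b hb hd => OEB.hmodZ m hm h3 b hb hd)
  exact ⟨(OEB.cmpE F (2 * m + 1)).trans (E.trans
    (Equiv.prodCongr (Equiv.ofBijective _ OEB.mul_irr_bij) (OEB.cmpE F (2 * m)).symm))⟩
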